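/- arXiv:1411.4364 — 4 statements merged into one kernel-verified Lean document; each statement's English description precedes it below -/
import Mathlib

section
/- For every ε > 0 there exists a positive integer N such that the following holds for all n ≥ N: if G is a graph with n vertices and m ≤ n²/4 edges such that P_G(3) ≥ P_H(3) for every graph H with n vertices and m edges, then there exists an n-vertex graph G₀, consisting of a complete bipartite graph together with isolated vertices, such that G is ε·n²-close to G₀. -/
open SimpleGraph

/-- Number of proper `q`-colorings of a graph on `Fin n`. -/
noncomputable def numColorings (q : ℕ) {n : ℕ} (G : SimpleGraph (Fin n)) : ℕ :=
  Nat.card { f : Fin n → Fin q // ∀ v w, G.Adj v w → f v ≠ f w }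

/-- Number of edges of a graph on `Fin n`. -/
noncomputable def numEdges {n : ℕ} (G : SimpleGraph (Fin n)) : ℕ :=
  Nat.card G.edgeSet

/-- `G` is `d`-close to `H`: some isomorphic copy `G'` of `G` differs from `H`
in at most `d` edges (edit distance at most `d`). -/
def EditClose {n : ℕ} (d : ℝ) (G H : SimpleGraph (Fin n)) : Prop :=
  ∃ G' : SimpleGraph (Fin n), Nonempty (G ≃g G') ∧
    (Nat.card ↥(symmDiff G'.edgeSet H.edgeSet) : ℝ) ≤ d

/-- `G₀` consists of a complete bipartite graph together with isolated vertices. -/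
def IsCompleteBipartitePlusIsolated {n : ℕ} (G₀ : SimpleGraph (Fin n)) : Prop :=
  ∃ X Y : Finset (Fin n), X.Nonempty ∧ Y.Nonempty ∧ Disjoint X Y ∧
    ∀ v w, G₀.Adj v w ↔ ((v ∈ X ∧ w ∈ Y) ∨ (v ∈ Y ∧ w ∈ X))

/-! ### Containers for independent sets -/

open Classical in
/-- The vertices having a neighbour in `T`. -/
noncomputable def outerNbhd {V : Type*} [Fintype V] (G : SimpleGraph V) (T : Finset V) :
    Finset V :=
  {v | ∃ u ∈ T, G.Adj u v}

open Classical in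
/-- The vertices outside the neighbourhood of `T` that have at most `|V| / k` neighbours outside
the neighbourhood of `T`. -/
noncomputable def container {V : Type*} [Fintype V] (G : SimpleGraph V) (k : ℕ) (T : Finset V) :
    Finset V :=
  {v | v ∉ outerNbhd G T ∧
    k * (Finset.card {w | G.Adj v w ∧ w ∉ outerNbhd G T}) ≤ Fintype.card V}

open Classical in
/-- Every independent set lies in the container of one of its subsets with at most `k`
elements. -/
theorem exists_subset_container {V : Type*} [Fintype V] [Nonempty V] (G : SimpleGraph V) (k : ℕ)
    (I : Finset V) (hI : ∀ v ∈ I, ∀ w ∈ I, ¬ G.Adj v w) :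
    ∃ T : Finset V, T.card ≤ k ∧ I ⊆ container G k T := by
  obtain ⟨T, hT, hmax⟩ := Finset.exists_max_image
    (I.powerset.filter fun T => T.card * Fintype.card V ≤ k * (outerNbhd G T).card)
    Finset.card ⟨∅, by simp⟩
  simp only [Finset.mem_filter, Finset.mem_powerset] at hT hmax
  obtain ⟨hTI, hTc⟩ := hT
  refine ⟨T, ?_, fun v hv => ?_⟩
  · have h1 : (outerNbhd G T).card ≤ Fintype.card V := Finset.card_le_univ _
    have h2 : T.card * Fintype.card V ≤ k * Fintype.card V :=
      hTc.trans (Nat.mul_le_mul_left k h1)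
    exact Nat.le_of_mul_le_mul_right h2 Fintype.card_pos
  · have hvN : v ∉ outerNbhd G T := by
      simp only [outerNbhd, Finset.mem_filter, Finset.mem_univ, true_and, not_exists, not_and]
      exact fun u hu => hI u (hTI hu) v hv
    simp only [container, Finset.mem_filter, Finset.mem_univ, true_and]
    refine ⟨hvN, ?_⟩
    by_contra! hlt
    have hN : outerNbhd G (insert v T) = outerNbhd G T ∪
        ({w | G.Adj v w ∧ w ∉ outerNbhd G T} : Finset V) := by
      ext w
      simp only [outerNbhd, Finset.mem_filter, Finset.mem_univ, true_and, Finset.mem_union,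
        Finset.mem_insert, exists_eq_or_imp]
      by_cases h : ∃ a ∈ T, G.Adj a w <;> simp [h]
    have hdisj : Disjoint (outerNbhd G T)
        ({w | G.Adj v w ∧ w ∉ outerNbhd G T} : Finset V) := by
      rw [Finset.disjoint_left]
      intro w hw hw'
      simp only [Finset.mem_filter] at hw'
      exact hw'.2.2 hw
    have hvT : v ∉ T := by
      intro hvT
      have : ({w | G.Adj v w ∧ w ∉ outerNbhd G T} : Finset V) = ∅ := by
        ext w
        simp only [Finset.mem_filter, Finset.mem_univ, true_and, Finset.notMem_empty, iff_false,
          not_and, not_not]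
        intro hw
        simp only [outerNbhd, Finset.mem_filter, Finset.mem_univ, true_and]
        exact ⟨v, hvT, hw⟩
      rw [this] at hlt
      simp at hlt
    have := hmax (insert v T) ⟨Finset.insert_subset hv hTI, by
      rw [hN, Finset.card_union_of_disjoint hdisj, Finset.card_insert_of_notMem hvT]
      nlinarith⟩
    rw [Finset.card_insert_of_notMem hvT] at this
    omega

open Classical in
/-- Containers span few edges. -/
theorem mul_card_adj_container_le {V : Type*} [Fintype V] (G : SimpleGraph V) (k : ℕ)
    (T : Finset V) :
    k * (Finset.card {p : V × V | p.1 ∈ container G k T ∧ p.2 ∈ container G k T ∧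
      G.Adj p.1 p.2}) ≤ Fintype.card V ^ 2 := by
  have h1 : Finset.card {p : V × V | p.1 ∈ container G k T ∧ p.2 ∈ container G k T ∧
      G.Adj p.1 p.2} ≤ ∑ v ∈ container G k T,
        Finset.card {w | G.Adj v w ∧ w ∉ outerNbhd G T} := by
    rw [← Finset.card_sigma]
    refine Finset.card_le_card_of_injOn (fun p => ⟨p.1, p.2⟩) ?_ ?_
    · intro p hp
      simp only [Finset.coe_filter, Finset.mem_univ, true_and, Set.mem_ofPred_eq] at hp
      simp only [Finset.coe_sigma, Set.mem_sigma_iff, Finset.mem_coe, Finset.mem_filter,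
        Finset.mem_univ, true_and]
      refine ⟨hp.1, hp.2.2, ?_⟩
      have := hp.2.1
      simp only [container, Finset.mem_filter] at this
      exact this.2.1
    · rintro ⟨a, b⟩ - ⟨c, d⟩ - h
      simpa using h
  calc _ ≤ k * ∑ v ∈ container G k T, Finset.card {w | G.Adj v w ∧ w ∉ outerNbhd G T} :=
        Nat.mul_le_mul_left k h1
    _ = ∑ v ∈ container G k T, k * Finset.card {w | G.Adj v w ∧ w ∉ outerNbhd G T} :=
        Finset.mul_sum _ _ _
    _ ≤ ∑ v ∈ container G k T, Fintype.card V := by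
        refine Finset.sum_le_sum fun v hv => ?_
        simp only [container, Finset.mem_filter] at hv
        exact hv.2.2
    _ ≤ Fintype.card V ^ 2 := by
        rw [Finset.sum_const, smul_eq_mul, sq]
        exact Nat.mul_le_mul_right _ (Finset.card_le_univ _)

theorem card_filter_card_le {V : Type*} [Fintype V] [Nonempty V] (k : ℕ) :
    (Finset.univ.filter fun T : Finset V => T.card ≤ k).card ≤
      (k + 1) * Fintype.card V ^ k := by
  classical
  have : (Finset.univ.filter fun T : Finset V => T.card ≤ k) ⊆
      (Finset.range (k + 1)).biUnion fun j => Finset.powersetCard j Finset.univ := by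
    intro T hT
    simp only [Finset.mem_filter, Finset.mem_univ, true_and] at hT
    simp only [Finset.mem_biUnion, Finset.mem_range, Finset.mem_powersetCard_univ]
    exact ⟨_, by omega, rfl⟩
  refine (Finset.card_le_card this).trans ?_
  refine (Finset.card_biUnion_le_card_mul _ _ (Fintype.card V ^ k) fun j hj => ?_).trans
    (by simp)
  rw [Finset.card_powersetCard, Finset.card_univ]
  exact (Nat.choose_le_pow _ _).trans
    (Nat.pow_le_pow_right Fintype.card_pos (by simpa [Nat.lt_succ_iff] using hj))

open Classical in
/-- Up to a factor polynomial in `n`, the number of proper `q`-colorings is at most the number of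
colorings from lists such that few edges join vertices with intersecting lists. -/
theorem exists_lists {n : ℕ} [NeZero n] (q : ℕ) (G : SimpleGraph (Fin n)) (k : ℕ) :
    ∃ A : Fin n → Finset (Fin q),
      numColorings q G ≤ ((k + 1) * n ^ k) ^ q * ∏ v, (A v).card ∧
      k * (Finset.card {p : Fin n × Fin n | G.Adj p.1 p.2 ∧ ¬ Disjoint (A p.1) (A p.2)}) ≤
        q * n ^ 2 := by
  let S : Finset (Finset (Fin n)) := Finset.univ.filter fun T => T.card ≤ k
  let L : (Fin q → Finset (Fin n)) → Fin n → Finset (Fin q) :=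
    fun T v => {i | v ∈ container G k (T i)}
  have hcol : numColorings q G = (Finset.univ.filter fun f : Fin n → Fin q =>
      ∀ v w, G.Adj v w → f v ≠ f w).card := by
    rw [numColorings, Nat.card_eq_fintype_card, Fintype.card_subtype]
  have hsub : (Finset.univ.filter fun f : Fin n → Fin q => ∀ v w, G.Adj v w → f v ≠ f w) ⊆
      (Fintype.piFinset fun _ : Fin q => S).biUnion fun T => Fintype.piFinset (L T) := by
    intro f hf
    simp only [Finset.mem_filter, Finset.mem_univ, true_and] at hf
    have := fun i : Fin q => exists_subset_container G k {v | f v = i} (by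
      intro v hv w hw hadj
      simp only [Finset.mem_filter, Finset.mem_univ, true_and] at hv hw
      exact hf v w hadj (hv.trans hw.symm))
    choose T hT hc using this
    simp only [Finset.mem_biUnion, Fintype.mem_piFinset, S, L, Finset.mem_filter,
      Finset.mem_univ, true_and]
    exact ⟨T, hT, fun v => hc (f v) (by simp)⟩
  obtain ⟨T, hT, hmax⟩ := Finset.exists_max_image (Fintype.piFinset fun _ : Fin q => S)
    (fun T => ∏ v, (L T v).card) ⟨fun _ => ∅, by simp [S]⟩
  refine ⟨L T, ?_, ?_⟩
  · rw [hcol]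
    refine (Finset.card_le_card hsub).trans ?_
    refine (Finset.card_biUnion_le_card_mul _ _ _ fun T' hT' => ?_).trans
      (Nat.mul_le_mul_right _ ?_)
    · rw [Fintype.card_piFinset]
      exact hmax T' hT'
    · rw [Fintype.card_piFinset_const]
      exact Nat.pow_le_pow_left (by simpa using card_filter_card_le (V := Fin n) k) q
  · have : ({p : Fin n × Fin n | G.Adj p.1 p.2 ∧ ¬ Disjoint (L T p.1) (L T p.2)} : Finset _) ⊆
        Finset.univ.biUnion fun i : Fin q => {p : Fin n × Fin n | p.1 ∈ container G k (T i) ∧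
          p.2 ∈ container G k (T i) ∧ G.Adj p.1 p.2} := by
      intro p hp
      simp only [L, Finset.mem_filter, Finset.mem_univ, true_and, Finset.not_disjoint_iff] at hp
      simp only [Finset.mem_biUnion, Finset.mem_filter, Finset.mem_univ, true_and]
      obtain ⟨h, i, h1, h2⟩ := hp
      exact ⟨i, h1, h2, h⟩
    calc _ ≤ k * ∑ i : Fin q, Finset.card {p : Fin n × Fin n | p.1 ∈ container G k (T i) ∧
          p.2 ∈ container G k (T i) ∧ G.Adj p.1 p.2} :=
          Nat.mul_le_mul_left k ((Finset.card_le_card this).trans Finset.card_biUnion_le)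
      _ ≤ ∑ i : Fin q, n ^ 2 := by
          rw [Finset.mul_sum]
          refine Finset.sum_le_sum fun i _ => ?_
          have := mul_card_adj_container_le G k (T i)
          rw [Fintype.card_fin] at this
          exact le_trans (le_of_eq (by congr!)) this
      _ = q * n ^ 2 := by simp

/-! ### Bipartite competitors -/

/-- If `m ≤ x * y` and `x + y ≤ n` then some graph with `n` vertices and `m` edges has at least
`2 ^ y * 3 ^ (n - x - y)` proper `3`-colorings. -/
theorem exists_numColorings_ge {n m x y : ℕ} (hxy : x + y ≤ n) (hm : m ≤ x * y) :
    ∃ H : SimpleGraph (Fin n), numEdges H = m ∧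
      2 ^ y * 3 ^ (n - x - y) ≤ numColorings 3 H := by
  classical
  obtain ⟨X, -, hX⟩ := Finset.exists_subset_card_eq (s := (Finset.univ : Finset (Fin n)))
    (n := x) (by simp; omega)
  obtain ⟨Y, hYX, hY⟩ := Finset.exists_subset_card_eq (s := Xᶜ) (n := y)
    (by rw [Finset.card_compl, hX, Fintype.card_fin]; omega)
  have hdisj : ∀ v ∈ Y, v ∉ X := fun v hv => by simpa using hYX hv
  have hinj : Set.InjOn (fun p : Fin n × Fin n => s(p.1, p.2)) (X ×ˢ Y : Finset _) := by
    rintro ⟨a, b⟩ hab ⟨c, d⟩ hcd h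
    simp only [Finset.coe_product, Set.mem_prod, Finset.mem_coe] at hab hcd
    simp only [Sym2.eq_iff] at h
    rcases h with ⟨rfl, rfl⟩ | ⟨rfl, rfl⟩
    · rfl
    · exact absurd hab.1 (hdisj _ hcd.2)
  obtain ⟨E, hE, hEm⟩ := Finset.exists_subset_card_eq
    (s := (X ×ˢ Y).image fun p : Fin n × Fin n => s(p.1, p.2)) (n := m)
    (by rw [Finset.card_image_of_injOn hinj, Finset.card_product, hX, hY]; exact hm)
  have hbip : ∀ v w, s(v, w) ∈ E → (v ∈ X ∧ w ∈ Y) ∨ (w ∈ X ∧ v ∈ Y) := by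
    intro v w h
    have := hE h
    simp only [Finset.mem_image, Finset.mem_product, Prod.exists, Sym2.eq_iff] at this
    obtain ⟨a, b, hab, ⟨rfl, rfl⟩ | ⟨rfl, rfl⟩⟩ := this
    · exact Or.inl hab
    · exact Or.inr hab
  refine ⟨SimpleGraph.fromEdgeSet (E : Set (Sym2 (Fin n))), ?_, ?_⟩
  · have : (SimpleGraph.fromEdgeSet (E : Set (Sym2 (Fin n)))).edgeSet = E := by
      ext e
      induction e with
      | h v w =>
        simp only [SimpleGraph.mem_edgeSet, SimpleGraph.fromEdgeSet_adj, Finset.mem_coe,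
          and_iff_left_iff_imp]
        rintro h rfl
        rcases hbip _ _ h with h | h <;> exact hdisj _ h.2 h.1
    rw [numEdges, this]
    simpa using hEm
  · let A : Fin n → Finset (Fin 3) := fun v =>
      if v ∈ X then {0} else if v ∈ Y then {1, 2} else Finset.univ
    have hprod : ∏ v, (A v).card = 2 ^ y * 3 ^ (n - x - y) := by
      have : ∀ v, (A v).card = (if v ∈ Y then 2 else 1) * (if v ∈ (X ∪ Y)ᶜ then 3 else 1) := by
        intro v
        by_cases h1 : v ∈ X
        · have h2 : v ∉ Y := fun h => hdisj _ h h1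
          simp [A, h1, h2]
        · by_cases h2 : v ∈ Y <;> simp [A, h1, h2]
      simp_rw [this, Finset.prod_mul_distrib, Finset.prod_ite_mem, Finset.univ_inter,
        Finset.prod_const]
      rw [hY, Finset.card_compl, Finset.card_union_of_disjoint
        (Finset.disjoint_right.2 hdisj), hX, hY, Fintype.card_fin, Nat.sub_sub]
    rw [← hprod, ← Fintype.card_piFinset, numColorings, Nat.card_eq_fintype_card,
      Fintype.card_subtype]
    refine Finset.card_le_card fun f hf => ?_
    simp only [Fintype.mem_piFinset, A] at hf
    simp only [Finset.mem_filter, Finset.mem_univ, true_and, SimpleGraph.fromEdgeSet_adj]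
    rintro v w ⟨h, -⟩ heq
    have hv := hf v
    have hw := hf w
    rw [heq] at hv
    rcases hbip _ _ h with ⟨h1, h2⟩ | ⟨h1, h2⟩
    · rw [if_pos h1] at hv
      rw [if_neg (hdisj _ h2), if_pos h2, Finset.mem_singleton.1 hv] at hw
      exact absurd hw (by decide)
    · rw [if_pos h1] at hw
      rw [if_neg (hdisj _ h2), if_pos h2, Finset.mem_singleton.1 hw] at hv
      exact absurd hv (by decide)

theorem exists_mul_ge_of_mul_add_sq_ge {n m s x y : ℝ} (hs : 0 ≤ s) (hx : 0 ≤ x) (hy : 0 ≤ y)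
    (hxy : x + y ≤ n) (hm : m - s ^ 2 ≤ x * y) (hmn : 4 * m ≤ n ^ 2) :
    ∃ x' y' : ℝ, 0 ≤ x' ∧ 0 ≤ y' ∧ x' ≤ x + s ∧ y' ≤ y + s ∧ x' + y' ≤ n ∧ m ≤ x' * y' := by
  wlog h : x ≤ y generalizing x y
  · obtain ⟨y', x', h1, h2, h3, h4, h5, h6⟩ :=
      this hy hx (by linarith) (by linarith) (le_of_not_ge h)
    exact ⟨x', y', h2, h1, h4, h3, by linarith, by linarith⟩
  by_cases h1 : x + s + (y + s) ≤ n
  · exact ⟨x + s, y + s, by positivity, by positivity, le_rfl, le_rfl, h1, by nlinarith⟩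
  push Not at h1
  by_cases h2 : n / 2 ≤ x + s
  · exact ⟨n / 2, n / 2, by linarith, by linarith, h2, by linarith, by linarith, by nlinarith⟩
  · push Not at h2
    exact ⟨x + s, n - (x + s), by linarith, by linarith, le_rfl, by linarith, by linarith,
      by nlinarith⟩

theorem exists_nat_mul_ge {n m : ℕ} {x y : ℝ} (hx : 0 ≤ x) (hy : 0 ≤ y) (hxy : x + y ≤ n)
    (hm : (m : ℝ) ≤ x * y) (hmn : 4 * m ≤ n ^ 2) :
    ∃ X Y : ℕ, (X : ℝ) ≤ x + 1 ∧ (Y : ℝ) ≤ y + 1 ∧ X + Y ≤ n ∧ m ≤ X * Y := by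
  wlog h : x ≤ y generalizing x y
  · obtain ⟨Y, X, h1, h2, h3, h4⟩ := this hy hx (by linarith) (by linarith) (le_of_not_ge h)
    exact ⟨X, Y, h2, h1, by omega, by linarith⟩
  have hX := Nat.le_ceil x
  have hX' := Nat.ceil_lt_add_one hx
  have hY := Nat.le_ceil y
  have hY' := Nat.ceil_lt_add_one hy
  have hx2 : 2 * x ≤ n := by linarith
  by_cases h1 : ⌈x⌉₊ + ⌈y⌉₊ ≤ n
  · refine ⟨_, _, hX'.le, hY'.le, h1, ?_⟩
    have : (m : ℝ) ≤ (⌈x⌉₊ : ℝ) * ⌈y⌉₊ := hm.trans (mul_le_mul hX hY hy (by positivity))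
    exact_mod_cast this
  · have hXn : ⌈x⌉₊ ≤ n := Nat.ceil_le.2 (by linarith)
    obtain ⟨c, hc⟩ := Nat.exists_eq_add_of_le hXn
    have hcr : (n : ℝ) = ⌈x⌉₊ + c := by exact_mod_cast hc
    refine ⟨⌈x⌉₊, c, hX'.le, ?_, by omega, ?_⟩
    · have : (c : ℝ) ≤ ⌈y⌉₊ := by exact_mod_cast (by omega : c ≤ ⌈y⌉₊)
      linarith
    · by_cases h2 : ⌈x⌉₊ ≤ c
      · have h2r : (⌈x⌉₊ : ℝ) ≤ c := by exact_mod_cast h2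
        have : (m : ℝ) ≤ (⌈x⌉₊ : ℝ) * c := by nlinarith
        exact_mod_cast this
      · have h3 : ⌈x⌉₊ < c + 2 := by
          have : (⌈x⌉₊ : ℝ) < c + 2 := by linarith
          exact_mod_cast this
        have h4 : ⌈x⌉₊ = c + 1 := by omega
        rw [h4] at hc ⊢
        rw [hc] at hmn
        have : 4 * m ≤ 4 * ((c + 1) * c) + 1 := hmn.trans (by nlinarith)
        omega

/-- Stability for the optimization problem behind the theorem: if a weighting with single-color
lists of weights `t` and `d`, and two-color lists of total weight `b`, costs at most `L` more than
each feasible bipartite one, then `d` is small. -/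
theorem weight_le_of_cost_le {α β t d b n D m L : ℝ} (hβ : 0 < β) (hαβ : 5 * β ≤ 2 * α)
    (ht : 0 ≤ t) (hd : 0 ≤ d) (hdt : d ≤ 2 * t) (hb : 0 ≤ b) (hn : t + d + b ≤ n)
    (hm : m - D ≤ t * d + d ^ 2 / 4 + t * b) (hmn : 4 * m ≤ n ^ 2) (hD : 0 ≤ D)
    (hcost : ∀ x y : ℝ, 0 ≤ x → 0 ≤ y → x + y ≤ n → m - D ≤ x * y →
      α * (t + d) + β * b ≤ α * x + β * y + L) :
    β * d ≤ 20 * L := by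
  by_cases hbt : t ≤ b
  · have := hcost (t + d / 2) (b + d / 2) (by positivity) (by positivity) (by linarith)
      (by nlinarith)
    nlinarith
  push Not at hbt
  set E := t * d + d ^ 2 / 4 + t * b with hE
  have hE0 : 0 ≤ E := by positivity
  have hsq : Real.sqrt E ^ 2 = E := Real.sq_sqrt hE0
  have hs0 := Real.sqrt_nonneg E
  have key : (α + β) * Real.sqrt E ≤ α * (t + d) + β * b - β * d / 20 := by
    have hnn : 0 ≤ α * (t + d) + β * b - β * d / 20 := by nlinarith
    refine abs_le_of_sq_le_sq' ?_ hnn |>.2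
    rw [mul_pow, hsq, hE]
    obtain ⟨γ, hγ⟩ : ∃ γ, α = 5 / 2 * β + γ := ⟨α - 5 / 2 * β, by ring⟩
    have hγ0 : 0 ≤ γ := by linarith
    obtain ⟨e, rfl⟩ : ∃ e, t = b + e := ⟨t - b, by ring⟩
    have he : 0 ≤ e := by linarith
    subst hγ
    rw [← sub_nonneg]
    ring_nf
    positivity
  have hfin : α * (t + d) + β * b ≤ (α + β) * Real.sqrt E + L := by
    by_cases h2 : 2 * Real.sqrt E ≤ n
    · have := hcost (Real.sqrt E) (Real.sqrt E) hs0 hs0 (by linarith) (by nlinarith)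
      linarith
    · have := hcost (n / 2) (n / 2) (by linarith) (by linarith) (by linarith) (by nlinarith)
      nlinarith
  linarith

theorem mul_le_add_of_cost_le {α β a b₀ x y n m D L : ℝ} (hα : 0 < α) (hβ : 0 ≤ β)
    (hx : 0 ≤ x) (hxa : x ≤ a) (hy : 0 ≤ y) (hyb : y ≤ b₀) (hn : a + b₀ ≤ n) (hD : 0 ≤ D)
    (hm : 0 ≤ m) (hL : 0 ≤ L)
    (hcost : ∀ x y : ℝ, 0 ≤ x → 0 ≤ y → x + y ≤ n → m - D ≤ x * y →
      α * a + β * b₀ ≤ α * x + β * y + L) :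
    α * (x * y - m) ≤ n * L := by
  by_cases h : x * y ≤ m
  · have : 0 ≤ n * L := mul_nonneg (by linarith) hL
    nlinarith
  push Not at h
  have hy0 : 0 < y := by
    rcases hy.eq_or_lt with h0 | h0
    · rw [← h0] at h; linarith
    · exact h0
  have h1 : m / y ≤ x := by rw [div_le_iff₀ hy0]; exact h.le
  have h2 := hcost (m / y) y (by positivity) hy (by linarith)
    (by rw [div_mul_cancel₀ _ hy0.ne']; linarith)
  have h3 : α * (x - m / y) ≤ L := by nlinarith
  have h4 : α * (x * y - m) = y * (α * (x - m / y)) := by field_simp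
  rw [h4]
  exact mul_le_mul (by linarith) h3 (mul_nonneg hα.le (by linarith)) (by linarith)

/-! ### Graphs and lists of colors -/

/-- The vertices with list `S`. -/
def listClass {n q : ℕ} (A : Fin n → Finset (Fin q)) (S : Finset (Fin q)) : Finset (Fin n) :=
  {v | A v = S}

theorem mem_listClass {n q : ℕ} {A : Fin n → Finset (Fin q)} {S : Finset (Fin q)} {v : Fin n} :
    v ∈ listClass A S ↔ A v = S := by
  simp [listClass]

open Classical in
/-- The ordered pairs of adjacent vertices whose lists intersect. -/
noncomputable def clashes {n q : ℕ} (G : SimpleGraph (Fin n)) (A : Fin n → Finset (Fin q)) :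
    Finset (Fin n × Fin n) :=
  {p | G.Adj p.1 p.2 ∧ ¬ Disjoint (A p.1) (A p.2)}

set_option synthInstance.maxSize 512 in
theorem disjoint_lists_cases : ∀ S T : Finset (Fin 3), S.Nonempty → T.Nonempty → Disjoint S T →
    (∃ l, S = {l} ∧ T = {l}ᶜ) ∨ (∃ l, T = {l} ∧ S = {l}ᶜ) ∨
    (S = {0} ∧ T = {1}) ∨ (T = {0} ∧ S = {1}) ∨ (S = {0} ∧ T = {2}) ∨ (T = {0} ∧ S = {2}) ∨
    (S = {1} ∧ T = {2}) ∨ (T = {1} ∧ S = {2}) := by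
  decide

theorem disjoint_lists_cases_of_color : ∀ (i : Fin 3) (S T : Finset (Fin 3)), S.Nonempty →
    T.Nonempty → Disjoint S T →
    (S = {i} ∧ T = {i}ᶜ) ∨ (T = {i} ∧ S = {i}ᶜ) ∨ (∃ l, l ≠ i ∧ S = {l}) ∨
    (∃ l, l ≠ i ∧ T = {l}) := by
  decide

theorem card_image_mk_product_le {n : ℕ} (X Y : Finset (Fin n)) :
    ((X ×ˢ Y).image fun p : Fin n × Fin n => s(p.1, p.2)).card ≤ X.card * Y.card :=
  Finset.card_image_le.trans (Finset.card_product X Y).le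

theorem mk_mem_image_product {n : ℕ} {X Y : Finset (Fin n)} {v w : Fin n} :
    s(v, w) ∈ ((X ×ˢ Y).image fun p : Fin n × Fin n => s(p.1, p.2)) ↔
      (v ∈ X ∧ w ∈ Y) ∨ (v ∈ Y ∧ w ∈ X) := by
  simp only [Finset.mem_image, Finset.mem_product, Prod.exists, Sym2.eq_iff]
  constructor
  · rintro ⟨a, b, ⟨ha, hb⟩, ⟨rfl, rfl⟩ | ⟨rfl, rfl⟩⟩
    · exact Or.inl ⟨ha, hb⟩
    · exact Or.inr ⟨hb, ha⟩
  · rintro (⟨h1, h2⟩ | ⟨h1, h2⟩)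
    · exact ⟨v, w, ⟨h1, h2⟩, Or.inl ⟨rfl, rfl⟩⟩
    · exact ⟨w, v, ⟨h2, h1⟩, Or.inr ⟨rfl, rfl⟩⟩

theorem numEdges_le {n : ℕ} (G : SimpleGraph (Fin n)) (A : Fin n → Finset (Fin 3))
    (hA : ∀ v, (A v).Nonempty) :
    numEdges G ≤ (clashes G A).card +
      (∑ l, (listClass A {l}).card * (listClass A {l}ᶜ).card +
      ((listClass A {0}).card * (listClass A {1}).card +
      ((listClass A {0}).card * (listClass A {2}).card +
      (listClass A {1}).card * (listClass A {2}).card))) := by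
  classical
  let I : Finset (Fin n) → Finset (Fin n) → Finset (Sym2 (Fin n)) :=
    fun X Y => (X ×ˢ Y).image fun p => s(p.1, p.2)
  have hsub : G.edgeFinset ⊆ ((clashes G A).image fun p => s(p.1, p.2)) ∪
      ((Finset.univ.biUnion fun l => I (listClass A {l}) (listClass A {l}ᶜ)) ∪
      (I (listClass A {0}) (listClass A {1}) ∪ (I (listClass A {0}) (listClass A {2}) ∪
      I (listClass A {1}) (listClass A {2})))) := by
    intro e
    induction e with
    | h v w =>
      intro he
      rw [SimpleGraph.mem_edgeFinset, SimpleGraph.mem_edgeSet] at he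
      by_cases hd : Disjoint (A v) (A w)
      · refine Finset.mem_union_right _ ?_
        simp only [I, Finset.mem_union, Finset.mem_biUnion, Finset.mem_univ, true_and,
          mk_mem_image_product, mem_listClass]
        rcases disjoint_lists_cases _ _ (hA v) (hA w) hd with
          ⟨l, h⟩ | ⟨l, h⟩ | h | h | h | h | h | h
        · exact Or.inl ⟨l, Or.inl h⟩
        · exact Or.inl ⟨l, Or.inr h.symm⟩
        all_goals simp [h.1, h.2]
      · refine Finset.mem_union_left _ (Finset.mem_image.2 ⟨(v, w), ?_, rfl⟩)
        simp [clashes, he, hd]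
  have hcard : numEdges G = G.edgeFinset.card := by
    rw [numEdges, Nat.card_eq_fintype_card, SimpleGraph.edgeFinset_card]
  rw [hcard]
  refine (Finset.card_le_card hsub).trans ?_
  refine (Finset.card_union_le _ _).trans (add_le_add Finset.card_image_le ?_)
  refine (Finset.card_union_le _ _).trans (add_le_add ?_ ?_)
  · exact Finset.card_biUnion_le.trans
      (Finset.sum_le_sum fun l _ => card_image_mk_product_le _ _)
  refine (Finset.card_union_le _ _).trans (add_le_add (card_image_mk_product_le _ _) ?_)
  exact (Finset.card_union_le _ _).trans
    (add_le_add (card_image_mk_product_le _ _) (card_image_mk_product_le _ _))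

open Classical in
/-- All edges of `G` that do not clash and do not join the vertices with list `{i}` to those with
the complementary list meet a vertex whose list consists of a single other color. -/
theorem card_edgeFinset_sdiff_le {n : ℕ} (G : SimpleGraph (Fin n)) (A : Fin n → Finset (Fin 3))
    (hA : ∀ v, (A v).Nonempty) (i : Fin 3) :
    (G.edgeFinset \ (listClass A {i} ×ˢ listClass A {i}ᶜ).image
      fun p : Fin n × Fin n => s(p.1, p.2)).card ≤
      (clashes G A).card + (∑ l ∈ Finset.univ.erase i, (listClass A {l}).card) * n := by
  have hsub : (G.edgeFinset \ (listClass A {i} ×ˢ listClass A {i}ᶜ).image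
      fun p : Fin n × Fin n => s(p.1, p.2)) ⊆ ((clashes G A).image fun p => s(p.1, p.2)) ∪
      ((Finset.univ.erase i).biUnion fun l =>
        (listClass A {l} ×ˢ Finset.univ).image fun p : Fin n × Fin n => s(p.1, p.2)) := by
    intro e
    induction e with
    | h v w =>
      intro he
      rw [Finset.mem_sdiff, SimpleGraph.mem_edgeFinset, SimpleGraph.mem_edgeSet,
        mk_mem_image_product] at he
      simp only [mem_listClass] at he
      by_cases hd : Disjoint (A v) (A w)
      · refine Finset.mem_union_right _ ?_
        simp only [Finset.mem_biUnion, Finset.mem_univ, true_and, and_true, Finset.mem_erase,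
          mk_mem_image_product, mem_listClass]
        rcases disjoint_lists_cases_of_color i _ _ (hA v) (hA w) hd with
          h | h | ⟨l, hl, h⟩ | ⟨l, hl, h⟩
        · exact absurd (Or.inl h) he.2
        · exact absurd (Or.inr h.symm) he.2
        · exact ⟨l, hl, Or.inl h⟩
        · exact ⟨l, hl, Or.inr h⟩
      · refine Finset.mem_union_left _ (Finset.mem_image.2 ⟨(v, w), ?_, rfl⟩)
        simp [clashes, he.1, hd]
  refine (Finset.card_le_card hsub).trans ?_
  refine (Finset.card_union_le _ _).trans (add_le_add Finset.card_image_le ?_)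
  rw [Finset.sum_mul]
  refine Finset.card_biUnion_le.trans (Finset.sum_le_sum fun l _ => ?_)
  simpa using card_image_mk_product_le (listClass A {l}) Finset.univ

theorem log_card_list (S : Finset (Fin 3)) (hS : S.Nonempty) :
    Real.log S.card = Real.log 3 - ((∑ l, if S = {l} then Real.log 3 else 0) +
      ∑ l, if S = {l}ᶜ then Real.log (3 / 2) else 0) := by
  have h : ∀ S : Finset (Fin 3), S.Nonempty →
      (S.card = 1 ∧ (Finset.univ.filter fun l => S = {l}).card = 1 ∧
        (Finset.univ.filter fun l => S = {l}ᶜ).card = 0) ∨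
      (S.card = 2 ∧ (Finset.univ.filter fun l => S = {l}).card = 0 ∧
        (Finset.univ.filter fun l => S = {l}ᶜ).card = 1) ∨
      (S.card = 3 ∧ (Finset.univ.filter fun l => S = {l}).card = 0 ∧
        (Finset.univ.filter fun l => S = {l}ᶜ).card = 0) := by decide
  rw [← Finset.sum_filter, ← Finset.sum_filter, Finset.sum_const, Finset.sum_const]
  rcases h S hS with ⟨h1, h2, h3⟩ | ⟨h1, h2, h3⟩ | ⟨h1, h2, h3⟩ <;> rw [h1, h2, h3]
  · simp
  · rw [Real.log_div (by norm_num) (by norm_num)]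
    simp
  · simp

theorem log_prod_card_lists {n : ℕ} (A : Fin n → Finset (Fin 3)) (hA : ∀ v, (A v).Nonempty) :
    Real.log (∏ v, (A v).card : ℕ) = n * Real.log 3 -
      (Real.log 3 * ∑ l, ((listClass A {l}).card : ℝ) +
      Real.log (3 / 2) * ∑ l, ((listClass A {l}ᶜ).card : ℝ)) := by
  push_cast
  rw [Real.log_prod fun v _ => by simpa using (hA v).ne_empty]
  simp_rw [fun v => log_card_list (A v) (hA v)]
  rw [Finset.sum_sub_distrib, Finset.sum_add_distrib, Finset.sum_comm,
    Finset.sum_comm (f := fun v l => if A v = {l}ᶜ then Real.log (3 / 2) else 0)]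
  simp only [← Finset.sum_filter, Finset.sum_const, Finset.sum_mul, listClass, nsmul_eq_mul,
    Finset.card_univ, Fintype.card_fin, mul_comm (Real.log 3), mul_comm (Real.log (3 / 2))]

theorem sum_card_listClass_le {n : ℕ} (A : Fin n → Finset (Fin 3)) :
    ∑ l, (listClass A {l}).card + ∑ l, (listClass A {l}ᶜ).card ≤ n := by
  have h : ∀ S : Finset (Fin 3), (Finset.univ.filter fun l => S = {l}).card +
      (Finset.univ.filter fun l => S = {l}ᶜ).card ≤ 1 := by decide
  calc _ = ∑ v, ((Finset.univ.filter fun l => A v = {l}).card +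
        (Finset.univ.filter fun l => A v = {l}ᶜ).card) := by
        simp only [listClass, Finset.card_filter]
        rw [Finset.sum_add_distrib, Finset.sum_comm,
          Finset.sum_comm (f := fun l v => if A v = {l}ᶜ then 1 else 0)]
    _ ≤ ∑ v : Fin n, 1 := Finset.sum_le_sum fun v _ => h (A v)
    _ = n := by simp

/-! ### The structure of extremal graphs -/

theorem cost_le_of_lists {n m K : ℕ} {G : SimpleGraph (Fin n)}
    (hG : ∀ H : SimpleGraph (Fin n), numEdges H = m → numColorings 3 H ≤ numColorings 3 G)
    {A : Fin n → Finset (Fin 3)} (hA : ∀ v, (A v).Nonempty)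
    (hK : numColorings 3 G ≤ K * ∏ v, (A v).card) {x y : ℕ} (hxy : x + y ≤ n)
    (hm : m ≤ x * y) :
    Real.log 3 * ∑ l, ((listClass A {l}).card : ℝ) +
      Real.log (3 / 2) * ∑ l, ((listClass A {l}ᶜ).card : ℝ) ≤
      Real.log 3 * x + Real.log (3 / 2) * y + Real.log K := by
  obtain ⟨H, hH, hHc⟩ := exists_numColorings_ge hxy hm
  have h1 : 2 ^ y * 3 ^ (n - x - y) ≤ K * ∏ v, (A v).card := hHc.trans ((hG H hH).trans hK)
  have hpos : 0 < K * ∏ v, (A v).card := lt_of_lt_of_le (by positivity) h1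
  have hK0 : K ≠ 0 := (Nat.pos_of_mul_pos_right hpos).ne'
  have hP0 : (∏ v, (A v).card) ≠ 0 := (Nat.pos_of_mul_pos_left hpos).ne'
  have h2 : Real.log ((2 ^ y * 3 ^ (n - x - y) : ℕ) : ℝ) ≤
      Real.log ((K * ∏ v, (A v).card : ℕ) : ℝ) :=
    Real.log_le_log (by positivity) (by exact_mod_cast h1)
  rw [Nat.cast_mul K, Real.log_mul (by exact_mod_cast hK0) (by exact_mod_cast hP0),
    log_prod_card_lists A hA] at h2
  push_cast at h2
  rw [Real.log_mul (by positivity) (by positivity), Real.log_pow, Real.log_pow] at h2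
  have hcast : ((n - x - y : ℕ) : ℝ) = n - x - y := by
    rw [Nat.sub_sub, Nat.cast_sub hxy]
    push_cast
    ring
  rw [hcast] at h2
  rw [Real.log_div (by norm_num) (by norm_num)] at h2 ⊢
  linarith

theorem pair_products_le (a : Fin 3 → ℝ) (i : Fin 3) (hai : ∀ l, a l ≤ a i) :
    ∑ l ∈ Finset.univ.erase i, a l ≤ 2 * a i ∧
    a 0 * a 1 + (a 0 * a 2 + a 1 * a 2) ≤
      a i * ∑ l ∈ Finset.univ.erase i, a l + (∑ l ∈ Finset.univ.erase i, a l) ^ 2 / 4 := by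
  have h := Finset.add_sum_erase Finset.univ a (Finset.mem_univ i)
  rw [Fin.sum_univ_three] at h
  obtain ⟨d, hd⟩ : ∃ d, ∑ l ∈ Finset.univ.erase i, a l = d := ⟨_, rfl⟩
  rw [hd] at h ⊢
  obtain rfl : d = a 0 + a 1 + a 2 - a i := by linarith
  have h0 := hai 0
  have h1 := hai 1
  have h2 := hai 2
  clear h hd hai
  obtain rfl | rfl | rfl : i = 0 ∨ i = 1 ∨ i = 2 := by omega
  · exact ⟨by linarith, by nlinarith [sq_nonneg (a 1 - a 2)]⟩
  · exact ⟨by linarith, by nlinarith [sq_nonneg (a 0 - a 2)]⟩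
  · exact ⟨by linarith, by nlinarith [sq_nonneg (a 0 - a 1)]⟩

open Classical in
theorem exists_bipartite_approx {n m j : ℕ} [NeZero n] (hj : 0 < j) (hmn : 4 * m ≤ n ^ 2)
    (G : SimpleGraph (Fin n)) (hGm : numEdges G = m)
    (hG : ∀ H : SimpleGraph (Fin n), numEdges H = m → numColorings 3 H ≤ numColorings 3 G)
    (hn : Real.log (((3 * j ^ 2 + 1) * n ^ (3 * j ^ 2)) ^ 3 : ℕ) + 4 ≤ n / j) :
    ∃ X Y : Finset (Fin n), Disjoint X Y ∧
      ((G.edgeFinset \ (X ×ˢ Y).image fun p : Fin n × Fin n => s(p.1, p.2)).card : ℝ) ≤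
        301 * (n ^ 2 / j) ∧
      (X.card : ℝ) * Y.card ≤ m + 6 * (n ^ 2 / j) := by
  obtain ⟨A, hK, hbad⟩ := exists_lists 3 G (3 * j ^ 2)
  set K := ((3 * j ^ 2 + 1) * n ^ (3 * j ^ 2)) ^ 3 with hKdef
  have hA : ∀ v, (A v).Nonempty := by
    obtain ⟨X, Y, -, -, hXY, hm⟩ := exists_nat_mul_ge (n := n) (m := m) (x := n / 2) (y := n / 2)
      (by positivity) (by positivity) (by linarith)
      (by have : (4 * m : ℝ) ≤ n ^ 2 := by exact_mod_cast hmn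
          nlinarith) hmn
    obtain ⟨H, hH, hHc⟩ := exists_numColorings_ge hXY hm
    have hpos : 0 < K * ∏ v, (A v).card :=
      lt_of_lt_of_le (by positivity) (hHc.trans ((hG H hH).trans hK))
    intro v
    have := Finset.prod_ne_zero_iff.1 (Nat.pos_of_mul_pos_left hpos).ne' v (Finset.mem_univ v)
    exact Finset.card_ne_zero.1 this
  set α := Real.log 3 with hα
  set β := Real.log (3 / 2) with hβ
  have hβ1 : 1 / 3 ≤ β := by
    have := Real.one_sub_inv_le_log_of_pos (show (0 : ℝ) < 3 / 2 by norm_num)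
    norm_num at this ⊢
    linarith
  have hβ0 : 0 < β := by linarith
  have hαβ : 5 * β ≤ 2 * α := by
    have : Real.log ((3 / 2) ^ 5) ≤ Real.log (3 ^ 2) :=
      Real.log_le_log (by norm_num) (by norm_num)
    rw [Real.log_pow, Real.log_pow] at this
    exact_mod_cast this
  have hα0 : 0 < α := by linarith
  have hsum : α + β ≤ 7 / 2 := by
    rw [hα, hβ, ← Real.log_mul (by norm_num) (by norm_num)]
    have := Real.log_le_sub_one_of_pos (show (0 : ℝ) < 3 * (3 / 2) by norm_num)
    linarith
  have hjr : (1 : ℝ) ≤ j := by exact_mod_cast hj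
  have hjr0 : (0 : ℝ) < j := by linarith
  set s : ℝ := n / j with hs
  have hs0 : 0 ≤ s := by positivity
  have hsn : s ≤ n := div_le_self (by positivity) hjr
  have hns : (n : ℝ) ^ 2 / j = n * s := by rw [hs]; ring
  have hclash : ((clashes G A).card : ℝ) ≤ s ^ 2 := by
    have : ((3 * j ^ 2 * (clashes G A).card : ℕ) : ℝ) ≤ (3 * n ^ 2 : ℕ) := by
      exact_mod_cast hbad
    push_cast at this
    rw [hs, div_pow, le_div_iff₀ (by positivity)]
    linarith
  have hK1 : 0 ≤ Real.log K := Real.log_natCast_nonneg K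
  have hmnr : (4 * m : ℝ) ≤ n ^ 2 := by exact_mod_cast hmn
  obtain ⟨i, -, hi⟩ := Finset.exists_max_image (Finset.univ : Finset (Fin 3))
    (fun l => (listClass A {l}).card) Finset.univ_nonempty
  set a : Fin 3 → ℝ := fun l => ((listClass A {l}).card : ℝ) with ha
  set b : Fin 3 → ℝ := fun l => ((listClass A {l}ᶜ).card : ℝ) with hb
  have ha0 : ∀ l, 0 ≤ a l := fun l => by positivity
  have hb0 : ∀ l, 0 ≤ b l := fun l => by positivity
  have hai : ∀ l, a l ≤ a i := fun l =>
    Nat.cast_le.2 (hi l (Finset.mem_univ l))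
  have habn : ∑ l, a l + ∑ l, b l ≤ n := by
    simp only [ha, hb]
    exact_mod_cast sum_card_listClass_le A
  have hm : (m : ℝ) ≤ s ^ 2 + (∑ l, a l * b l + (a 0 * a 1 + (a 0 * a 2 + a 1 * a 2))) := by
    have : (m : ℝ) ≤ (clashes G A).card +
        (∑ l, a l * b l + (a 0 * a 1 + (a 0 * a 2 + a 1 * a 2))) := by
      rw [← hGm]
      simp only [ha, hb]
      exact_mod_cast numEdges_le G A hA
    linarith
  set d : ℝ := ∑ l ∈ Finset.univ.erase i, a l with hd
  have hd0 : 0 ≤ d := Finset.sum_nonneg fun l _ => ha0 l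
  have had : ∑ l, a l = a i + d := (Finset.add_sum_erase _ _ (Finset.mem_univ i)).symm
  have hcost : ∀ x y : ℝ, 0 ≤ x → 0 ≤ y → x + y ≤ n → (m : ℝ) - s ^ 2 ≤ x * y →
      α * (a i + d) + β * ∑ l, b l ≤ α * x + β * y + 5 * s := by
    intro x y hx hy hxy hmxy
    obtain ⟨x', y', hx', hy', hxx, hyy, hxy', hm'⟩ :=
      exists_mul_ge_of_mul_add_sq_ge hs0 hx hy hxy hmxy hmnr
    obtain ⟨X, Y, hX, hY, hXY, hmXY⟩ := exists_nat_mul_ge hx' hy' hxy' hm' hmn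
    have h := cost_le_of_lists hG hA hK hXY hmXY
    have h1 : α * X ≤ α * (x + s + 1) := mul_le_mul_of_nonneg_left (by linarith) hα0.le
    have h2 : β * Y ≤ β * (y + s + 1) := mul_le_mul_of_nonneg_left (by linarith) hβ0.le
    have h3 : (α + β) * (s + 1) ≤ 7 / 2 * (s + 1) :=
      mul_le_mul_of_nonneg_right hsum (by linarith)
    rw [← had]
    linarith
  have hab : ∑ l, a l * b l ≤ a i * ∑ l, b l := by
    rw [Finset.mul_sum]
    exact Finset.sum_le_sum fun l _ => mul_le_mul_of_nonneg_right (hai l) (hb0 l)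
  have hdt := pair_products_le a i hai
  rw [← hd] at hdt
  have hbs : 0 ≤ ∑ l, b l := Finset.sum_nonneg fun l _ => hb0 l
  have hbi : b i ≤ ∑ l, b l := Finset.single_le_sum (fun l _ => hb0 l) (Finset.mem_univ i)
  have hdL := weight_le_of_cost_le hβ0 hαβ (ha0 i) hd0 hdt.1 hbs (by linarith)
    (by linarith [hdt.2]) hmnr (sq_nonneg s) hcost
  have hds : d ≤ 300 * s := by linarith [mul_le_mul_of_nonneg_right hβ1 hd0]
  have hprod := mul_le_add_of_cost_le hα0 hβ0.le (ha0 i) (by linarith) (hb0 i) hbi (by linarith)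
    (sq_nonneg s) (Nat.cast_nonneg m) (by positivity) hcost
  refine ⟨listClass A {i}, listClass A {i}ᶜ, ?_, ?_, ?_⟩
  · rw [Finset.disjoint_left]
    intro v hv hv'
    rw [mem_listClass] at hv hv'
    rw [hv] at hv'
    exact absurd hv' ((by decide : ∀ i : Fin 3, ({i} : Finset (Fin 3)) ≠ {i}ᶜ) i)
  · have h := card_edgeFinset_sdiff_le G A hA i
    have h' : ((G.edgeFinset \ (listClass A {i} ×ˢ listClass A {i}ᶜ).image
        fun p : Fin n × Fin n => s(p.1, p.2)).card : ℝ) ≤ (clashes G A).card + d * n := by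
      simp only [hd, ha]
      exact_mod_cast h
    have h1 : s ^ 2 ≤ n * s := by rw [sq]; exact mul_le_mul_of_nonneg_right hsn hs0
    have h2 : d * n ≤ 300 * s * n := mul_le_mul_of_nonneg_right hds (hs0.trans hsn)
    rw [hns]
    linarith
  · rw [hns]
    change a i * b i ≤ _
    have h0 : 0 ≤ n * s := mul_nonneg (hs0.trans hsn) hs0
    by_contra! hlt
    have h1 : 5 / 6 * (a i * b i - m) ≤ α * (a i * b i - m) :=
      mul_le_mul_of_nonneg_right (by linarith) (by linarith)
    linarith

theorem exists_completeBipartite {n : ℕ} {X Y : Finset (Fin n)} (hX : X.Nonempty)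
    (hY : Y.Nonempty) (hXY : Disjoint X Y) :
    ∃ G₀ : SimpleGraph (Fin n), IsCompleteBipartitePlusIsolated G₀ ∧
      G₀.edgeSet = ((X ×ˢ Y).image fun p : Fin n × Fin n => s(p.1, p.2) : Finset _) := by
  refine ⟨⟨fun v w => (v ∈ X ∧ w ∈ Y) ∨ (v ∈ Y ∧ w ∈ X), ?_, ?_⟩, ⟨X, Y, hX, hY, hXY, ?_⟩, ?_⟩
  · exact ⟨fun v w h => by
      rcases h with h | h
      · exact Or.inr h.symm
      · exact Or.inl h.symm⟩
  · exact ⟨fun v h => by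
      rcases h with h | h
      · exact Finset.disjoint_left.1 hXY h.1 h.2
      · exact Finset.disjoint_left.1 hXY h.2 h.1⟩
  · exact fun v w => Iff.rfl
  · ext e
    induction e with
    | h v w =>
      rw [SimpleGraph.mem_edgeSet, Finset.mem_coe, mk_mem_image_product]

open Classical in
theorem editClose_of_card_le {n : ℕ} {G G₀ : SimpleGraph (Fin n)} {E : Finset (Sym2 (Fin n))}
    (hE : G₀.edgeSet = E) {d : ℝ}
    (hd : ((G.edgeFinset \ E).card : ℝ) + (E \ G.edgeFinset).card ≤ d) : EditClose d G G₀ := by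
  refine ⟨G, ⟨SimpleGraph.Iso.refl⟩, le_trans ?_ hd⟩
  have : symmDiff G.edgeSet G₀.edgeSet = (symmDiff G.edgeFinset E : Finset _) := by
    rw [hE, Finset.coe_symmDiff, SimpleGraph.coe_edgeFinset]
  rw [this, Nat.card_coe_set_eq, Set.ncard_coe_finset]
  exact_mod_cast Finset.card_union_le _ _

theorem eventually_log_add_le (k j : ℕ) (hj : 0 < j) :
    ∀ᶠ n : ℕ in Filter.atTop, Real.log (((k + 1) * n ^ k) ^ 3 : ℕ) + 4 ≤ (n : ℝ) / j := by
  have hjr : (0 : ℝ) < j := by exact_mod_cast hj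
  have hlog := (Real.isLittleO_log_id_atTop.comp_tendsto
    (tendsto_natCast_atTop_atTop (R := ℝ))).def
    (show (0 : ℝ) < 1 / (2 * j * (3 * k + 1)) by positivity)
  filter_upwards [hlog, Filter.eventually_ge_atTop 1, (tendsto_natCast_atTop_atTop
    (R := ℝ)).eventually_ge_atTop (2 * j * (3 * Real.log (k + 1) + 4))] with n h1 h2 h3
  have hn : (0 : ℝ) < n := by exact_mod_cast h2
  simp only [Function.comp_apply, id_eq, Real.norm_eq_abs, Nat.abs_cast] at h1
  have h4 : Real.log n ≤ 1 / (2 * j * (3 * k + 1)) * n := (le_abs_self _).trans h1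
  have h4' : 0 ≤ Real.log n := Real.log_natCast_nonneg n
  push_cast
  rw [Real.log_pow, Real.log_mul (by positivity) (by positivity), Real.log_pow]
  have h5 : (3 * k + 1) * Real.log n ≤ n / (2 * j) := by
    calc (3 * (k : ℝ) + 1) * Real.log n ≤ (3 * k + 1) * (1 / (2 * j * (3 * k + 1)) * n) :=
          mul_le_mul_of_nonneg_left h4 (by positivity)
      _ = n / (2 * j) := by field_simp
  have h6 : 3 * Real.log (k + 1) + 4 ≤ n / (2 * j) := by
    rw [le_div_iff₀ (by positivity)]
    linarith
  have h7 : (n : ℝ) / j = n / (2 * j) + n / (2 * j) := by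
    field_simp
    ring
  push_cast
  rw [h7]
  nlinarith

/-- Every extremal graph for the number of `3`-colorings with `n` vertices and at most
`n²/4` edges is `ε n²`-close to a complete bipartite graph plus isolated vertices. -/
theorem three_colorings_extremal (ε : ℝ) (hε : 0 < ε) :
    ∃ N : ℕ, 0 < N ∧ ∀ n : ℕ, N ≤ n → ∀ m : ℕ, 4 * m ≤ n ^ 2 →
      ∀ G : SimpleGraph (Fin n), numEdges G = m →
        (∀ H : SimpleGraph (Fin n), numEdges H = m →
          numColorings 3 H ≤ numColorings 3 G) →
        ∃ G₀ : SimpleGraph (Fin n), IsCompleteBipartitePlusIsolated G₀ ∧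
          EditClose (ε * (n : ℝ) ^ 2) G G₀ := by
  classical
  obtain ⟨j, hj⟩ := exists_nat_gt (610 / ε)
  have hjr : (0 : ℝ) < j := lt_trans (by positivity) hj
  have hj0 : 0 < j := by exact_mod_cast hjr
  obtain ⟨N, hN⟩ := Filter.eventually_atTop.1 (eventually_log_add_le (3 * j ^ 2) j hj0)
  refine ⟨N + 2, by omega, fun n hn m hmn G hGm hG => ?_⟩
  have : NeZero n := ⟨by omega⟩
  have hlog := hN n (by omega)
  obtain ⟨X, Y, hXY, hdiff, hprod⟩ := exists_bipartite_approx hj0 hmn G hGm hG hlog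
  have hε' : 610 * ((n : ℝ) ^ 2 / j) ≤ ε * n ^ 2 := by
    rw [div_lt_iff₀ hε] at hj
    rw [← mul_div_assoc, div_le_iff₀ hjr]
    nlinarith [sq_nonneg (n : ℝ)]
  have hone : (1 : ℝ) ≤ (n : ℝ) ^ 2 / j := by
    have h0 := Real.log_natCast_nonneg (((3 * j ^ 2 + 1) * n ^ (3 * j ^ 2)) ^ 3)
    have h1 : (4 : ℝ) ≤ n / j := by linarith
    have h2 : (1 : ℝ) ≤ n := by exact_mod_cast (by omega : 1 ≤ n)
    rw [sq, mul_div_assoc]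
    nlinarith
  have hcard : G.edgeFinset.card = m := by
    rw [← hGm, numEdges, Nat.card_eq_fintype_card, SimpleGraph.edgeFinset_card]
  set E := (X ×ˢ Y).image fun p : Fin n × Fin n => s(p.1, p.2) with hE
  by_cases hne : X.Nonempty ∧ Y.Nonempty
  · obtain ⟨G₀, hG₀, hedge⟩ := exists_completeBipartite hne.1 hne.2 hXY
    refine ⟨G₀, hG₀, editClose_of_card_le (E := E) hedge ?_⟩
    have h1 : ((E \ G.edgeFinset).card : ℝ) + G.edgeFinset.card =
        (G.edgeFinset \ E).card + E.card := by
      have h := Finset.card_sdiff_add_card E G.edgeFinset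
      have h' := Finset.card_sdiff_add_card G.edgeFinset E
      rw [Finset.union_comm] at h'
      exact_mod_cast h.trans h'.symm
    have h2 : (E.card : ℝ) ≤ X.card * Y.card := by
      exact_mod_cast card_image_mk_product_le X Y
    rw [hcard] at h1
    linarith
  · have hE0 : E = ∅ := by
      rw [hE, Finset.image_eq_empty, Finset.product_eq_empty]
      simpa only [not_and_or, Finset.not_nonempty_iff_eq_empty] using hne
    rw [hE0, Finset.sdiff_empty] at hdiff
    have h01 : (⟨0, by omega⟩ : Fin n) ≠ ⟨1, by omega⟩ := by simp
    obtain ⟨G₀, hG₀, hedge⟩ := exists_completeBipartite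
      (Finset.singleton_nonempty (⟨0, by omega⟩ : Fin n))
      (Finset.singleton_nonempty (⟨1, by omega⟩ : Fin n)) (Finset.disjoint_singleton.2 h01)
    refine ⟨G₀, hG₀, editClose_of_card_le hedge ?_⟩
    refine (add_le_add (Nat.cast_le.2 (Finset.card_le_card Finset.sdiff_subset))
      (Nat.cast_le.2 ((Finset.card_le_card Finset.sdiff_subset).trans
        (card_image_mk_product_le _ _)))).trans ?_
    simp only [Finset.card_singleton]
    push_cast
    linarith
end

section
/- Let s, t, r be integers with t ≥ 2 and 50·t·log t ≤ r ≤ min{s/2, (3/2)·t²·(log t)²}, and set q = s·t + r. Then Lazebnik's conjecture is false for the pair (s,q): there exist a positive integer n divisible by s and a graph G with n vertices and the same number of edges as the Turán graph T_s(n) such that P_G(q) > P_{T_s(n)}(q). -/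
open SimpleGraph

/-- Lazebnik's conjecture is false for the pair `(s, q)`: for some `n` divisible by `s`,
some graph with `n` vertices and as many edges as the Turán graph `T_s(n)` has strictly
more proper `q`-colorings than `T_s(n)`. -/
def LazebnikFalseFor (s q : ℕ) : Prop :=
  ∃ n : ℕ, 0 < n ∧ s ∣ n ∧
    ∃ G : SimpleGraph (Fin n),
      numEdges G = numEdges (turanGraph n s) ∧
      numColorings q (turanGraph n s) < numColorings q G

/-- The complete multipartite graph with parts the fibers of `P`. -/
def partGraph {V ι : Type*} (P : V → ι) : SimpleGraph V := SimpleGraph.comap P ⊤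

lemma two_mul_numEdges_partGraph {n : ℕ} {ι : Type*} [Fintype ι] [DecidableEq ι]
    (P : Fin n → ι) :
    2 * numEdges (partGraph P) + ∑ i, (Finset.univ.filter fun v => P v = i).card ^ 2 = n ^ 2 := by
  classical
  have h1 : numEdges (partGraph P) = (partGraph P).edgeFinset.card := by
    rw [numEdges, Nat.card_eq_fintype_card, SimpleGraph.edgeFinset_card]
  have h2 : ∑ i, (Finset.univ.filter fun v => P v = i).card ^ 2
      = ∑ v, (Finset.univ.filter fun w => P w = P v).card := by
    rw [← Finset.sum_fiberwise (s := Finset.univ) (g := P)]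
    refine Finset.sum_congr rfl fun i _ => ?_
    rw [Finset.sum_congr rfl (g := fun _ => (Finset.univ.filter fun w => P w = i).card)]
    · simp [sq]
    · intro v hv
      simp only [Finset.mem_filter, Finset.mem_univ, true_and] at hv
      rw [hv]
  rw [h1, h2, ← SimpleGraph.sum_degrees_eq_twice_card_edges, ← Finset.sum_add_distrib]
  have h3 : ∀ v, (partGraph P).degree v + (Finset.univ.filter fun w => P w = P v).card = n := by
    intro v
    have h : (partGraph P).neighborFinset v = Finset.univ.filter fun w => ¬ P w = P v := by
      ext w
      rw [SimpleGraph.mem_neighborFinset]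
      simp [partGraph, eq_comm]
    rw [← SimpleGraph.card_neighborFinset_eq_degree, h, add_comm,
      Finset.card_filter_add_card_filter_not]
    simp
  simp [h3, sq]

lemma exists_le_numEdges_eq {n k : ℕ} (G : SimpleGraph (Fin n)) (hk : k ≤ numEdges G) :
    ∃ H ≤ G, numEdges H = k := by
  classical
  have h1 : numEdges G = G.edgeFinset.card := by
    rw [numEdges, Nat.card_eq_fintype_card, SimpleGraph.edgeFinset_card]
  obtain ⟨S, hS, hc⟩ := Finset.exists_subset_card_eq (h1 ▸ hk)
  have hS' : (S : Set (Sym2 (Fin n))) ⊆ G.edgeSet := fun e he =>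
    SimpleGraph.mem_edgeFinset.1 (hS he)
  have he : (SimpleGraph.fromEdgeSet (S : Set (Sym2 (Fin n)))).edgeSet = S := by
    rw [SimpleGraph.edgeSet_fromEdgeSet, sdiff_eq_left, Set.disjoint_left]
    exact fun e he hd => G.not_isDiag_of_mem_edgeSet (hS' he) hd
  refine ⟨SimpleGraph.fromEdgeSet S, ?_, ?_⟩
  · rw [← SimpleGraph.edgeSet_subset_edgeSet, he]
    exact hS'
  · rw [numEdges, he]
    simp [hc]

lemma exists_card_fiber_eq {ι : Type*} [Fintype ι] [DecidableEq ι] (a : ι → ℕ) {n : ℕ}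
    (h : ∑ i, a i = n) :
    ∃ P : Fin n → ι, ∀ i, (Finset.univ.filter fun v => P v = i).card = a i := by
  have e : Fin n ≃ Σ i, Fin (a i) := Fintype.equivOfCardEq (by simp [h])
  refine ⟨fun v => (e v).1, fun i => ?_⟩
  have h1 : (Finset.univ.filter fun v => (e v).1 = i).card
      = (Finset.univ.filter fun x : Σ i, Fin (a i) => x.1 = i).card :=
    Finset.card_bij (fun v _ => e v) (by simp) (by simp)
      (fun x hx => ⟨e.symm x, by simpa using hx, by simp⟩)
  rw [h1, ← Fintype.card_subtype, Fintype.card_congr (Equiv.sigmaSubtype i)]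
  simp

lemma card_colorings_compatible {n q : ℕ} {ι : Type*} [Fintype ι] [DecidableEq ι]
    (P : Fin n → ι) (g : Fin q → ι) :
    Fintype.card {f : Fin n → Fin q // ∀ v, g (f v) = P v}
      = ∏ i, (Finset.univ.filter fun c => g c = i).card
          ^ (Finset.univ.filter fun v => P v = i).card := by
  rw [Fintype.card_congr (Equiv.subtypePiEquivPi (p := fun v c => g c = P v)), Fintype.card_pi,
    ← Finset.prod_fiberwise (s := Finset.univ) (g := P)]
  refine Finset.prod_congr rfl fun i _ => ?_
  rw [← Finset.prod_const]
  refine Finset.prod_congr rfl fun v hv => ?_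
  simp only [Finset.mem_filter, Finset.mem_univ, true_and] at hv
  rw [Fintype.card_subtype, hv]

lemma prod_pow_le_numColorings {n q : ℕ} {ι : Type*} [Fintype ι] [DecidableEq ι]
    (P : Fin n → ι) (g : Fin q → ι) {H : SimpleGraph (Fin n)} (hH : H ≤ partGraph P) :
    ∏ i, (Finset.univ.filter fun c => g c = i).card
          ^ (Finset.univ.filter fun v => P v = i).card ≤ numColorings q H := by
  classical
  rw [← card_colorings_compatible, numColorings, Nat.card_eq_fintype_card]
  refine Fintype.card_le_of_injective (fun f => ⟨f.1, fun v w hvw he => ?_⟩) ?_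
  · have h : P v ≠ P w := hH hvw
    exact h (by rw [← f.2 v, ← f.2 w, he])
  · intro f f' h
    exact Subtype.ext (Subtype.mk.inj h)

lemma numColorings_partGraph_le {n q : ℕ} {ι : Type*} [Fintype ι] [DecidableEq ι] [Nonempty ι]
    (P : Fin n → ι) {M B : ℕ} (hP : ∀ i, (Finset.univ.filter fun v => P v = i).card = M)
    (hB : ∀ g : Fin q → ι, ∏ i, (Finset.univ.filter fun c => g c = i).card ≤ B) :
    numColorings q (partGraph P) ≤ Fintype.card ι ^ q * B ^ M := by
  classical
  have hex : ∀ f : {f : Fin n → Fin q // ∀ v w, (partGraph P).Adj v w → f v ≠ f w},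
      ∃ g : Fin q → ι, ∀ v, g (f.1 v) = P v := by
    rintro ⟨f, hf⟩
    refine ⟨fun c => if h : ∃ v, f v = c then P h.choose else Classical.arbitrary ι, fun v => ?_⟩
    have h : ∃ w, f w = f v := ⟨v, rfl⟩
    simp only [h, dif_pos]
    by_contra hne
    exact hf _ _ hne h.choose_spec
  choose g hg using hex
  have h1 : numColorings q (partGraph P)
      ≤ Fintype.card (Σ g : Fin q → ι, {f : Fin n → Fin q // ∀ v, g (f v) = P v}) := by
    rw [numColorings, Nat.card_eq_fintype_card]
    refine Fintype.card_le_of_injective (fun f => ⟨g f, f.1, hg f⟩) ?_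
    intro f f' h
    have := congrArg (fun x => x.2.1) h
    exact Subtype.ext this
  refine h1.trans ?_
  rw [Fintype.card_sigma]
  refine (Finset.sum_le_card_nsmul _ _ (B ^ M) fun g _ => ?_).trans (by simp)
  rw [card_colorings_compatible]
  simp only [hP, Finset.prod_pow]
  exact Nat.pow_le_pow_left (hB g) M

/-- The logarithm lies below its chord through consecutive integers `t`, `t + 1`, at integers. -/
lemma natCast_le_mul_exp {t : ℕ} (ht : 0 < t) (k : ℕ) :
    (k : ℝ) ≤ t * Real.exp (Real.log (((t : ℝ) + 1) / t) * ((k : ℝ) - t)) := by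
  have ht' : (0 : ℝ) < t := by exact_mod_cast ht
  have hpos : (0 : ℝ) < ((t : ℝ) + 1) / t := by positivity
  rw [← Real.rpow_def_of_pos hpos]
  rcases le_total t k with h | h
  · obtain ⟨j, rfl⟩ := Nat.exists_eq_add_of_le h
    have hb := one_add_mul_le_pow (a := 1 / (t : ℝ))
      (by have : 0 < 1 / (t : ℝ) := by positivity
          linarith) j
    have e1 : ((t + j : ℕ) : ℝ) - t = (j : ℝ) := by push_cast; ring
    have e2 : ((t : ℝ) + 1) / t = 1 + 1 / t := by field_simp
    rw [e1, Real.rpow_natCast, e2]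
    calc ((t + j : ℕ) : ℝ) = t * (1 + j * (1 / t)) := by push_cast; field_simp
      _ ≤ _ := by gcongr
  · obtain ⟨j, rfl⟩ := Nat.exists_eq_add_of_le h
    set u : ℝ := ((k + j : ℕ) : ℝ) with hu
    have hk : (k : ℝ) = u - j := by rw [hu]; push_cast; ring
    have hb := one_add_mul_le_pow (a := -(1 / (u + 1)))
      (by have : 1 / (u + 1) ≤ 1 := by
            rw [div_le_one (by positivity)]; linarith
          linarith) j
    have e1 : (k : ℝ) - u = -(j : ℝ) := by rw [hk]; ring
    have e2 : ((u + 1) / u)⁻¹ = 1 + -(1 / (u + 1)) := by field_simp; ring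
    rw [e1, Real.rpow_neg hpos.le, Real.rpow_natCast, ← inv_pow, e2]
    calc (k : ℝ) = u * (1 - j * (1 / u)) := by rw [hk]; field_simp
      _ ≤ u * (1 + j * (-(1 / (u + 1)))) := by
        have : 1 / (u + 1) ≤ 1 / u := by gcongr; linarith
        have hj : (0 : ℝ) ≤ j := by positivity
        have := mul_le_mul_of_nonneg_left this hj
        exact mul_le_mul_of_nonneg_left (by linarith) ht'.le
      _ ≤ _ := by gcongr

lemma prod_le_of_sum_eq {s t r : ℕ} (ht : 0 < t) (hr : r ≤ s) (k : Fin s → ℕ)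
    (hk : ∑ i, k i = s * t + r) : ∏ i, k i ≤ t ^ (s - r) * (t + 1) ^ r := by
  have ht' : (0 : ℝ) < t := by exact_mod_cast ht
  have hpos : (0 : ℝ) < ((t : ℝ) + 1) / t := by positivity
  have hk' : ∑ i, (k i : ℝ) = s * t + r := by exact_mod_cast hk
  rw [← Nat.cast_le (α := ℝ)]
  push_cast
  calc ∏ i, (k i : ℝ)
      ≤ ∏ i, (t * Real.exp (Real.log (((t : ℝ) + 1) / t) * ((k i : ℝ) - t))) :=
        Finset.prod_le_prod (fun _ _ => by positivity) fun i _ => natCast_le_mul_exp ht (k i)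
    _ = t ^ s * (((t : ℝ) + 1) / t) ^ r := by
        rw [Finset.prod_mul_distrib, ← Real.exp_sum, ← Finset.mul_sum, Finset.sum_sub_distrib, hk']
        simp only [Finset.prod_const, Finset.sum_const, Finset.card_univ, Fintype.card_fin,
          nsmul_eq_mul]
        rw [add_sub_cancel_left, ← Real.rpow_def_of_pos hpos, Real.rpow_natCast]
    _ = t ^ (s - r) * ((t : ℝ) + 1) ^ r := by
        obtain ⟨j, rfl⟩ := Nat.exists_eq_add_of_le hr
        rw [Nat.add_sub_cancel_left, pow_add, div_pow]
        field_simp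

lemma exists_turanGraph_eq_partGraph {s M : ℕ} (hs : 0 < s) :
    ∃ P : Fin (M * s) → Fin s, turanGraph (M * s) s = partGraph P ∧
      ∀ i, (Finset.univ.filter fun v => P v = i).card = M := by
  refine ⟨fun v => ⟨v % s, Nat.mod_lt _ hs⟩, ?_, fun i => ?_⟩
  · ext v w
    simp [partGraph, turanGraph]
  · have h : (Finset.univ.filter fun v : Fin (M * s) => (⟨v % s, Nat.mod_lt _ hs⟩ : Fin s) = i)
        = Finset.univ.image fun a : Fin M => finProdFinEquiv (a, i) := by
      ext v
      obtain ⟨⟨a, b⟩, rfl⟩ := finProdFinEquiv.surjective v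
      simp [Fin.ext_iff, finProdFinEquiv, Nat.mod_eq_of_lt]
      refine ⟨fun hb => ⟨a, by rw [hb]⟩, fun ⟨c, hc⟩ => ?_⟩
      have hmod := congrArg (· % s) hc
      simpa [Nat.mod_eq_of_lt, eq_comm] using hmod
    rw [h, Finset.card_image_of_injective]
    · simp
    · intro a b hab
      simpa using hab

lemma exists_pow_gt {A B : ℕ} (h : B < A) (C : ℕ) : ∃ K, 0 < K ∧ C * B ^ K < A ^ K := by
  rcases Nat.eq_zero_or_pos B with rfl | hB
  · exact ⟨1, one_pos, by simpa using h⟩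
  · have hB' : (0 : ℝ) < B := by exact_mod_cast hB
    have h1 : (1 : ℝ) < A / B := by rw [one_lt_div hB']; exact_mod_cast h
    obtain ⟨K, hK⟩ := pow_unbounded_of_one_lt ((C : ℝ) + 1) h1
    refine ⟨K, ?_, ?_⟩
    · rcases Nat.eq_zero_or_pos K with rfl | hK0
      · have : (0 : ℝ) ≤ C := by positivity
        simp at hK
        linarith
      · exact hK0
    · rw [div_pow, lt_div_iff₀ (by positivity)] at hK
      have : (0 : ℝ) < (B : ℝ) ^ K := by positivity
      have : (C : ℝ) * B ^ K < A ^ K := by nlinarith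
      exact_mod_cast this

lemma numeric_bounds {t r : ℕ} (ht : 2 ≤ t)
    (h1 : 50 * (t : ℝ) * Real.log t ≤ (r : ℝ)) :
    (r : ℝ) ≥ 69 ∧
      10 * Real.log t < ((r : ℝ) - 5) * (Real.log (t + 1) - Real.log t) := by
  have ht' : (2 : ℝ) ≤ t := by exact_mod_cast ht
  have hL : 0.69 < Real.log t :=
    lt_of_lt_of_le (by linarith [Real.log_two_gt_d9]) (Real.log_le_log (by norm_num) ht')
  have hr : (69 : ℝ) ≤ r := by nlinarith
  refine ⟨hr, ?_⟩
  have hd : 1 / ((t : ℝ) + 1) ≤ Real.log (t + 1) - Real.log t := by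
    rw [← Real.log_div (by positivity) (by positivity)]
    have := Real.one_sub_inv_le_log_of_pos (x := ((t : ℝ) + 1) / t) (by positivity)
    refine le_trans (le_of_eq ?_) this
    field_simp
    ring
  refine lt_of_lt_of_le ?_ (mul_le_mul_of_nonneg_left hd (by linarith))
  rw [mul_one_div, lt_div_iff₀ (by positivity)]
  nlinarith

lemma prod_fin_ite_lt {α : Type*} [CommMonoid α] {w s : ℕ} (h : w ≤ s) (a b : α) :
    ∏ i : Fin s, (if (i : ℕ) < w then a else b) = a ^ w * b ^ (s - w) := by
  obtain ⟨u, rfl⟩ := Nat.exists_eq_add_of_le h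
  simp [Fin.prod_univ_add]

lemma sum_fin_ite_lt {w s : ℕ} (h : w ≤ s) (a b : ℕ) :
    ∑ i : Fin s, (if (i : ℕ) < w then a else b) = w * a + (s - w) * b := by
  obtain ⟨u, rfl⟩ := Nat.exists_eq_add_of_le h
  simp [Fin.sum_univ_add]

lemma sum_sq_sizes_le {s w u m : ℕ} (hs : s = w + u) (hw : 68 ≤ w) (hws : w + 2 ≤ u)
    (hm : m + 4 * (w + 1) + 6 = (w + 1) * s) :
    (10 * s) ^ 2 + (w * (m + 4 * s) ^ 2 + u * m ^ 2) ≤ s * ((w + 1) * s) ^ 2 := by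
  subst hs
  zify at *
  have hm' : (m : ℤ) = (w + 1) * (w + u) - 4 * (w + 1) - 6 := by linarith
  rw [hm']
  have key : ((w : ℤ) + u) * ((w + 1) * (w + u)) ^ 2 - ((10 * (w + u)) ^ 2
      + (w * ((w + 1) * (w + u) - 4 * (w + 1) - 6 + 4 * (w + u)) ^ 2
        + u * ((w + 1) * (w + u) - 4 * (w + 1) - 6) ^ 2))
      = ((w : ℤ) + u) * (20 * (w + 1) * (w + u) - 100 * (w + u) - 16 * w * u - 100) := by
    ring
  have hpos : (0 : ℤ) ≤ 20 * (w + 1) * (w + u) - 100 * (w + u) - 16 * w * u - 100 := by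
    nlinarith
  have := mul_nonneg (by positivity : (0 : ℤ) ≤ (w : ℤ) + u) hpos
  linarith

lemma prod_sizes_gt {s t w u m : ℕ} (ht : 2 ≤ t) (hs : s = w + u) (hw : 68 ≤ w)
    (hws : w + 2 ≤ u) (hm : m + 4 * (w + 1) + 6 = (w + 1) * s)
    (hlog : 10 * Real.log t < ((w : ℝ) + 1 - 5) * (Real.log (t + 1) - Real.log t)) :
    (t ^ (s - (w + 1)) * (t + 1) ^ (w + 1)) ^ ((w + 1) * s)
      < ((t + 1) ^ (m + 4 * s)) ^ w * (t ^ m) ^ (s - w) := by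
  have ht' : (0 : ℝ) < t := by exact_mod_cast (by omega : 0 < t)
  rw [← Nat.cast_lt (α := ℝ)]
  push_cast
  rw [← Real.log_lt_log_iff (by positivity) (by positivity), Real.log_pow,
    Real.log_mul (by positivity) (by positivity), Real.log_mul (by positivity) (by positivity)]
  simp only [Real.log_pow]
  rw [Nat.cast_sub (by omega), Nat.cast_sub (by omega)]
  have hm' : (m : ℝ) = (w + 1) * s - 4 * (w + 1) - 6 := by
    have : ((m + 4 * (w + 1) + 6 : ℕ) : ℝ) = ((w + 1) * s : ℕ) := by rw [hm]
    push_cast at this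
    linarith
  push_cast
  rw [hm']
  set L := Real.log (t : ℝ)
  set δ := Real.log ((t : ℝ) + 1) - L with hδ
  have hL : Real.log ((t : ℝ) + 1) = L + δ := by rw [hδ]; ring
  rw [hL]
  have hδ0 : 0 < δ := by
    rw [hδ, sub_pos]
    exact Real.log_lt_log ht' (by linarith)
  have hs2 : 2 * ((w : ℝ) + 1) ≤ s := by exact_mod_cast (by omega : 2 * (w + 1) ≤ s)
  have hs0 : (0 : ℝ) < s := by
    have : (0 : ℝ) ≤ w := by positivity
    linarith
  have hw' : (68 : ℝ) ≤ w := by exact_mod_cast hw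
  have h1 : (s : ℝ) * (w + 1 - 5) * δ ≤
      (w * ((w + 1) * s - 4 * (w + 1) - 6 + 4 * s) - (w + 1) ^ 2 * s) * δ := by
    refine mul_le_mul_of_nonneg_right ?_ hδ0.le
    nlinarith
  have h2 := mul_lt_mul_of_pos_left hlog hs0
  nlinarith

/-- If `t ≥ 2` and `50 t log t ≤ r ≤ min{s/2, (3/2) t² log² t}`, then Lazebnik's
conjecture is false for `(s, q)` where `q = s t + r`. -/
theorem counterexample_structured (s t r : ℕ) (ht : 2 ≤ t)
    (h1 : 50 * (t : ℝ) * Real.log t ≤ (r : ℝ))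
    (h2 : (r : ℝ) ≤ (s : ℝ) / 2)
    (h3 : (r : ℝ) ≤ 3 / 2 * (t : ℝ) ^ 2 * (Real.log t) ^ 2) :
    LazebnikFalseFor s (s * t + r) := by
  have ht0 : 0 < t := by omega
  obtain ⟨hr, hlog⟩ := numeric_bounds ht h1
  have hr69 : 69 ≤ r := by exact_mod_cast hr
  have hrs : 2 * r ≤ s := by
    have : (2 : ℝ) * r ≤ s := by linarith
    exact_mod_cast this
  obtain ⟨w, rfl⟩ : ∃ w, r = w + 1 := ⟨r - 1, by omega⟩
  obtain ⟨u, hu⟩ : ∃ u, s = w + u := ⟨s - w, by omega⟩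
  obtain ⟨m, hm⟩ : ∃ m, m + 4 * (w + 1) + 6 = (w + 1) * s :=
    ⟨(w + 1) * s - (4 * (w + 1) + 6), by
      have : 4 * (w + 1) + 6 ≤ (w + 1) * s := by nlinarith
      omega⟩
  have hws : w ≤ s := by omega
  have hs0 : 0 < s := by omega
  have hgt := prod_sizes_gt ht hu (by omega) (by omega) hm (by push_cast at hlog; exact hlog)
  have hsq := sum_sq_sizes_le hu (by omega) (by omega) hm
  obtain ⟨K, hK, hlt⟩ := exists_pow_gt hgt (s ^ (s * t + (w + 1)))
  have : Nonempty (Fin s) := ⟨⟨0, hs0⟩⟩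
  obtain ⟨T, hT, hTcard⟩ := exists_turanGraph_eq_partGraph (M := (w + 1) * s * K) hs0
  obtain ⟨P, hP⟩ := exists_card_fiber_eq (n := (w + 1) * s * K * s)
    (fun i : Option (Fin s) => i.elim (10 * s * K)
      fun i => if (i : ℕ) < w then (m + 4 * s) * K else m * K) (by
    simp only [Fintype.sum_option, Option.elim]
    rw [sum_fin_ite_lt hws]
    obtain rfl : u = s - w := by omega
    zify [hws] at hm ⊢
    linear_combination (s : ℤ) * K * hm)
  obtain ⟨g, hg⟩ := exists_card_fiber_eq (n := s * t + (w + 1))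
    (fun i : Option (Fin s) => i.elim 1 fun i => if (i : ℕ) < w then t + 1 else t) (by
    simp only [Fintype.sum_option, Option.elim]
    rw [sum_fin_ite_lt hws]
    zify [hws]
    ring)
  have hE : numEdges (turanGraph ((w + 1) * s * K * s) s) ≤ numEdges (partGraph P) := by
    have e1 := two_mul_numEdges_partGraph T
    have e2 := two_mul_numEdges_partGraph P
    rw [← hT] at e1
    simp only [hTcard, Finset.sum_const, Finset.card_univ, Fintype.card_fin, smul_eq_mul] at e1
    simp only [hP, Fintype.sum_option, Option.elim, apply_ite (fun x : ℕ => x ^ 2)] at e2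
    rw [sum_fin_ite_lt hws, show s - w = u by omega] at e2
    have := Nat.mul_le_mul_right (K ^ 2) hsq
    nlinarith
  obtain ⟨H, hHle, hH⟩ := exists_le_numEdges_eq _ hE
  refine ⟨(w + 1) * s * K * s, by positivity, dvd_mul_left _ _, H, hH, ?_⟩
  have hupper := numColorings_partGraph_le (q := s * t + (w + 1)) T hTcard
    (B := t ^ (s - (w + 1)) * (t + 1) ^ (w + 1)) fun g =>
      prod_le_of_sum_eq ht0 (by omega) _ (by
        rw [← Finset.card_eq_sum_card_fiberwise (fun _ _ => Finset.mem_coe.2 (Finset.mem_univ _))]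
        simp)
  have hlower := prod_pow_le_numColorings P g hHle
  rw [hT]
  refine hupper.trans_lt (lt_of_lt_of_le ?_ hlower)
  simp only [hP, hg, Fintype.prod_option, Option.elim]
  rw [Fintype.card_fin, pow_mul]
  refine hlt.trans_le (le_of_eq ?_)
  have : ∀ i : Fin s, (if (i : ℕ) < w then t + 1 else t)
      ^ (if (i : ℕ) < w then (m + 4 * s) * K else m * K)
      = if (i : ℕ) < w then ((t + 1) ^ (m + 4 * s)) ^ K else (t ^ m) ^ K := by
    intro i
    split_ifs <;> rw [pow_mul]
  simp only [this, prod_fin_ite_lt hws]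
  rw [one_pow, one_mul, mul_pow]
  ring
end

section
/- There exists an integer s₀ such that for every integer s ≥ s₀ and every integer q ≥ 100·s²/log s, a vector α ∈ FEAS_q(s) is a solution to OPT_q(s) if and only if α is an s-balanced vector for q; in other words, the s-balanced vectors are exactly the maximizers of OBJ_q over FEAS_q(s). -/
/-- The nonempty subsets of `[q] = Fin q`, indexing the coordinates of our vectors. -/
def NEsets (q : ℕ) : Finset (Finset (Fin q)) :=
  Finset.univ.filter (fun A => A.Nonempty)

/-- The objective function `OBJ_q(α) = Σ_{A ≠ ∅} α_A log |A|`. -/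
noncomputable def objQ (q : ℕ) (α : Finset (Fin q) → ℝ) : ℝ :=
  ∑ A ∈ NEsets q, α A * Real.log (A.card : ℝ)

/-- The constraint function `V_q(α) = Σ_{A ≠ ∅} α_A`. -/
noncomputable def vQ (q : ℕ) (α : Finset (Fin q) → ℝ) : ℝ :=
  ∑ A ∈ NEsets q, α A

/-- The constraint function `E_q(α) = Σ_{{A,B} : A ∩ B = ∅} α_A α_B`, the sum being
over unordered pairs of disjoint nonempty sets. -/
noncomputable def eQ (q : ℕ) (α : Finset (Fin q) → ℝ) : ℝ :=
  (1 / 2) * ∑ A ∈ NEsets q, ∑ B ∈ NEsets q,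
    if Disjoint A B then α A * α B else 0

/-- The feasible set `FEAS_q(s)`: nonnegative vectors (indexed by nonempty subsets of
`[q]`, so the coordinate at `∅` is normalized to `0`) with `V_q(α) = 1` and
`E_q(α) ≥ (s-1)/(2s)`. -/
def Feas (q : ℕ) (s : ℝ) (α : Finset (Fin q) → ℝ) : Prop :=
  α ∅ = 0 ∧ (∀ A, 0 ≤ α A) ∧ vQ q α = 1 ∧ (s - 1) / (2 * s) ≤ eQ q α

/-- `α` is a solution to `OPT_q(s)`: it is feasible and maximizes `OBJ_q` over
`FEAS_q(s)`. -/
def IsSolution (q : ℕ) (s : ℝ) (α : Finset (Fin q) → ℝ) : Prop :=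
  Feas q s α ∧ ∀ β, Feas q s β → objQ q β ≤ objQ q α

/-- The support of `α`: the nonempty sets `A ⊆ [q]` with `α_A > 0`. -/
noncomputable def supp (q : ℕ) (α : Finset (Fin q) → ℝ) : Finset (Finset (Fin q)) :=
  @Finset.filter _ (fun A => 0 < α A) (Classical.decPred _) (NEsets q)

/-- `P` is a partition of `[q]` into nonempty parts. -/
def IsPartitionOf (q : ℕ) (P : Finset (Finset (Fin q))) : Prop :=
  (∀ A ∈ P, A.Nonempty) ∧ (∀ A ∈ P, ∀ B ∈ P, A ≠ B → Disjoint A B) ∧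
    P.biUnion id = Finset.univ

/-- `SUPP_q(α)` is in class `P_k`: the support of `α` is a partition of `[q]`
into `k` nonempty sets. -/
def ClassP (q k : ℕ) (α : Finset (Fin q) → ℝ) : Prop :=
  IsPartitionOf q (supp q α) ∧ (supp q α).card = k

/-- `SUPP_q(α)` is in class `Q_k`: the support of `α` consists of a partition
`A₁, …, A_k` of `[q]` into `k` nonempty sets together with the set `A₁ ∪ A₂`. -/
def ClassQ (q k : ℕ) (α : Finset (Fin q) → ℝ) : Prop :=
  ∃ P : Finset (Finset (Fin q)), ∃ A₁ ∈ P, ∃ A₂ ∈ P, A₁ ≠ A₂ ∧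
    IsPartitionOf q P ∧ P.card = k ∧ supp q α = insert (A₁ ∪ A₂) P

/-- `α` is an `s`-balanced vector for `q`: its support is a partition of `[q]` into `s`
nonempty parts whose sizes differ by at most one, each carrying weight `1/s`. -/
def IsBalanced (q s : ℕ) (α : Finset (Fin q) → ℝ) : Prop :=
  ∃ P : Finset (Finset (Fin q)), IsPartitionOf q P ∧ P.card = s ∧
    (∀ A ∈ P, ∀ B ∈ P, |(A.card : ℤ) - (B.card : ℤ)| ≤ 1) ∧
    (∀ A ∈ P, α A = 1 / (s : ℝ)) ∧ (∀ A, A ∉ P → α A = 0)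

/-- Chord bound. -/
theorem log_div_le_chord {m a : ℕ} (hm : 0 < m) (ha : 0 < a) :
    Real.log (a / m) ≤ (a - m) * Real.log (1 + 1 / m) := by
  have hm' : (0 : ℝ) < m := by exact_mod_cast hm
  have ha' : (0 : ℝ) < a := by exact_mod_cast ha
  rcases le_total m a with h | h
  · obtain ⟨k, rfl⟩ := Nat.exists_eq_add_of_le h
    have h1 : 1 + (k : ℝ) * (1 / m) ≤ (1 + 1 / (m : ℝ)) ^ k :=
      one_add_mul_le_pow (by have : (0 : ℝ) ≤ 1 / m := by positivity
                             linarith) k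
    have h2 : ((m + k : ℕ) : ℝ) / m = 1 + (k : ℝ) * (1 / m) := by
      push_cast; field_simp
    have h3 : ((m + k : ℕ) : ℝ) - m = k := by push_cast; ring
    rw [h2, h3, ← Real.log_pow]
    exact Real.log_le_log (by positivity) h1
  · have h1 : Real.log (1 + 1 / (m : ℝ)) ≤ 1 / m := by
      have := Real.log_le_sub_one_of_pos (show (0 : ℝ) < 1 + 1 / m by positivity)
      linarith
    have h2 := Real.log_le_sub_one_of_pos (show (0 : ℝ) < a / m by positivity)
    have h3 : ((a : ℝ) - m) * (1 / m) ≤ (a - m) * Real.log (1 + 1 / m) :=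
      mul_le_mul_of_nonpos_left h1 (by have : (a : ℝ) ≤ m := by exact_mod_cast h
                                       linarith)
    have h4 : ((a : ℝ) - m) * (1 / m) = a / m - 1 := by field_simp
    linarith

theorem eq_or_eq_succ_of_log_div_eq_chord {m a : ℕ} (hm : 0 < m) (ha : 0 < a)
    (h : (a - m) * Real.log (1 + 1 / m) ≤ Real.log (a / m)) : a = m ∨ a = m + 1 := by
  have hm' : (0 : ℝ) < m := by exact_mod_cast hm
  have ha' : (0 : ℝ) < a := by exact_mod_cast ha
  by_contra! hne
  have hx : (0 : ℝ) < 1 / m := by positivity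
  rcases lt_or_gt_of_ne hne.1 with hlt | hgt
  · have hlt' : (a : ℝ) < m := by exact_mod_cast hlt
    have h1 : Real.log (1 + 1 / (m : ℝ)) < 1 / m := by
      have := Real.log_lt_sub_one_of_pos (show (0 : ℝ) < 1 + 1 / m by positivity) (by linarith)
      linarith
    have h2 := Real.log_le_sub_one_of_pos (show (0 : ℝ) < a / m by positivity)
    have h3 : ((a : ℝ) - m) * (1 / m) < (a - m) * Real.log (1 + 1 / m) :=
      mul_lt_mul_of_neg_left h1 (by linarith)
    have h4 : ((a : ℝ) - m) * (1 / m) = a / m - 1 := by field_simp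
    linarith
  · obtain ⟨k, rfl⟩ := Nat.exists_eq_add_of_le hgt.le
    have hk : 1 < k := by omega
    have h1 : 1 + (k : ℝ) * (1 / m) < (1 + 1 / (m : ℝ)) ^ k := by
      rw [← Real.rpow_natCast]
      exact one_add_mul_self_lt_rpow_one_add (by linarith) hx.ne' (by exact_mod_cast hk)
    have h2 : ((m + k : ℕ) : ℝ) / m = 1 + (k : ℝ) * (1 / m) := by
      push_cast; field_simp
    have h3 : ((m + k : ℕ) : ℝ) - m = k := by push_cast; ring
    rw [h2, h3, ← Real.log_pow] at h
    exact absurd (Real.log_lt_log (by positivity) h1) (not_lt.mpr h)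

/-- reciprocal of the slope of the chord -/
noncomputable def chordScale (m : ℕ) : ℝ := 1 / Real.log (1 + 1 / m)

theorem le_chordScale {m : ℕ} (hm : 0 < m) : (m : ℝ) ≤ chordScale m := by
  have hm' : (0 : ℝ) < m := by exact_mod_cast hm
  have hx : (0 : ℝ) < 1 / m := by positivity
  have h0 : 0 < Real.log (1 + 1 / (m : ℝ)) := Real.log_pos (by linarith)
  have h1 := Real.log_le_sub_one_of_pos (show (0 : ℝ) < 1 + 1 / m by positivity)
  rw [chordScale, le_div_iff₀ h0]
  calc (m : ℝ) * Real.log (1 + 1 / m) ≤ m * (1 / m) := by gcongr; linarith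
    _ = 1 := by field_simp

theorem chordScale_le {m : ℕ} (hm : 0 < m) : chordScale m ≤ m + 1 / 2 := by
  have hm' : (0 : ℝ) < m := by exact_mod_cast hm
  have hx : (0 : ℝ) < 1 / m := by positivity
  have h0 : 0 < Real.log (1 + 1 / (m : ℝ)) := Real.log_pos (by linarith)
  have h1 := Real.le_log_one_add_of_nonneg hx.le
  rw [chordScale, div_le_iff₀ h0]
  have h2 : 2 * (1 / (m : ℝ)) / (1 / m + 2) = 1 / (m + 1 / 2) := by field_simp; ring
  rw [h2] at h1
  calc (1 : ℝ) = (m + 1 / 2) * (1 / (m + 1 / 2)) := by field_simp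
    _ ≤ _ := by gcongr

theorem chordScale_mul_log_le {m a : ℕ} (hm : 0 < m) (ha : 0 < a) :
    chordScale m * Real.log (a / m) ≤ a - m := by
  have hm' : (0 : ℝ) < m := by exact_mod_cast hm
  have hx : (0 : ℝ) < 1 / m := by positivity
  have h0 : 0 < Real.log (1 + 1 / (m : ℝ)) := Real.log_pos (by linarith)
  have h1 := log_div_le_chord hm ha
  rw [chordScale, one_div, inv_mul_le_iff₀ h0]
  linarith

/-- The Lagrangian density. -/
noncomputable def density (m : ℕ) (a u : ℝ) : ℝ :=
  chordScale m * Real.log (a / m) + m + chordScale m - a / u - chordScale m * u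

theorem log_le_two_mul_sqrt_sub_one {x : ℝ} (hx : 0 < x) : Real.log x ≤ 2 * (√x - 1) := by
  have h := Real.log_le_sub_one_of_pos (Real.sqrt_pos.mpr hx)
  rw [Real.log_sqrt hx.le] at h
  linarith

theorem chordScale_mul_log_div_le {m : ℕ} (hm : 2 ≤ m) :
    chordScale m * Real.log (chordScale m / m) + m ≤ chordScale m + 1 / (3 * chordScale m) := by
  have hm' : (2 : ℝ) ≤ m := by exact_mod_cast hm
  have h1 := le_chordScale (show 0 < m by omega)
  have h2 := chordScale_le (show 0 < m by omega)
  set M := chordScale m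
  have hM : 0 < M := by linarith
  have h3 := Real.log_le_sub_one_of_pos (show (0 : ℝ) < M / m by positivity)
  have h4 : M * Real.log (M / m) ≤ M * (M / m - 1) := by gcongr
  have h5 : M * (M / m - 1) + m = M + (M - m) ^ 2 / m := by field_simp; ring
  have h6 : (M - m) ^ 2 / m ≤ 1 / (3 * M) := by
    rw [div_le_div_iff₀ (by linarith) (by linarith)]
    have : (M - m) ^ 2 ≤ 1 / 4 := by nlinarith
    nlinarith
  linarith

theorem density_le_neg_sq {m : ℕ} (hm : 2 ≤ m) {a u : ℝ} (ha : 0 < a) (hu : 0 < u) :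
    density m a u ≤ -chordScale m * ((√(a / (chordScale m * u)) - 1) ^ 2 + (√u - 1) ^ 2)
      + 1 / (3 * chordScale m) := by
  have h0 := chordScale_mul_log_div_le hm
  have hm' : (2 : ℝ) ≤ m := by exact_mod_cast hm
  have h1 := le_chordScale (show 0 < m by omega)
  unfold density
  set M := chordScale m
  have hM : 0 < M := by linarith
  have hy : 0 < a / (M * u) := by positivity
  have e : Real.log (a / m) = Real.log (a / (M * u)) + Real.log u + Real.log (M / m) := by
    rw [← Real.log_mul hy.ne' hu.ne', ← Real.log_mul (by positivity) (by positivity)]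
    congr 1; field_simp
  have l1 := log_le_two_mul_sqrt_sub_one hy
  have l2 := log_le_two_mul_sqrt_sub_one hu
  have s1 := Real.sq_sqrt hy.le
  have s2 := Real.sq_sqrt hu.le
  set P := √(a / (M * u))
  set Q := √u
  have h3 : a / u = M * P ^ 2 := by rw [s1]; field_simp
  have l3 : M * (Real.log (a / (M * u)) + Real.log u) ≤ M * (2 * (P - 1) + 2 * (Q - 1)) := by
    gcongr
  have h4 : M * u = M * Q ^ 2 := by rw [s2]
  rw [e]
  linarith

theorem density_le_of_big {m a : ℕ} (hm : 100 ≤ m) {u : ℝ}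
    (ha : |(a : ℝ) - chordScale m| ≤ 3 / 100 * chordScale m) (hu : |u - 1| ≤ 1 / 100) :
    density m a u ≤ 21 / 10 * |u - 1| - 1 / 50 * chordScale m * (u - 1) ^ 2 := by
  have hm' : (100 : ℝ) ≤ m := by exact_mod_cast hm
  have h1 := le_chordScale (show 0 < m by omega)
  have hM : 100 ≤ chordScale m := by linarith
  rw [abs_le] at ha
  have hu' := abs_le.mp hu
  have ha0 : (0 : ℝ) < a := by linarith
  have hu0 : 0 < u := by linarith
  by_cases h2 : |(a : ℝ) - chordScale m| ≤ 2
  · have hc := chordScale_mul_log_le (show 0 < m by omega) (show 0 < a by exact_mod_cast ha0)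
    unfold density
    set M := chordScale m
    have e : (a : ℝ) + M - a / u - M * u = ((a - M) * (u - 1) - M * (u - 1) ^ 2) / u := by
      field_simp; ring
    have h3 : ((a : ℝ) - M) * (u - 1) ≤ 2 * |u - 1| := by
      calc ((a : ℝ) - M) * (u - 1) ≤ |((a : ℝ) - M) * (u - 1)| := le_abs_self _
        _ = |(a : ℝ) - M| * |u - 1| := abs_mul _ _
        _ ≤ 2 * |u - 1| := by gcongr
    have h4 : ((a - M) * (u - 1) - M * (u - 1) ^ 2) / u
        ≤ 21 / 10 * |u - 1| - 1 / 50 * M * (u - 1) ^ 2 := by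
      rw [div_le_iff₀ hu0]
      have hp : 0 ≤ |u - 1| := abs_nonneg _
      have hq : 0 ≤ M * (u - 1) ^ 2 := by positivity
      nlinarith
    linarith
  · push Not at h2
    have h3 := density_le_neg_sq (show 2 ≤ m by omega) ha0 hu0
    set M := chordScale m
    have hM0 : 0 < M := by linarith
    have s1 := Real.sq_sqrt (show 0 ≤ (a : ℝ) / (M * u) by positivity)
    have s2 := Real.sq_sqrt hu0.le
    have p1 := Real.sqrt_nonneg ((a : ℝ) / (M * u))
    have p2 := Real.sqrt_nonneg u
    set P := √((a : ℝ) / (M * u))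
    set Q := √u
    have e : (a : ℝ) = M * (P * Q) ^ 2 := by rw [mul_pow, s1, s2]; field_simp
    have hPQ0 : 0 ≤ P * Q := by positivity
    set Z := P * Q with hZ
    have hZu : Z ^ 2 ≤ 103 / 100 := le_of_mul_le_mul_left (by linarith) hM0
    have hZl : 97 / 100 ≤ Z ^ 2 := le_of_mul_le_mul_left (by linarith) hM0
    have hZ1 : Z ≤ 102 / 100 := le_of_sq_le_sq (by linarith) (by norm_num)
    have hZ2 : 98 / 100 ≤ Z := le_of_sq_le_sq (by linarith) hPQ0
    have hQ1 : Q ≤ 1006 / 1000 := le_of_sq_le_sq (by linarith) (by norm_num)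
    have hQ2 : 994 / 1000 ≤ Q := le_of_sq_le_sq (by linarith) p2
    clear_value Z P Q M
    have hd : 2 < M * |Z ^ 2 - 1| := by
      rw [show M * |Z ^ 2 - 1| = |(a : ℝ) - M| by
        rw [e, show M * Z ^ 2 - M = M * (Z ^ 2 - 1) by ring, abs_mul, abs_of_pos hM0]]
      exact h2
    have hd2 : 4 < M ^ 2 * (Z ^ 2 - 1) ^ 2 := by
      rw [← sq_abs (Z ^ 2 - 1), ← mul_pow]
      nlinarith
    have hd3 : (Z ^ 2 - 1) ^ 2 ≤ (Z - 1) ^ 2 * (202 / 100) ^ 2 := by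
      rw [show Z ^ 2 - 1 = (Z - 1) * (Z + 1) by ring, mul_pow]
      gcongr; linarith
    have hd4 : (Z - 1) ^ 2 ≤ 204 / 100 * ((P - 1) ^ 2 + (Q - 1) ^ 2) := by
      have : Z - 1 = (P - 1) * Q + (Q - 1) := by rw [hZ]; ring
      rw [this]
      have t1 : ((P - 1) * Q + (Q - 1)) ^ 2 ≤ 2 * (((P - 1) * Q) ^ 2 + (Q - 1) ^ 2) := by
        linarith [sq_nonneg ((P - 1) * Q - (Q - 1))]
      have t2 : ((P - 1) * Q) ^ 2 ≤ (P - 1) ^ 2 * (102 / 100) := by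
        rw [mul_pow, s2]; gcongr; linarith
      linarith [sq_nonneg (Q - 1), sq_nonneg (P - 1)]
    have hd5 : (u - 1) ^ 2 ≤ 41 / 10 * (Q - 1) ^ 2 := by
      rw [← s2, show Q ^ 2 - 1 = (Q - 1) * (Q + 1) by ring, mul_pow]
      have : (Q + 1) ^ 2 ≤ (202 / 100) ^ 2 := by gcongr; linarith
      linarith [mul_le_mul_of_nonneg_left this (sq_nonneg (Q - 1)), sq_nonneg (Q - 1)]
    have hXQ : (Q - 1) ^ 2 ≤ (P - 1) ^ 2 + (Q - 1) ^ 2 := by linarith [sq_nonneg (P - 1)]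
    have hX0 : 0 ≤ (P - 1) ^ 2 + (Q - 1) ^ 2 := by positivity
    generalize (P - 1) ^ 2 + (Q - 1) ^ 2 = X at h3 hd4 hXQ hX0
    have hX : (Z ^ 2 - 1) ^ 2 ≤ 833 / 100 * X := by linarith
    have hG : 48 / 100 ≤ M ^ 2 * X := by
      have : M ^ 2 * (Z ^ 2 - 1) ^ 2 ≤ M ^ 2 * (833 / 100 * X) :=
        mul_le_mul_of_nonneg_left hX (by positivity)
      linarith
    have hG' : 1 / (3 * M) ≤ 9 / 10 * M * X := by
      rw [div_le_iff₀ (by positivity)]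
      linarith
    have hp : 0 ≤ |u - 1| := abs_nonneg _
    have h6 : M * (u - 1) ^ 2 ≤ M * (41 / 10 * X) :=
      mul_le_mul_of_nonneg_left (by linarith) hM0.le
    have hMX : 0 ≤ M * X := by positivity
    linarith

theorem density_le_of_not_big {m : ℕ} (hm : 1000 ≤ m) {a u : ℝ} (ha : 0 < a) (hu : 0 < u)
    (h : ¬ (|a - chordScale m| ≤ 3 / 100 * chordScale m ∧ |u - 1| ≤ 1 / 100)) :
    ∃ g : ℝ, density m a u ≤ - chordScale m * g ∧ 1 ≤ 500000 * g ∧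
      a / u ≤ 500000 * chordScale m * g ∧ u ≤ 500000 * g := by
  have hm' : (1000 : ℝ) ≤ m := by exact_mod_cast hm
  have h1 := le_chordScale (show 0 < m by omega)
  have hM : 1000 ≤ chordScale m := by linarith
  have h3 := density_le_neg_sq (show 2 ≤ m by omega) ha hu
  set M := chordScale m
  have hM0 : 0 < M := by linarith
  have s1 := Real.sq_sqrt (show 0 ≤ a / (M * u) by positivity)
  have s2 := Real.sq_sqrt hu.le
  have p1 := Real.sqrt_nonneg (a / (M * u))
  have p2 := Real.sqrt_nonneg u
  set P := √(a / (M * u))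
  set Q := √u
  have e : a = M * (P * Q) ^ 2 := by rw [mul_pow, s1, s2]; field_simp
  have hG : 16 / 1000000 ≤ (P - 1) ^ 2 + (Q - 1) ^ 2 := by
    by_contra! hc
    have hP : |P - 1| ≤ 4 / 1000 :=
      abs_le_of_sq_le_sq (by nlinarith [sq_nonneg (Q - 1)]) (by norm_num)
    have hQ : |Q - 1| ≤ 4 / 1000 :=
      abs_le_of_sq_le_sq (by nlinarith [sq_nonneg (P - 1)]) (by norm_num)
    rw [abs_le] at hP hQ
    have hl : 992 / 1000 ≤ P * Q := by nlinarith
    have hr : P * Q ≤ 1009 / 1000 := by nlinarith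
    have hl2 : (992 / 1000) ^ 2 ≤ (P * Q) ^ 2 := by gcongr
    have hr2 : (P * Q) ^ 2 ≤ (1009 / 1000) ^ 2 := by gcongr
    apply h
    constructor
    · rw [abs_le, e]
      constructor <;> nlinarith
    · rw [abs_le, ← s2]
      constructor <;> nlinarith
  set G := (P - 1) ^ 2 + (Q - 1) ^ 2 with hGdef
  have hM1 : 1 / (3 * M) ≤ M * G / 2 := by
    rw [div_le_iff₀ (by positivity)]
    have : 1000 * 1000 ≤ M * M := by gcongr
    nlinarith
  refine ⟨G / 2, by linarith, by linarith, ?_, ?_⟩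
  · have : a / u = M * P ^ 2 := by rw [s1]; field_simp
    rw [this]
    have : P ^ 2 ≤ 250000 * G := by nlinarith [sq_nonneg (P - 2), sq_nonneg (Q - 1)]
    nlinarith
  · rw [← s2]
    nlinarith [sq_nonneg (Q - 2), sq_nonneg (P - 1)]

theorem density_le_of_small {m : ℕ} (hm : 2 ≤ m) {a u : ℝ} (ha : 0 < a)
    (h : a ^ 2 ≤ chordScale m) :
    density m a u
      ≤ - (chordScale m * (Real.log (chordScale m) / 2 - 3)) - a / u - chordScale m * u := by
  have hm' : (2 : ℝ) ≤ m := by exact_mod_cast hm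
  have h1 := le_chordScale (show 0 < m by omega)
  have h0 := chordScale_mul_log_div_le hm
  unfold density
  set M := chordScale m
  have hM0 : 0 < M := by linarith
  have e : Real.log (a / m) = Real.log a - Real.log M + Real.log (M / m) := by
    rw [Real.log_div (by positivity) (by positivity), Real.log_div (by positivity) (by positivity)]
    ring
  have l : 2 * Real.log a ≤ Real.log M := by
    have := Real.log_le_log (by positivity) h
    rwa [Real.log_pow, Nat.cast_ofNat] at this
  have h5 : 1 / (3 * M) ≤ M := by
    rw [div_le_iff₀ (by positivity)]; nlinarith
  rw [e]
  nlinarith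

open Classical in
/-- The amount by which the weights `α B / c B` of the members of `Φ` containing `i` fall short
of a fractional cover of the point `i`. -/
noncomputable def shortage {ι : Type*} (Φ : Finset (Finset ι)) (α c : Finset ι → ℝ) (i : ι) : ℝ :=
  1 - ∑ B ∈ Φ with i ∈ B, α B / c B

section
variable {ι : Type*} [DecidableEq ι]

theorem shortage_eq (Φ : Finset (Finset ι)) (α c : Finset ι → ℝ) (i : ι) :
    shortage Φ α c i = 1 - ∑ B ∈ Φ with i ∈ B, α B / c B := by
  unfold shortage; congr!

theorem sum_filter_mem_eq {Φ : Finset (Finset ι)} {X : Finset ι} (f : Finset ι → ℝ) :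
    ∑ i ∈ X, ∑ B ∈ Φ with i ∈ B, f B = ∑ B ∈ Φ, ((B ∩ X).card : ℝ) * f B := by
  simp_rw [Finset.sum_filter]
  rw [Finset.sum_comm]
  refine Finset.sum_congr rfl fun B _ => ?_
  rw [← Finset.sum_filter, Finset.sum_const, nsmul_eq_mul, Finset.filter_mem_eq_inter,
    Finset.inter_comm]

theorem shortage_nonneg {Φ : Finset (Finset ι)} {α c : Finset ι → ℝ} {i : ι}
    (hα : ∀ B ∈ Φ, 0 < α B)
    (hc : ∀ B ∈ Φ, i ∈ B → ∑ C ∈ Φ with i ∈ C, α C ≤ c B) : 0 ≤ shortage Φ α c i := by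
  rw [shortage_eq, sub_nonneg]
  rcases (Φ.filter (i ∈ ·)).eq_empty_or_nonempty with h | h
  · simp [h]
  have hD : 0 < ∑ C ∈ Φ with i ∈ C, α C :=
    Finset.sum_pos (fun B hB => hα B (Finset.mem_filter.mp hB).1) h
  calc ∑ B ∈ Φ with i ∈ B, α B / c B
      ≤ ∑ B ∈ Φ with i ∈ B, α B / ∑ C ∈ Φ with i ∈ C, α C := by
        refine Finset.sum_le_sum fun B hB => ?_
        rw [Finset.mem_filter] at hB
        have := hα B hB.1
        have := hc B hB.1 hB.2
        gcongr
    _ = 1 := by rw [← Finset.sum_div, div_self hD.ne']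

theorem sum_shortage [Fintype ι] (Φ : Finset (Finset ι)) (α c : Finset ι → ℝ) :
    ∑ i, shortage Φ α c i = Fintype.card ι - ∑ B ∈ Φ, B.card * (α B / c B) := by
  simp_rw [shortage_eq, Finset.sum_sub_distrib, sum_filter_mem_eq]
  simp

end

/-- A weighted family of sets of size about `M` which is close to the `s` parts of a partition,
each of weight about `1 / s`. -/
structure NearPartition {ι : Type*} [Fintype ι] [DecidableEq ι] (Φ : Finset (Finset ι))
    (α c : Finset ι → ℝ) (s M : ℝ) : Prop where
  weight_pos : ∀ B ∈ Φ, 0 < α B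
  s_pos : 0 < s
  M_pos : 0 < M
  le_card : ∀ B ∈ Φ, 97 / 100 * M ≤ B.card
  card_le : ∀ B ∈ Φ, (B.card : ℝ) ≤ 103 / 100 * M
  le_mul : ∀ B ∈ Φ, 99 / 100 ≤ s * c B
  mul_le : ∀ B ∈ Φ, s * c B ≤ 101 / 100
  meet_le : ∀ B ∈ Φ, ∑ C ∈ Φ with ¬ Disjoint B C, α C ≤ c B
  sum_shortage_le : ∑ i, shortage Φ α c i ≤ M / 10000

namespace NearPartition

section
variable {ι : Type*} [DecidableEq ι] {Φ : Finset (Finset ι)} {α c : Finset ι → ℝ}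

/-- Two sets are linked if they share a point of small shortage. -/
def Linked (Φ : Finset (Finset ι)) (α c : Finset ι → ℝ) (B C : Finset ι) : Prop :=
  ∃ i ∈ B ∩ C, shortage Φ α c i ≤ 1 / 100

theorem Linked.symm {B C : Finset ι} (h : Linked Φ α c B C) : Linked Φ α c C B := by
  obtain ⟨i, hi, h⟩ := h
  exact ⟨i, by rwa [Finset.inter_comm], h⟩

theorem Linked.not_disjoint {B C : Finset ι} (h : Linked Φ α c B C) : ¬ Disjoint B C := by
  obtain ⟨i, hi, h⟩ := h
  rw [Finset.mem_inter] at hi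
  exact Finset.not_disjoint_iff.mpr ⟨i, hi.1, hi.2⟩

end

variable {ι : Type*} [Fintype ι] [DecidableEq ι] {Φ : Finset (Finset ι)}
  {α c : Finset ι → ℝ} {s M : ℝ}

section
variable (h : NearPartition Φ α c s M)
include h

theorem c_pos {B : Finset ι} (hB : B ∈ Φ) : 0 < c B := by
  have := h.le_mul B hB
  exact pos_of_mul_pos_right (by linarith : 0 < s * c B) h.s_pos.le

theorem sum_mem_le {B : Finset ι} (hB : B ∈ Φ) {p : Finset ι → Prop} [DecidablePred p]
    (hp : ∀ C ∈ Φ, p C → ¬ Disjoint B C) : ∑ C ∈ Φ with p C, α C ≤ c B := by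
  refine le_trans ?_ (h.meet_le B hB)
  refine Finset.sum_le_sum_of_subset_of_nonneg ?_ fun C hC _ =>
    (h.weight_pos C (Finset.mem_filter.mp hC).1).le
  intro C hC
  rw [Finset.mem_filter] at hC ⊢
  exact ⟨hC.1, hp C hC.1 hC.2⟩

theorem shortage_nonneg (i : ι) : 0 ≤ shortage Φ α c i :=
  _root_.shortage_nonneg h.weight_pos fun _ hB hi =>
    h.sum_mem_le hB fun _ _ hi' => Finset.not_disjoint_iff.mpr ⟨i, hi, hi'⟩

theorem le_card_good (X : Finset ι) :
    (X.card : ℝ) - M / 100 ≤ (X.filter fun i => shortage Φ α c i ≤ 1 / 100).card := by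
  have h1 : ∑ i ∈ X with ¬ shortage Φ α c i ≤ 1 / 100, (1 / 100 : ℝ) ≤ M / 10000 := by
    refine le_trans ?_ h.sum_shortage_le
    refine (Finset.sum_le_sum fun i hi => ?_).trans
      (Finset.sum_le_sum_of_subset_of_nonneg (Finset.subset_univ _) fun i _ _ =>
        h.shortage_nonneg i)
    exact (not_le.mp (Finset.mem_filter.mp hi).2).le
  rw [Finset.sum_const, nsmul_eq_mul] at h1
  have h2 := Finset.card_filter_add_card_filter_not (s := X)
    (fun i => shortage Φ α c i ≤ 1 / 100)
  have h3 : ((X.filter fun i => shortage Φ α c i ≤ 1 / 100).card : ℝ)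
      + (X.filter fun i => ¬ shortage Φ α c i ≤ 1 / 100).card = X.card := by exact_mod_cast h2
  linarith

theorem exists_good {X : Finset ι} (hX : M / 100 < X.card) :
    ∃ i ∈ X, shortage Φ α c i ≤ 1 / 100 := by
  have h1 := h.le_card_good X
  have h2 : (0 : ℝ) < (X.filter fun i => shortage Φ α c i ≤ 1 / 100).card := by linarith
  obtain ⟨i, hi⟩ := Finset.card_pos.mp (by exact_mod_cast h2)
  exact ⟨i, Finset.mem_filter.mp hi⟩

theorem linked_refl {B : Finset ι} (hB : B ∈ Φ) : Linked Φ α c B B := by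
  have := h.le_card B hB
  have := h.M_pos
  obtain ⟨i, hi⟩ := h.exists_good (X := B) (by linarith)
  exact ⟨i, by simpa using hi.1, hi.2⟩

theorem le_degree {i : ι} (hi : shortage Φ α c i ≤ 1 / 100) :
    98 / 100 ≤ s * ∑ B ∈ Φ with i ∈ B, α B := by
  rw [shortage_eq] at hi
  have h1 : ∑ B ∈ Φ with i ∈ B, α B / c B ≤ ∑ B ∈ Φ with i ∈ B, 100 / 99 * (s * α B) := by
    refine Finset.sum_le_sum fun B hB => ?_
    have hB := (Finset.mem_filter.mp hB).1
    have h2 := h.le_mul B hB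
    have h3 := h.weight_pos B hB
    rw [div_le_iff₀ (h.c_pos hB)]
    nlinarith
  rw [← Finset.mul_sum, ← Finset.mul_sum] at h1
  linarith

theorem le_codegree {B : Finset ι} (hB : B ∈ Φ) {i j : ι} (hiB : i ∈ B) (hjB : j ∈ B)
    (hi : shortage Φ α c i ≤ 1 / 100) (hj : shortage Φ α c j ≤ 1 / 100) :
    95 / 100 ≤ s * ∑ X ∈ Φ with i ∈ X ∧ j ∈ X, α X := by
  have h1 := h.le_degree hi
  have h2 := h.le_degree hj
  have h3 : ∑ X ∈ Φ with i ∈ X ∨ j ∈ X, α X ≤ c B := h.sum_mem_le hB fun C _ hC =>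
    Finset.not_disjoint_iff.mpr (hC.elim (fun hC => ⟨i, hiB, hC⟩) (fun hC => ⟨j, hjB, hC⟩))
  have h4 : ∑ X ∈ Φ with i ∈ X ∨ j ∈ X, α X + ∑ X ∈ Φ with i ∈ X ∧ j ∈ X, α X
      = ∑ X ∈ Φ with i ∈ X, α X + ∑ X ∈ Φ with j ∈ X, α X := by
    rw [Finset.filter_or, Finset.filter_and, Finset.sum_union_inter]
  have h5 := mul_le_mul_of_nonneg_left h3 h.s_pos.le
  have h6 := h.mul_le B hB
  have h7 := congrArg (s * ·) h4
  simp only [mul_add] at h7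
  linarith

theorem le_sum_card_inter {B : Finset ι} (hB : B ∈ Φ) {i : ι} (hiB : i ∈ B)
    (hi : shortage Φ α c i ≤ 1 / 100) :
    912 / 1000 * M ≤ s * ∑ X ∈ Φ with i ∈ X, ((X ∩ B).card : ℝ) * α X := by
  have h1 : ∑ j ∈ B with shortage Φ α c j ≤ 1 / 100, (95 / 100 : ℝ)
      ≤ ∑ j ∈ B, s * ∑ X ∈ Φ with i ∈ X ∧ j ∈ X, α X := by
    refine (Finset.sum_le_sum fun j hj => ?_).trans
      (Finset.sum_le_sum_of_subset_of_nonneg (Finset.filter_subset _ _) fun j _ _ => ?_)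
    · rw [Finset.mem_filter] at hj
      exact h.le_codegree hB hiB hj.1 hi hj.2
    · exact mul_nonneg h.s_pos.le (Finset.sum_nonneg fun X hX =>
        (h.weight_pos X (Finset.mem_filter.mp hX).1).le)
  rw [Finset.sum_const, nsmul_eq_mul, ← Finset.mul_sum] at h1
  simp_rw [← Finset.filter_filter] at h1
  rw [sum_filter_mem_eq] at h1
  have h2 := h.le_card_good B
  have h3 := h.le_card B hB
  linarith

theorem Linked.le_card_inter {B C : Finset ι} (hB : B ∈ Φ) (hC : C ∈ Φ)
    (hBC : Linked Φ α c B C) : 77 / 100 * M ≤ (B ∩ C).card := by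
  obtain ⟨i, hi, hs⟩ := hBC
  rw [Finset.mem_inter] at hi
  have h1 := h.le_sum_card_inter hB hi.1 hs
  have h2 := h.le_sum_card_inter hC hi.2 hs
  have h3 : ∑ X ∈ Φ with i ∈ X, ((X ∩ B).card : ℝ) * α X
      + ∑ X ∈ Φ with i ∈ X, ((X ∩ C).card : ℝ) * α X
      ≤ (103 / 100 * M + (B ∩ C).card) * ∑ X ∈ Φ with i ∈ X, α X := by
    rw [← Finset.sum_add_distrib, Finset.mul_sum]
    refine Finset.sum_le_sum fun X hX => ?_
    have hX := (Finset.mem_filter.mp hX).1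
    have h4 := (h.weight_pos X hX).le
    rw [← add_mul]
    refine mul_le_mul_of_nonneg_right ?_ h4
    have h5 := h.card_le X hX
    have h6 : (X ∩ B).card + (X ∩ C).card ≤ X.card + (B ∩ C).card := by
      rw [← Finset.card_union_add_card_inter]
      exact Nat.add_le_add
        (Finset.card_le_card (Finset.union_subset Finset.inter_subset_left
          Finset.inter_subset_left))
        (Finset.card_le_card (Finset.inter_subset_inter Finset.inter_subset_right
          Finset.inter_subset_right))
    have h7 : ((X ∩ B).card : ℝ) + (X ∩ C).card ≤ X.card + (B ∩ C).card := by exact_mod_cast h6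
    linarith
  have h4 : ∑ X ∈ Φ with i ∈ X, α X ≤ c B :=
    h.sum_mem_le hB fun X _ hX => Finset.not_disjoint_iff.mpr ⟨i, hi.1, hX⟩
  have h5 : s * ∑ X ∈ Φ with i ∈ X, α X ≤ 101 / 100 :=
    (mul_le_mul_of_nonneg_left h4 h.s_pos.le).trans (h.mul_le B hB)
  have h6 := mul_le_mul_of_nonneg_left h3 h.s_pos.le
  have hM := h.M_pos
  have h7 : (103 / 100 * M + (B ∩ C).card) * (s * ∑ X ∈ Φ with i ∈ X, α X)
      ≤ (103 / 100 * M + (B ∩ C).card) * (101 / 100) := by gcongr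
  linarith

theorem Linked.trans {B C E : Finset ι} (hB : B ∈ Φ) (hC : C ∈ Φ) (hE : E ∈ Φ)
    (hBC : Linked Φ α c B C) (hCE : Linked Φ α c C E) : Linked Φ α c B E := by
  have h1 := Linked.le_card_inter h hB hC hBC
  have h2 := Linked.le_card_inter h hC hE hCE
  have h3 := h.card_le C hC
  have h4 : (B ∩ C).card + (C ∩ E).card ≤ C.card + (B ∩ E).card := by
    rw [← Finset.card_union_add_card_inter]
    exact Nat.add_le_add
      (Finset.card_le_card (Finset.union_subset Finset.inter_subset_right
        Finset.inter_subset_left))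
      (Finset.card_le_card (Finset.inter_subset_inter Finset.inter_subset_left
        Finset.inter_subset_right))
  have h5 : ((B ∩ C).card : ℝ) + (C ∩ E).card ≤ C.card + (B ∩ E).card := by exact_mod_cast h4
  have hM := h.M_pos
  exact h.exists_good (by linarith)

open Classical in
/-- A near partition groups into `k` classes; `P B` is the total weight of the class of `B`. -/
theorem exists_classes : ∃ (k : ℕ) (P : Finset ι → ℝ),
    (∀ B ∈ Φ, 0 < P B ∧ P B ≤ ∑ C ∈ Φ with ¬ Disjoint B C, α C) ∧
    ∑ B ∈ Φ, α B / P B = k ∧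
    k - (∑ i, shortage Φ α c i) / (96 / 100 * M) ≤ ∑ B ∈ Φ, α B / c B := by
  have hM := h.M_pos
  let cls : Finset ι → Finset (Finset ι) := fun B => Φ.filter (Linked Φ α c B)
  have mem_cls : ∀ {B C}, C ∈ cls B ↔ C ∈ Φ ∧ Linked Φ α c B C := by
    intro B C; exact Finset.mem_filter
  have cls_eq : ∀ {B C}, B ∈ Φ → C ∈ Φ → Linked Φ α c B C → cls B = cls C := by
    intro B C hB hC hBC
    ext E
    rw [mem_cls, mem_cls]
    exact ⟨fun hE => ⟨hE.1, Linked.trans h hC hB hE.1 hBC.symm hE.2⟩,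
      fun hE => ⟨hE.1, Linked.trans h hB hC hE.1 hBC hE.2⟩⟩
  have fiber : ∀ B ∈ Φ, Φ.filter (cls · = cls B) = cls B := by
    intro B hB
    ext C
    rw [mem_cls, Finset.mem_filter]
    refine and_congr_right fun hC => ⟨fun e => ?_, fun e => (cls_eq hB hC e).symm⟩
    have : C ∈ cls C := mem_cls.mpr ⟨hC, h.linked_refl hC⟩
    rw [e] at this
    exact (mem_cls.mp this).2
  have hpos : ∀ B ∈ Φ, 0 < ∑ C ∈ cls B, α C := fun B hB =>
    Finset.sum_pos (fun C hC => h.weight_pos C (mem_cls.mp hC).1)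
      ⟨B, mem_cls.mpr ⟨hB, h.linked_refl hB⟩⟩
  refine ⟨(Φ.image cls).card, fun B => ∑ C ∈ cls B, α C, fun B hB => ⟨hpos B hB, ?_⟩, ?_, ?_⟩
  · refine Finset.sum_le_sum_of_subset_of_nonneg ?_ fun C hC _ =>
      (h.weight_pos C (Finset.mem_filter.mp hC).1).le
    intro C hC
    rw [mem_cls] at hC
    exact Finset.mem_filter.mpr ⟨hC.1, hC.2.not_disjoint⟩
  · rw [← Finset.sum_fiberwise_of_maps_to (t := Φ.image cls) (g := cls)
      fun B hB => Finset.mem_image_of_mem _ hB]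
    rw [Finset.card_eq_sum_ones, Nat.cast_sum]
    refine Finset.sum_congr rfl fun K hK => ?_
    obtain ⟨B, hB, rfl⟩ := Finset.mem_image.mp hK
    have e : ∀ C ∈ Φ.filter (cls · = cls B),
        α C / ∑ E ∈ cls C, α E = α C / ∑ E ∈ cls B, α E := fun C hC => by
      rw [(Finset.mem_filter.mp hC).2]
    rw [Finset.sum_congr rfl e, ← Finset.sum_div, fiber B hB, div_self (hpos B hB).ne',
      Nat.cast_one]
  · have hrep : ∀ K ∈ Φ.image cls, ∃ B ∈ Φ, cls B = K := fun K hK => Finset.mem_image.mp hK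
    choose! r hr hrc using hrep
    let G : Finset (Finset ι) → Finset ι := fun K =>
      (r K).filter fun i => shortage Φ α c i ≤ 1 / 100
    have hG : ∀ K ∈ Φ.image cls, 96 / 100 * M ≤ (G K).card := by
      intro K hK
      have h1 := h.le_card_good (r K)
      have h2 := h.le_card _ (hr K hK)
      change _ ≤ (((r K).filter fun i => shortage Φ α c i ≤ 1 / 100).card : ℝ)
      linarith
    have hdisj : (Φ.image cls : Set (Finset (Finset ι))).PairwiseDisjoint G := by
      intro K hK L hL hKL
      rw [Function.onFun, Finset.disjoint_left]
      intro i hi hi'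
      have hi := Finset.mem_filter.mp hi
      have hi' := Finset.mem_filter.mp hi'
      apply hKL
      rw [← hrc K hK, ← hrc L hL]
      exact cls_eq (hr K hK) (hr L hL) ⟨i, Finset.mem_inter.mpr ⟨hi.1, hi'.1⟩, hi.2⟩
    have hsum : ∑ K ∈ Φ.image cls, ∑ i ∈ G K, shortage Φ α c i ≤ ∑ i, shortage Φ α c i := by
      rw [← Finset.sum_biUnion hdisj]
      exact Finset.sum_le_sum_of_subset_of_nonneg (Finset.subset_univ _) fun i _ _ =>
        h.shortage_nonneg i
    have hK : ∀ K ∈ Φ.image cls, 1 - (∑ i ∈ G K, shortage Φ α c i) / (96 / 100 * M)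
        ≤ ∑ B ∈ Φ with cls B = K, α B / c B := by
      intro K hK
      have h1 : ∀ i ∈ G K, 1 - shortage Φ α c i ≤ ∑ B ∈ Φ with cls B = K, α B / c B := by
        intro i hi
        rw [shortage_eq, sub_sub_cancel]
        refine Finset.sum_le_sum_of_subset_of_nonneg ?_ fun C hC _ => ?_
        · intro C hC
          rw [Finset.mem_filter] at hC ⊢
          refine ⟨hC.1, ?_⟩
          have hi := Finset.mem_filter.mp hi
          rw [← hrc K hK]
          exact cls_eq hC.1 (hr K hK) ⟨i, Finset.mem_inter.mpr ⟨hC.2, hi.1⟩, hi.2⟩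
        · have hC := (Finset.mem_filter.mp hC).1
          exact div_nonneg (h.weight_pos C hC).le (h.c_pos hC).le
      have h2 := Finset.sum_le_sum h1
      rw [Finset.sum_sub_distrib, Finset.sum_const, Finset.sum_const, nsmul_eq_mul, nsmul_eq_mul,
        mul_one] at h2
      have h3 := hG K hK
      have h4 : 0 ≤ ∑ i ∈ G K, shortage Φ α c i := Finset.sum_nonneg fun i _ =>
        h.shortage_nonneg i
      have h5 : 0 < ((G K).card : ℝ) := by linarith
      calc 1 - (∑ i ∈ G K, shortage Φ α c i) / (96 / 100 * M)
          ≤ 1 - (∑ i ∈ G K, shortage Φ α c i) / (G K).card := by gcongr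
        _ ≤ _ := by
          rw [sub_le_iff_le_add, ← sub_le_iff_le_add', le_div_iff₀ h5]
          linarith
    have h6 := Finset.sum_le_sum hK
    rw [Finset.sum_fiberwise_of_maps_to (fun B hB => Finset.mem_image_of_mem _ hB),
      Finset.sum_sub_distrib, ← Finset.sum_div, Finset.sum_const, nsmul_eq_mul, mul_one] at h6
    refine le_trans ?_ h6
    gcongr

end

end NearPartition

/-- The total weight of the members of `Ω` meeting `A`. -/
noncomputable def meetWeight {ι : Type*} [DecidableEq ι] (Ω : Finset (Finset ι))
    (α : Finset ι → ℝ) (A : Finset ι) : ℝ :=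
  ∑ B ∈ Ω with ¬ Disjoint A B, α B

/-- A feasible weighted family whose objective is at least the value of a balanced vector with
parts of size `m` and `m + 1`. -/
structure NearOptimal {ι : Type*} [Fintype ι] [DecidableEq ι] (Ω : Finset (Finset ι))
    (α : Finset ι → ℝ) (s m : ℕ) : Prop where
  nonempty : ∀ A ∈ Ω, A.Nonempty
  weight_pos : ∀ A ∈ Ω, 0 < α A
  sum_eq : ∑ A ∈ Ω, α A = 1
  sum_meetWeight_le : s * ∑ A ∈ Ω, α A * meetWeight Ω α A ≤ 1
  le_objective : Real.log m + ((Fintype.card ι : ℝ) / s - m) / chordScale m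
    ≤ ∑ A ∈ Ω, α A * Real.log A.card

/-- The size `m` is large in terms of the number of parts `s`. -/
structure LargeScale (s m : ℕ) : Prop where
  s_pos : 0 < s
  le_m : 500000 ^ 2 ≤ m
  mul_le_mul_sqrt : 10 ^ 14 * (s : ℝ) ≤ chordScale m * √(chordScale m)
  mul_le_mul_log : 20 * (s : ℝ) ≤ chordScale m * (Real.log (chordScale m) / 2 - 3)

/-- A splitting of `Ω` into sets of typical size and typical `u`, small sets, and all other sets,
together with the resulting energy estimate. -/
structure Split {ι : Type*} (Ω 𝓑 𝓢 𝓓 : Finset (Finset ι)) (α u : Finset ι → ℝ)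
    (s M S κ W Γ : ℝ) : Prop where
  sum_eq : ∀ f : Finset ι → ℝ, ∑ A ∈ Ω, f A = ∑ A ∈ 𝓑, f A + (∑ A ∈ 𝓢, f A + ∑ A ∈ 𝓓, f A)
  big_subset : 𝓑 ⊆ Ω
  small_subset : 𝓢 ⊆ Ω
  mid_subset : 𝓓 ⊆ Ω
  big_card : ∀ A ∈ 𝓑, |(A.card : ℝ) - M| ≤ 3 / 100 * M
  big_u : ∀ A ∈ 𝓑, |u A - 1| ≤ 1 / 100
  mid_card : ∀ A ∈ 𝓓, M < (A.card : ℝ) ^ 2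
  S_nonneg : 0 ≤ S
  κ_nonneg : 0 ≤ κ
  W_nonneg : 0 ≤ W
  Γ_nonneg : 0 ≤ Γ
  small_weight : 20 * s * ∑ A ∈ 𝓢, α A ≤ W
  small_card : ∑ A ∈ 𝓢, α A * (A.card / u A) ≤ W
  small_u : M * ∑ A ∈ 𝓢, α A * u A ≤ W
  mid_weight : ∑ A ∈ 𝓓, α A ≤ 500000 * Γ
  mid_card_sum : ∑ A ∈ 𝓓, α A * (A.card / u A) ≤ 500000 * (M * Γ)
  mid_u : ∑ A ∈ 𝓓, α A * u A ≤ 500000 * Γ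
  energy : S / s + κ + M * Γ + W + M / 50 * ∑ A ∈ 𝓑, α A * (u A - 1) ^ 2
    ≤ 21 / 10 * ∑ A ∈ 𝓑, α A * |u A - 1|

namespace LargeScale
variable {s m : ℕ} (h : LargeScale s m)
include h

theorem s_pos' : (0 : ℝ) < s := by exact_mod_cast h.s_pos

theorem le_M : (500000 : ℝ) ^ 2 ≤ chordScale m :=
  le_trans (by exact_mod_cast h.le_m) (le_chordScale (by have := h.le_m; omega))

theorem le_sqrt : 500000 ≤ √(chordScale m) := Real.le_sqrt_of_sq_le h.le_M

theorem le_sq : 10 ^ 14 * (s : ℝ) ≤ chordScale m ^ 2 := by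
  have h0 := h.le_M
  have h1 := h.mul_le_mul_sqrt
  have h2 : √(chordScale m) ≤ chordScale m :=
    Real.sqrt_le_iff.mpr ⟨by linarith, by nlinarith⟩
  nlinarith

end LargeScale

namespace NearOptimal
variable {ι : Type*} [Fintype ι] [DecidableEq ι] {Ω : Finset (Finset ι)} {α : Finset ι → ℝ}
  {s m : ℕ} (h : NearOptimal Ω α s m)
include h

theorem sum_mem_le {A : Finset ι} {p : Finset ι → Prop} [DecidablePred p]
    (hp : ∀ C ∈ Ω, p C → ¬ Disjoint A C) : ∑ C ∈ Ω with p C, α C ≤ meetWeight Ω α A := by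
  refine Finset.sum_le_sum_of_subset_of_nonneg ?_ fun C hC _ =>
    (h.weight_pos C (Finset.mem_filter.mp hC).1).le
  intro C hC
  rw [Finset.mem_filter] at hC ⊢
  exact ⟨hC.1, hp C hC.1 hC.2⟩

theorem weight_le_meetWeight {A : Finset ι} (hA : A ∈ Ω) : α A ≤ meetWeight Ω α A := by
  refine Finset.single_le_sum (f := α)
    (fun C hC => (h.weight_pos C (Finset.mem_filter.mp hC).1).le) ?_
  rw [Finset.mem_filter, disjoint_self]
  exact ⟨hA, (h.nonempty A hA).ne_empty⟩

theorem meetWeight_pos {A : Finset ι} (hA : A ∈ Ω) : 0 < meetWeight Ω α A :=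
  (h.weight_pos A hA).trans_le (h.weight_le_meetWeight hA)

theorem shortage_nonneg {Φ : Finset (Finset ι)} (hΦ : Φ ⊆ Ω) (i : ι) :
    0 ≤ shortage Φ α (meetWeight Ω α) i := by
  refine _root_.shortage_nonneg (fun B hB => h.weight_pos B (hΦ hB)) fun B hB hi => ?_
  refine le_trans ?_ (h.sum_mem_le (p := (i ∈ ·)) fun C _ hC =>
    Finset.not_disjoint_iff.mpr ⟨i, hi, hC⟩)
  exact Finset.sum_le_sum_of_subset_of_nonneg (Finset.filter_subset_filter _ hΦ)
    fun C hC _ => (h.weight_pos C (Finset.mem_filter.mp hC).1).le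

theorem le_sum_density (hm : 0 < m) (hs : 0 < s) :
    (∑ i, shortage Ω α (meetWeight Ω α) i) / s
      + chordScale m * (1 - s * ∑ A ∈ Ω, α A * meetWeight Ω α A)
      ≤ ∑ A ∈ Ω, α A * density m A.card (s * meetWeight Ω α A) := by
  have hs' : (0 : ℝ) < s := by exact_mod_cast hs
  have hm' : (0 : ℝ) < m := by exact_mod_cast hm
  have hM : 0 < chordScale m := hm'.trans_le (le_chordScale hm)
  have h1 : ∀ A ∈ Ω, α A * density m A.card (s * meetWeight Ω α A)
      = chordScale m * (α A * Real.log A.card) + (m + chordScale m - chordScale m * Real.log m)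
        * α A - A.card * (α A / meetWeight Ω α A) / s
        - chordScale m * s * (α A * meetWeight Ω α A) := by
    intro A hA
    have hc := h.meetWeight_pos hA
    have ha : (0 : ℝ) < A.card := by exact_mod_cast (h.nonempty A hA).card_pos
    rw [density, Real.log_div ha.ne' hm'.ne']
    field_simp
    ring
  rw [Finset.sum_congr rfl h1, Finset.sum_sub_distrib, Finset.sum_sub_distrib,
    Finset.sum_add_distrib, ← Finset.mul_sum, ← Finset.mul_sum, ← Finset.sum_div,
    ← Finset.mul_sum, sum_shortage, h.sum_eq]
  have h2 := mul_le_mul_of_nonneg_left h.le_objective hM.le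
  rw [mul_add, mul_div_cancel₀ _ hM.ne'] at h2
  rw [sub_div]
  linarith

open Classical in
theorem exists_split (hL : LargeScale s m) : ∃ (𝓑 𝓢 𝓓 : Finset (Finset ι)) (W Γ : ℝ),
    Split Ω 𝓑 𝓢 𝓓 α (fun A => s * meetWeight Ω α A) s (chordScale m)
      (∑ i, shortage Ω α (meetWeight Ω α) i)
      (chordScale m * (1 - s * ∑ A ∈ Ω, α A * meetWeight Ω α A)) W Γ := by
  have hs := hL.s_pos'
  have hm := hL.le_m
  have hM := hL.le_M
  have hlog := hL.mul_le_mul_log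
  have hmain := h.le_sum_density (by omega) hL.s_pos
  have hκ := h.sum_meetWeight_le
  set M := chordScale m with hMdef
  set u : Finset ι → ℝ := fun A => s * meetWeight Ω α A with hu
  have hu0 : ∀ A ∈ Ω, 0 < u A := fun A hA => mul_pos hs (h.meetWeight_pos hA)
  have ha0 : ∀ A ∈ Ω, (0 : ℝ) < A.card := fun A hA => by exact_mod_cast (h.nonempty A hA).card_pos
  let big : Finset ι → Prop := fun A => |(A.card : ℝ) - M| ≤ 3 / 100 * M ∧ |u A - 1| ≤ 1 / 100
  have hg : ∀ A ∈ Ω, ¬ big A → ∃ g : ℝ, density m A.card (u A) ≤ - M * g ∧ 1 ≤ 500000 * g ∧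
      A.card / u A ≤ 500000 * M * g ∧ u A ≤ 500000 * g := fun A hA hb =>
    density_le_of_not_big (by omega) (ha0 A hA) (hu0 A hA) hb
  choose! g hg1 hg2 hg3 hg4 using hg
  set 𝓑 := Ω.filter big with h𝓑
  set 𝓢 := (Ω.filter fun A => ¬ big A).filter fun A => (A.card : ℝ) ^ 2 ≤ M with h𝓢
  set 𝓓 := (Ω.filter fun A => ¬ big A).filter fun A => ¬ (A.card : ℝ) ^ 2 ≤ M with h𝓓
  have memB : ∀ {A}, A ∈ 𝓑 → A ∈ Ω ∧ big A := fun hA => Finset.mem_filter.mp hA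
  have memS : ∀ {A}, A ∈ 𝓢 → A ∈ Ω ∧ ¬ big A ∧ (A.card : ℝ) ^ 2 ≤ M := fun hA => by
    have := Finset.mem_filter.mp hA
    have h2 := Finset.mem_filter.mp this.1
    exact ⟨h2.1, h2.2, this.2⟩
  have memD : ∀ {A}, A ∈ 𝓓 → A ∈ Ω ∧ ¬ big A ∧ M < (A.card : ℝ) ^ 2 := fun hA => by
    have := Finset.mem_filter.mp hA
    have h2 := Finset.mem_filter.mp this.1
    exact ⟨h2.1, h2.2, not_le.mp this.2⟩
  have hsplit : ∀ f : Finset ι → ℝ,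
      ∑ A ∈ Ω, f A = ∑ A ∈ 𝓑, f A + (∑ A ∈ 𝓢, f A + ∑ A ∈ 𝓓, f A) := fun f => by
    rw [h𝓢, h𝓓, Finset.sum_filter_add_sum_filter_not, h𝓑, Finset.sum_filter_add_sum_filter_not]
  have hαS : ∀ A ∈ 𝓢, 0 < α A := fun A hA => h.weight_pos A (memS hA).1
  have hαD : ∀ A ∈ 𝓓, 0 < α A := fun A hA => h.weight_pos A (memD hA).1
  have hS1 : ∀ A ∈ 𝓢, 0 ≤ (A.card : ℝ) / u A := fun A hA =>
    (div_pos (ha0 A (memS hA).1) (hu0 A (memS hA).1)).le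
  have hS2 : ∀ A ∈ 𝓢, 0 ≤ M * u A := fun A hA =>
    mul_nonneg (by linarith) (hu0 A (memS hA).1).le
  refine ⟨𝓑, 𝓢, 𝓓, ∑ A ∈ 𝓢, α A * (M * (Real.log M / 2 - 3) + A.card / u A + M * u A),
    ∑ A ∈ 𝓓, α A * g A, hsplit, Finset.filter_subset _ _,
    fun A hA => (memS hA).1, fun A hA => (memD hA).1, fun A hA => (memB hA).2.1,
    fun A hA => (memB hA).2.2, fun A hA => (memD hA).2.2,
    Finset.sum_nonneg fun i _ => h.shortage_nonneg subset_rfl i,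
    mul_nonneg (by linarith) (by linarith), ?_, ?_, ?_, ?_, ?_, ?_, ?_, ?_, ?_⟩
  · refine Finset.sum_nonneg fun A hA => mul_nonneg (hαS A hA).le ?_
    linarith [hS1 A hA, hS2 A hA]
  · refine Finset.sum_nonneg fun A hA => mul_nonneg (hαD A hA).le ?_
    linarith [hg2 A (memD hA).1 (memD hA).2.1]
  · rw [Finset.mul_sum]
    refine Finset.sum_le_sum fun A hA => ?_
    rw [mul_comm]
    exact mul_le_mul_of_nonneg_left (by linarith [hS1 A hA, hS2 A hA]) (hαS A hA).le
  · refine Finset.sum_le_sum fun A hA => ?_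
    exact mul_le_mul_of_nonneg_left (by linarith [hS1 A hA, hS2 A hA]) (hαS A hA).le
  · rw [Finset.mul_sum]
    refine Finset.sum_le_sum fun A hA => ?_
    rw [mul_left_comm]
    exact mul_le_mul_of_nonneg_left (by linarith [hS1 A hA, hS2 A hA]) (hαS A hA).le
  · rw [Finset.mul_sum]
    refine Finset.sum_le_sum fun A hA => ?_
    rw [mul_left_comm]
    exact le_mul_of_one_le_right (hαD A hA).le (hg2 A (memD hA).1 (memD hA).2.1)
  · rw [Finset.mul_sum, Finset.mul_sum]
    refine Finset.sum_le_sum fun A hA => ?_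
    rw [mul_left_comm M, mul_left_comm, ← mul_assoc 500000]
    exact mul_le_mul_of_nonneg_left (hg3 A (memD hA).1 (memD hA).2.1) (hαD A hA).le
  · rw [Finset.mul_sum]
    refine Finset.sum_le_sum fun A hA => ?_
    exact (mul_le_mul_of_nonneg_left (hg4 A (memD hA).1 (memD hA).2.1) (hαD A hA).le).trans_eq
      (by ring)
  · have hd := hsplit fun A => α A * density m A.card (u A)
    have e1 : ∑ A ∈ 𝓑, α A * density m A.card (u A)
        ≤ 21 / 10 * ∑ A ∈ 𝓑, α A * |u A - 1| - M / 50 * ∑ A ∈ 𝓑, α A * (u A - 1) ^ 2 := by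
      rw [Finset.mul_sum, Finset.mul_sum, ← Finset.sum_sub_distrib]
      refine Finset.sum_le_sum fun A hA => ?_
      have := mul_le_mul_of_nonneg_left
        (density_le_of_big (by omega) (memB hA).2.1 (memB hA).2.2) (h.weight_pos A (memB hA).1).le
      linarith
    have e2 : ∑ A ∈ 𝓢, α A * density m A.card (u A)
        ≤ - ∑ A ∈ 𝓢, α A * (M * (Real.log M / 2 - 3) + A.card / u A + M * u A) := by
      rw [← Finset.sum_neg_distrib]
      refine Finset.sum_le_sum fun A hA => ?_
      have := mul_le_mul_of_nonneg_left
        (density_le_of_small (u := u A) (by omega) (ha0 A (memS hA).1) (memS hA).2.2) (hαS A hA).le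
      linarith
    have e3 : ∑ A ∈ 𝓓, α A * density m A.card (u A) ≤ - (M * ∑ A ∈ 𝓓, α A * g A) := by
      rw [Finset.mul_sum, ← Finset.sum_neg_distrib]
      refine Finset.sum_le_sum fun A hA => ?_
      have := mul_le_mul_of_nonneg_left (hg1 A (memD hA).1 (memD hA).2.1) (hαD A hA).le
      linarith
    change _ ≤ ∑ A ∈ Ω, α A * density m A.card (u A) at hmain
    linarith

end NearOptimal

theorem NearPartition.sum_excess_le {ι : Type*} [Fintype ι] [DecidableEq ι]
    {Φ Ψ : Finset (Finset ι)} {α c : Finset ι → ℝ} {s M : ℝ} (h : NearPartition Φ α c s M)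
    (hΨ : ∀ A ∈ Ψ, 0 ≤ α A) (p : Finset ι → ι)
    (hΦc : ∀ B ∈ Φ, ∑ C ∈ Φ with ¬ Disjoint B C, α C + ∑ A ∈ Ψ with p A ∈ B, α A ≤ c B)
    (hΨc : ∀ A ∈ Ψ, ∑ B ∈ Φ with p A ∈ B, α B ≤ c A)
    (hsum : ∑ B ∈ Φ, α B + ∑ A ∈ Ψ, α A = 1)
    (hu : s * (∑ B ∈ Φ, α B * c B + ∑ A ∈ Ψ, α A * c A) ≤ 1)
    (hk : ∀ k : ℕ, k - (∑ i, shortage Φ α c i) / (96 / 100 * M) ≤ ∑ B ∈ Φ, α B / c B → k ≤ s) :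
    ∑ B ∈ Φ, α B * (s * c B + 1 / (s * c B) - 2) ≤ 2 * ∑ A ∈ Ψ, α A * shortage Φ α c (p A) := by
  obtain ⟨k, P, hP, hPk, hkN⟩ := h.exists_classes
  have hks := hk k hkN
  have hs := h.s_pos
  have h1 : ∑ B ∈ Φ, α B / c B ≤ k - ∑ B ∈ Φ, ∑ A ∈ Ψ with p A ∈ B, α B / c B ^ 2 * α A := by
    rw [← hPk, ← Finset.sum_sub_distrib]
    refine Finset.sum_le_sum fun B hB => ?_
    rw [← Finset.mul_sum]
    obtain ⟨hP0, hPle⟩ := hP B hB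
    have hc := h.c_pos hB
    have hα := h.weight_pos B hB
    have hn : 0 ≤ ∑ A ∈ Ψ with p A ∈ B, α A := Finset.sum_nonneg fun A hA =>
      hΨ A (Finset.mem_filter.mp hA).1
    have h2 := hΦc B hB
    generalize ∑ A ∈ Ψ with p A ∈ B, α A = n at hn h2
    have h3 : n / c B ^ 2 ≤ 1 / P B - 1 / c B := by
      rw [div_sub_div _ _ hP0.ne' hc.ne', div_le_div_iff₀ (by positivity) (by positivity)]
      have h4 : n ≤ c B - P B := by linarith
      have h5 : P B ≤ c B := by linarith
      calc n * (P B * c B) ≤ (c B - P B) * (c B * c B) := by gcongr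
        _ = _ := by ring
    have h4 := mul_le_mul_of_nonneg_left h3 hα.le
    rw [mul_sub, mul_one_div, mul_one_div] at h4
    have h5 : α B / c B ^ 2 * n = α B * (n / c B ^ 2) := by ring
    linarith
  have h2 : ∑ B ∈ Φ, ∑ A ∈ Ψ with p A ∈ B, α B / c B ^ 2 * α A
      = ∑ A ∈ Ψ, α A * ∑ B ∈ Φ with p A ∈ B, α B / c B ^ 2 := by
    simp_rw [Finset.sum_filter, Finset.mul_sum]
    rw [Finset.sum_comm]
    refine Finset.sum_congr rfl fun A _ => Finset.sum_congr rfl fun B _ => ?_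
    split_ifs <;> ring
  have h3 : ∀ A ∈ Ψ, α A * (2 - s * c A - (∑ B ∈ Φ with p A ∈ B, α B / c B ^ 2) / s)
      ≤ α A * (2 * shortage Φ α c (p A)) := by
    intro A hA
    refine mul_le_mul_of_nonneg_left ?_ (hΨ A hA)
    have h4 := mul_le_mul_of_nonneg_left (hΨc A hA) hs.le
    rw [shortage_eq]
    have h5 : 2 * ∑ B ∈ Φ with p A ∈ B, α B / c B
        ≤ s * ∑ B ∈ Φ with p A ∈ B, α B + (∑ B ∈ Φ with p A ∈ B, α B / c B ^ 2) / s := by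
      rw [Finset.mul_sum, Finset.mul_sum, Finset.sum_div, ← Finset.sum_add_distrib]
      refine Finset.sum_le_sum fun B hB => ?_
      have hB := (Finset.mem_filter.mp hB).1
      have hc := h.c_pos hB
      have hα := h.weight_pos B hB
      have h6 : s * α B + α B / c B ^ 2 / s - 2 * (α B / c B)
          = α B / (s * c B ^ 2) * (s * c B - 1) ^ 2 := by
        field_simp; ring
      have h7 : 0 ≤ α B / (s * c B ^ 2) * (s * c B - 1) ^ 2 := by positivity
      linarith
    linarith
  have h4 := Finset.sum_le_sum h3
  have h5 : ∑ A ∈ Ψ, α A * (2 - s * c A - (∑ B ∈ Φ with p A ∈ B, α B / c B ^ 2) / s)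
      = 2 * ∑ A ∈ Ψ, α A - s * ∑ A ∈ Ψ, α A * c A
        - (∑ A ∈ Ψ, α A * ∑ B ∈ Φ with p A ∈ B, α B / c B ^ 2) / s := by
    rw [Finset.mul_sum, Finset.mul_sum, Finset.sum_div, ← Finset.sum_sub_distrib,
      ← Finset.sum_sub_distrib]
    exact Finset.sum_congr rfl fun A _ => by ring
  have h6 : ∑ B ∈ Φ, α B * (s * c B + 1 / (s * c B) - 2)
      = s * ∑ B ∈ Φ, α B * c B + (∑ B ∈ Φ, α B / c B) / s - 2 * ∑ B ∈ Φ, α B := by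
    rw [Finset.mul_sum, Finset.mul_sum, Finset.sum_div, ← Finset.sum_add_distrib,
      ← Finset.sum_sub_distrib]
    refine Finset.sum_congr rfl fun B hB => ?_
    have hc := h.c_pos hB
    field_simp
  have h7 : 2 * ∑ A ∈ Ψ, α A * shortage Φ α c (p A)
      = ∑ A ∈ Ψ, α A * (2 * shortage Φ α c (p A)) := by
    rw [Finset.mul_sum]; exact Finset.sum_congr rfl fun A _ => by ring
  rw [h2] at h1
  have h8 := div_le_div_of_nonneg_right h1 hs.le
  rw [sub_div] at h8
  have h9 : (k : ℝ) / s ≤ 1 := (div_le_one hs).mpr hks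
  rw [h6, h7]
  linarith

namespace NearOptimal
variable {ι : Type*} [Fintype ι] [DecidableEq ι] {Ω 𝓑 𝓢 𝓓 : Finset (Finset ι)}
  {α : Finset ι → ℝ} {s m : ℕ} {κ W Γ : ℝ}

section
variable (h : NearOptimal Ω α s m)
  (hsp : Split Ω 𝓑 𝓢 𝓓 α (fun A => s * meetWeight Ω α A) s (chordScale m)
    (∑ i, shortage Ω α (meetWeight Ω α) i) κ W Γ)
include h hsp

theorem sum_abs_sq_le :
    (∑ A ∈ 𝓑, α A * |s * meetWeight Ω α A - 1|) ^ 2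
      ≤ ∑ A ∈ 𝓑, α A * (s * meetWeight Ω α A - 1) ^ 2 := by
  have hα : ∀ A ∈ 𝓑, 0 ≤ α A := fun A hA => (h.weight_pos A (hsp.big_subset hA)).le
  have h1 := Finset.sum_sq_le_sum_mul_sum_of_sq_le_mul 𝓑 (f := α)
    (g := fun A => α A * (s * meetWeight Ω α A - 1) ^ 2)
    (r := fun A => α A * |s * meetWeight Ω α A - 1|) hα
    (fun A hA => mul_nonneg (hα A hA) (sq_nonneg _))
    (fun A _ => by rw [mul_pow, sq_abs]; exact le_of_eq (by ring))
  have h2 : ∑ A ∈ 𝓑, α A ≤ 1 := h.sum_eq ▸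
    Finset.sum_le_sum_of_subset_of_nonneg hsp.big_subset fun A hA _ => (h.weight_pos A hA).le
  have h3 : 0 ≤ ∑ A ∈ 𝓑, α A * (s * meetWeight Ω α A - 1) ^ 2 :=
    Finset.sum_nonneg fun A hA => mul_nonneg (hα A hA) (sq_nonneg _)
  exact h1.trans (mul_le_of_le_one_left h3 h2)

theorem sum_sq_le_sum_excess : ∑ A ∈ 𝓑, α A * (s * meetWeight Ω α A - 1) ^ 2
    ≤ 101 / 100 * ∑ A ∈ 𝓑, α A * (s * meetWeight Ω α A + 1 / (s * meetWeight Ω α A) - 2) := by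
  rw [Finset.mul_sum]
  refine Finset.sum_le_sum fun A hA => ?_
  have hα := h.weight_pos A (hsp.big_subset hA)
  have hu := abs_le.mp (hsp.big_u A hA)
  have hu0 : 0 < s * meetWeight Ω α A := by linarith
  generalize s * meetWeight Ω α A = u at hu hu0
  have h2 : (u - 1) ^ 2 ≤ 101 / 100 * (u + 1 / u - 2) := by
    have e : u + 1 / u - 2 = (u - 1) ^ 2 / u := by field_simp; ring
    rw [e, ← mul_div_assoc, le_div_iff₀ hu0]
    have : 0 ≤ (u - 1) ^ 2 * (101 / 100 - u) := mul_nonneg (sq_nonneg _) (by linarith)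
    linarith
  calc α A * (u - 1) ^ 2 ≤ α A * (101 / 100 * (u + 1 / u - 2)) := by gcongr
    _ = _ := by ring

variable (hL : LargeScale s m)
include hL

theorem shortage_big_le (i : ι) : shortage 𝓑 α (meetWeight Ω α) i
    ≤ ∑ i, shortage Ω α (meetWeight Ω α) i + s * W + s * (chordScale m * Γ) := by
  have hs := hL.s_pos'
  have hM := hL.le_M
  have hsq := hL.le_sqrt
  have hS : shortage Ω α (meetWeight Ω α) i ≤ ∑ i, shortage Ω α (meetWeight Ω α) i :=
    Finset.single_le_sum (f := shortage Ω α (meetWeight Ω α))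
      (fun j _ => h.shortage_nonneg subset_rfl j) (Finset.mem_univ i)
  have h1 := hsp.sum_eq fun A => if i ∈ A then α A / meetWeight Ω α A else 0
  rw [shortage_eq, Finset.sum_filter] at hS
  rw [shortage_eq, Finset.sum_filter]
  have key : ∀ A ∈ Ω, ∀ r : ℝ, r ≤ A.card →
      r * (if i ∈ A then α A / meetWeight Ω α A else 0)
      ≤ s * (α A * (A.card / (s * meetWeight Ω α A))) := by
    intro A hA r hr
    have hα := h.weight_pos A hA
    have hc := h.meetWeight_pos hA
    have e : s * (α A * (A.card / (s * meetWeight Ω α A)))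
        = A.card * (α A / meetWeight Ω α A) := by field_simp
    rw [e]
    split_ifs
    · gcongr
    · rw [mul_zero]; positivity
  have h2 : ∑ A ∈ 𝓢, (if i ∈ A then α A / meetWeight Ω α A else 0) ≤ s * W := by
    refine le_trans ?_ (mul_le_mul_of_nonneg_left hsp.small_card hs.le)
    rw [Finset.mul_sum]
    refine Finset.sum_le_sum fun A hA => ?_
    have hA := hsp.small_subset hA
    have := key A hA 1 (by exact_mod_cast (h.nonempty A hA).card_pos)
    rwa [one_mul] at this
  have h3 : √(chordScale m) * ∑ A ∈ 𝓓, (if i ∈ A then α A / meetWeight Ω α A else 0)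
      ≤ s * (500000 * (chordScale m * Γ)) := by
    refine le_trans ?_ (mul_le_mul_of_nonneg_left hsp.mid_card_sum hs.le)
    rw [Finset.mul_sum, Finset.mul_sum]
    refine Finset.sum_le_sum fun A hA => ?_
    exact key A (hsp.mid_subset hA) _ (Real.sqrt_le_iff.mpr ⟨by positivity, (hsp.mid_card A hA).le⟩)
  have h4 : ∑ A ∈ 𝓓, (if i ∈ A then α A / meetWeight Ω α A else 0) ≤ s * (chordScale m * Γ) := by
    have hΓ := hsp.Γ_nonneg
    have : 0 ≤ s * (chordScale m * Γ) := mul_nonneg hs.le (mul_nonneg (by linarith) hΓ)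
    refine le_of_mul_le_mul_left (a := √(chordScale m)) ?_ (by linarith)
    nlinarith
  linarith

theorem sum_shortage_big_le : ∑ i, shortage 𝓑 α (meetWeight Ω α) i
    ≤ ∑ i, shortage Ω α (meetWeight Ω α) i + s * W + s * (500000 * (chordScale m * Γ)) := by
  have hs := hL.s_pos'
  have h1 := hsp.sum_eq fun A => A.card * (α A / meetWeight Ω α A)
  have key : ∀ A ∈ Ω, A.card * (α A / meetWeight Ω α A)
      = s * (α A * (A.card / (s * meetWeight Ω α A))) := by
    intro A hA
    have hc := h.meetWeight_pos hA
    field_simp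
  have h2 := mul_le_mul_of_nonneg_left hsp.small_card hs.le
  have h3 := mul_le_mul_of_nonneg_left hsp.mid_card_sum hs.le
  rw [Finset.mul_sum, ← Finset.sum_congr rfl fun A hA => key A (hsp.small_subset hA)] at h2
  rw [Finset.mul_sum, ← Finset.sum_congr rfl fun A hA => key A (hsp.mid_subset hA)] at h3
  rw [sum_shortage 𝓑]
  have h4 := sum_shortage Ω α (meetWeight Ω α)
  linarith

theorem nearPartition_big
    (hS : ∑ i, shortage 𝓑 α (meetWeight Ω α) i ≤ chordScale m / 10000) :
    NearPartition 𝓑 α (meetWeight Ω α) s (chordScale m) where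
  weight_pos A hA := h.weight_pos A (hsp.big_subset hA)
  s_pos := hL.s_pos'
  M_pos := by linarith [hL.le_M]
  le_card A hA := by linarith [(abs_le.mp (hsp.big_card A hA)).1]
  card_le A hA := by linarith [(abs_le.mp (hsp.big_card A hA)).2]
  le_mul A hA := by linarith [(abs_le.mp (hsp.big_u A hA)).1]
  mul_le A hA := by linarith [(abs_le.mp (hsp.big_u A hA)).2]
  meet_le A hA := by
    refine Finset.sum_le_sum_of_subset_of_nonneg (Finset.filter_subset_filter _ hsp.big_subset)
      fun C hC _ => (h.weight_pos C (Finset.mem_filter.mp hC).1).le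
  sum_shortage_le := hS

theorem sum_div_big_le
    (hκ : κ = chordScale m * (1 - s * ∑ A ∈ Ω, α A * meetWeight Ω α A)) :
     ∑ A ∈ 𝓑, α A / meetWeight Ω α A
    ≤ s * (1 + 100 / 99 * ∑ A ∈ 𝓑, α A * (s * meetWeight Ω α A - 1) ^ 2
      + (κ + W + 500000 * (chordScale m * Γ)) / chordScale m) := by
  have hs := hL.s_pos'
  have hM : 0 < chordScale m := by linarith [hL.le_M]
  have h1 : ∑ A ∈ 𝓑, α A / meetWeight Ω α A ≤ ∑ A ∈ 𝓑, s * (2 * α A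
      + 100 / 99 * (α A * (s * meetWeight Ω α A - 1) ^ 2) - α A * (s * meetWeight Ω α A)) := by
    refine Finset.sum_le_sum fun A hA => ?_
    have hα := h.weight_pos A (hsp.big_subset hA)
    have hc := h.meetWeight_pos (hsp.big_subset hA)
    have hu := (abs_le.mp (hsp.big_u A hA)).1
    have e : α A / meetWeight Ω α A = s * (α A * (1 / (s * meetWeight Ω α A))) := by field_simp
    have hu0 : 0 < s * meetWeight Ω α A := by positivity
    rw [e]
    generalize s * meetWeight Ω α A = u at hu hu0
    have h2 : 1 / u ≤ 2 + 100 / 99 * (u - 1) ^ 2 - u := by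
      rw [div_le_iff₀ hu0]
      have : 0 ≤ (u - 1) ^ 2 * (u - 99 / 100) := mul_nonneg (sq_nonneg _) (by linarith)
      linarith
    calc s * (α A * (1 / u)) ≤ s * (α A * (2 + 100 / 99 * (u - 1) ^ 2 - u)) := by gcongr
      _ = _ := by ring
  refine h1.trans ?_
  rw [← Finset.mul_sum, Finset.sum_sub_distrib, Finset.sum_add_distrib, ← Finset.mul_sum,
    ← Finset.mul_sum]
  refine mul_le_mul_of_nonneg_left ?_ hs.le
  have h2 : ∑ A ∈ 𝓑, α A ≤ 1 := h.sum_eq ▸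
    Finset.sum_le_sum_of_subset_of_nonneg hsp.big_subset fun A hA _ => (h.weight_pos A hA).le
  have h3 := hsp.sum_eq fun A => α A * (s * meetWeight Ω α A)
  have h4 : ∑ A ∈ Ω, α A * (s * meetWeight Ω α A) = s * ∑ A ∈ Ω, α A * meetWeight Ω α A := by
    rw [Finset.mul_sum]; exact Finset.sum_congr rfl fun A _ => by ring
  have h5 := hsp.small_u
  have h6 := mul_le_mul_of_nonneg_left hsp.mid_u hM.le
  have h7 : 1 - ∑ A ∈ 𝓑, α A * (s * meetWeight Ω α A)
      ≤ (κ + W + 500000 * (chordScale m * Γ)) / chordScale m := by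
    rw [le_div_iff₀ hM, hκ, ← h4, h3]
    linarith
  linarith

end

theorem energy_bounds {M C T X : ℝ} (hM : 0 < M) (hC : 0 ≤ C) (hX : T ^ 2 ≤ X)
    (h : C + M / 50 * X ≤ 21 / 10 * T) :
    M * C ≤ 441 / 2 ∧ M ^ 2 * X ≤ 11025 ∧ C ^ 2 ≤ 441 / 100 * X := by
  have h1 : M * T ≤ 105 := by
    by_contra! hc
    have hT0 : 0 < T := pos_of_mul_pos_right (by linarith) hM.le
    have h2 : M * T ^ 2 ≤ M * X := by gcongr
    nlinarith
  have hX0 : 0 ≤ X := (sq_nonneg T).trans hX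
  have hMX : 0 ≤ M / 50 * X := by positivity
  refine ⟨?_, ?_, ?_⟩
  · nlinarith
  · have : M * (C + M / 50 * X) ≤ M * (21 / 10 * T) := by gcongr
    have : 0 ≤ M * C := by positivity
    linarith
  · have : C ^ 2 ≤ (21 / 10 * T) ^ 2 := by gcongr; linarith
    linarith

theorem rigid_of_sum_sq_eq_zero (h : NearOptimal Ω α s m) (hL : LargeScale s m)
    (hsp : Split Ω 𝓑 𝓢 𝓓 α (fun A => s * meetWeight Ω α A) s (chordScale m)
      (∑ i, shortage Ω α (meetWeight Ω α) i) 0 0 0)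
    (hκ : 0 = chordScale m * (1 - s * ∑ A ∈ Ω, α A * meetWeight Ω α A))
    (hS : ∑ i, shortage Ω α (meetWeight Ω α) i = 0)
    (hX : ∑ A ∈ 𝓑, α A * (s * meetWeight Ω α A - 1) ^ 2 = 0) :
    (∀ A ∈ Ω, s * meetWeight Ω α A = 1 ∧ (A.card = m ∨ A.card = m + 1)) ∧
      ∀ i, shortage Ω α (meetWeight Ω α) i = 0 := by
  have hden := h.le_sum_density (by have := hL.le_m; omega) hL.s_pos
  have hs := hL.s_pos'
  have hM := hL.le_M
  have hmS := hsp.small_weight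
  have hmD := hsp.mid_weight
  have hΨ : Ω \ 𝓑 = ∅ := by
    by_contra hne
    have h1 : 0 < ∑ A ∈ Ω \ 𝓑, α A := Finset.sum_pos
      (fun A hA => h.weight_pos A (Finset.mem_sdiff.mp hA).1) (Finset.nonempty_iff_ne_empty.mpr hne)
    have e1 := hsp.sum_eq α
    have e2 := Finset.sum_sdiff (f := α) hsp.big_subset
    have h2 : ∑ A ∈ 𝓢, α A ≤ 0 := by
      refine le_of_mul_le_mul_left (a := 20 * (s : ℝ)) ?_ (by positivity)
      linarith
    linarith
  have hu : ∀ A ∈ Ω, s * meetWeight Ω α A = 1 := by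
    intro A hA
    have hA' := Finset.sdiff_eq_empty_iff_subset.mp hΨ hA
    have hα := h.weight_pos A hA
    have := (Finset.sum_eq_zero_iff_of_nonneg (fun A hA => mul_nonneg
      (h.weight_pos A (hsp.big_subset hA)).le (sq_nonneg _))).mp hX A hA'
    have h2 : (s * meetWeight Ω α A - 1) ^ 2 = 0 := by simpa [hα.ne'] using this
    have h3 : s * meetWeight Ω α A - 1 = 0 := by simpa using h2
    linarith
  refine ⟨fun A hA => ⟨hu A hA, ?_⟩, fun i => ?_⟩
  · have hmpos : 0 < m := by have := hL.le_m; omega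
    have hle : ∀ A ∈ Ω, α A * density m A.card (s * meetWeight Ω α A) ≤ 0 := by
      intro A hA
      rw [hu A hA]
      have := chordScale_mul_log_le hmpos (h.nonempty A hA).card_pos
      refine mul_nonpos_of_nonneg_of_nonpos (h.weight_pos A hA).le ?_
      unfold density
      linarith
    rw [hS, ← hκ, zero_div, zero_add] at hden
    have hz := (Finset.sum_eq_zero_iff_of_nonpos hle).mp (le_antisymm (Finset.sum_nonpos hle) hden)
      A hA
    have hα := h.weight_pos A hA
    rw [hu A hA] at hz
    have hz' : density m A.card 1 = 0 := by simpa [hα.ne'] using hz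
    unfold density at hz'
    refine eq_or_eq_succ_of_log_div_eq_chord hmpos (h.nonempty A hA).card_pos ?_
    have h1 : chordScale m * Real.log (A.card / m) = A.card - m := by linarith
    rw [← h1, chordScale]
    have hl : Real.log (1 + 1 / (m : ℝ)) ≠ 0 := by
      intro h0
      rw [chordScale, h0] at hM
      simp at hM
    exact le_of_eq (by rw [one_div_mul_eq_div, div_mul_cancel₀ _ hl])
  · exact (Finset.sum_eq_zero_iff_of_nonneg fun i _ => h.shortage_nonneg subset_rfl i).mp
      hS i (Finset.mem_univ i)

set_option maxHeartbeats 1000000 in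
/-- A nearly optimal family is rigid: every member meets total weight exactly `1 / s`, has size
`m` or `m + 1`, and no point has any shortage. -/
theorem rigid (h : NearOptimal Ω α s m) (hL : LargeScale s m) :
    (∀ A ∈ Ω, s * meetWeight Ω α A = 1 ∧ (A.card = m ∨ A.card = m + 1)) ∧
      ∀ i, shortage Ω α (meetWeight Ω α) i = 0 := by
  obtain ⟨𝓑, 𝓢, 𝓓, W, Γ, hsp⟩ := h.exists_split hL
  have hden := h.le_sum_density (by have := hL.le_m; omega) hL.s_pos
  obtain ⟨κ, hκ⟩ : ∃ κ, κ = chordScale m * (1 - s * ∑ A ∈ Ω, α A * meetWeight Ω α A) := ⟨_, rfl⟩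
  rw [← hκ] at hsp hden
  have hs := hL.s_pos'
  have hs1 : (1 : ℝ) ≤ s := by exact_mod_cast hL.s_pos
  have hM := hL.le_M
  have hsq := hL.le_sqrt
  have hMs := hL.mul_le_mul_sqrt
  have hM2 := hL.le_sq
  have hcs := h.sum_abs_sq_le hsp
  have hsh1 := h.shortage_big_le hsp hL
  have hsh2 := h.sum_shortage_big_le hsp hL
  have hN := h.sum_div_big_le hsp hL hκ
  have hexc := h.sum_sq_le_sum_excess hsp
  have hen := hsp.energy
  have hmS := hsp.small_weight
  have hmD := hsp.mid_weight
  have hS0 := hsp.S_nonneg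
  have hκ0 := hsp.κ_nonneg
  have hW0 := hsp.W_nonneg
  have hΓ0 := hsp.Γ_nonneg
  have hnear := h.nearPartition_big hsp hL
  set M := chordScale m with hMdef
  obtain ⟨S, hS⟩ : ∃ S, S = ∑ i, shortage Ω α (meetWeight Ω α) i := ⟨_, rfl⟩
  rw [← hS] at hsh1 hsh2 hen hS0 hden
  obtain ⟨R, hR⟩ : ∃ R, R = ∑ i, shortage 𝓑 α (meetWeight Ω α) i := ⟨_, rfl⟩
  rw [← hR] at hsh2 hnear
  obtain ⟨X, hX⟩ : ∃ X, X = ∑ A ∈ 𝓑, α A * (s * meetWeight Ω α A - 1) ^ 2 := ⟨_, rfl⟩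
  rw [← hX] at hcs hen hexc hN
  have hM0 : 0 < M := by linarith
  have hMΓ : 0 ≤ M * Γ := by positivity
  have hSs : 0 ≤ S / s := by positivity
  have hSS : S = s * (S / s) := by field_simp
  obtain ⟨C, hC⟩ : ∃ C, C = S / s + κ + M * Γ + W := ⟨_, rfl⟩
  have hC0 : 0 ≤ C := by rw [hC]; positivity
  rw [← hC] at hen
  obtain ⟨b1, b2, b3⟩ := energy_bounds hM0 hC0 hcs hen
  have hsC : s * C = S + s * κ + s * (M * Γ) + s * W := by rw [hC]; field_simp
  have hsκ : 0 ≤ s * κ := by positivity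
  have hsΓ : 0 ≤ s * (M * Γ) := by positivity
  have hsW : 0 ≤ s * W := by positivity
  have hsh1' : ∀ i, shortage 𝓑 α (meetWeight Ω α) i ≤ s * C := fun i => by linarith [hsh1 i]
  have hR' : R ≤ 500000 * (s * C) := by linarith
  have hMR : M * R ≤ 500000 * (441 / 2) * s := by
    have h1 := mul_le_mul_of_nonneg_left hR' hM0.le
    have h2 := mul_le_mul_of_nonneg_left b1 hs.le
    linarith only [h1, h2]
  have hRM : R ≤ M / 10000 := by
    refine le_of_mul_le_mul_left (a := M) ?_ hM0
    linarith
  replace hnear := hnear hRM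
  have hR0 : 0 ≤ R := hR ▸ Finset.sum_nonneg fun i _ => hnear.shortage_nonneg i
  have hk : ∀ k : ℕ, k - (∑ i, shortage 𝓑 α (meetWeight Ω α) i) / (96 / 100 * M)
      ≤ ∑ B ∈ 𝓑, α B / meetWeight Ω α B → (k : ℝ) ≤ s := by
    intro k hk
    rw [← hR] at hk
    have e1 : R / (96 / 100 * M) ≤ 1 / 4 := by
      rw [div_le_iff₀ (by positivity)]; linarith
    have e2 : s * (100 / 99 * X + (κ + W + 500000 * (M * Γ)) / M) ≤ 1 / 4 := by
      have e3 : M ^ 2 * (s * (100 / 99 * X + (κ + W + 500000 * (M * Γ)) / M))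
          = s * (100 / 99 * (M ^ 2 * X) + M * (κ + W + 500000 * (M * Γ))) := by
        field_simp
      have e4 : M * (κ + W + 500000 * (M * Γ)) ≤ 500000 * (441 / 2) := by
        have : M * (κ + W + 500000 * (M * Γ)) ≤ M * (500000 * C) := by
          gcongr; linarith
        linarith
      refine le_of_mul_le_mul_left (a := M ^ 2) ?_ (by positivity)
      rw [e3]
      have : s * (100 / 99 * (M ^ 2 * X) + M * (κ + W + 500000 * (M * Γ)))
          ≤ s * (100 / 99 * 11025 + 500000 * (441 / 2)) := by gcongr
      linarith
    have : (k : ℝ) < s + 1 := by linarith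
    have : k < s + 1 := by exact_mod_cast this
    exact_mod_cast Nat.lt_succ_iff.mp this
  have hp : ∀ A ∈ Ω, ∃ i ∈ A, A.card * shortage 𝓑 α (meetWeight Ω α) i ≤ R := by
    intro A hA
    obtain ⟨i, hi, hmin⟩ := A.exists_min_image (shortage 𝓑 α (meetWeight Ω α)) (h.nonempty A hA)
    refine ⟨i, hi, ?_⟩
    rw [← nsmul_eq_mul, hR]
    refine (Finset.card_nsmul_le_sum A _ _ hmin).trans ?_
    exact Finset.sum_le_sum_of_subset_of_nonneg (Finset.subset_univ _) fun i _ _ =>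
      hnear.shortage_nonneg i
  have hι : Nonempty ι := by
    obtain ⟨A, hA⟩ : Ω.Nonempty := by
      rw [Finset.nonempty_iff_ne_empty]
      intro h0
      have := h.sum_eq
      rw [h0] at this
      simp at this
    exact ⟨(h.nonempty A hA).choose⟩
  choose! p hpA hpR using hp
  have hsd : ∀ f : Finset ι → ℝ, ∑ A ∈ Ω \ 𝓑, f A = ∑ A ∈ 𝓢, f A + ∑ A ∈ 𝓓, f A := fun f => by
    have e1 := hsp.sum_eq f
    have e2 := Finset.sum_sdiff (f := f) hsp.big_subset
    linarith
  have hF := hnear.sum_excess_le (Ψ := Ω \ 𝓑)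
    (fun A hA => (h.weight_pos A (Finset.mem_sdiff.mp hA).1).le) p ?_ ?_ ?_ ?_ hk
  · rw [hsd] at hF
    have f1 : ∑ A ∈ 𝓢, α A * shortage 𝓑 α (meetWeight Ω α) (p A) ≤ C ^ 2 / 20 := by
      have : ∑ A ∈ 𝓢, α A * shortage 𝓑 α (meetWeight Ω α) (p A) ≤ (∑ A ∈ 𝓢, α A) * (s * C) := by
        rw [Finset.sum_mul]
        exact Finset.sum_le_sum fun A hA => mul_le_mul_of_nonneg_left (hsh1' _)
          (h.weight_pos A (hsp.small_subset hA)).le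
      have h2 : 20 * s * ∑ A ∈ 𝓢, α A ≤ C := by linarith only [hmS, hC, hSs, hκ0, hMΓ]
      have h3 := mul_le_mul_of_nonneg_right h2 hC0
      linarith only [this, h3]
    have f2 : ∑ A ∈ 𝓓, α A * shortage 𝓑 α (meetWeight Ω α) (p A) ≤ C ^ 2 / 400 := by
      have g1 : √M * ∑ A ∈ 𝓓, α A * shortage 𝓑 α (meetWeight Ω α) (p A)
          ≤ (∑ A ∈ 𝓓, α A) * R := by
        rw [Finset.sum_mul, Finset.mul_sum]
        refine Finset.sum_le_sum fun A hA => ?_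
        have hA' := hsp.mid_subset hA
        rw [mul_left_comm]
        refine mul_le_mul_of_nonneg_left (le_trans ?_ (hpR A hA')) (h.weight_pos A hA').le
        refine mul_le_mul_of_nonneg_right ?_ (hnear.shortage_nonneg _)
        exact Real.sqrt_le_iff.mpr ⟨Nat.cast_nonneg _, (hsp.mid_card A hA).le⟩
      have g2 : M * ∑ A ∈ 𝓓, α A ≤ 500000 * C := by
        have := mul_le_mul_of_nonneg_left hmD hM0.le
        linarith
      have g3 : M * √M * ∑ A ∈ 𝓓, α A * shortage 𝓑 α (meetWeight Ω α) (p A)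
          ≤ 500000 * C * (500000 * (s * C)) := by
        calc M * √M * ∑ A ∈ 𝓓, α A * shortage 𝓑 α (meetWeight Ω α) (p A)
            ≤ M * ((∑ A ∈ 𝓓, α A) * R) := by rw [mul_assoc]; gcongr
          _ = M * (∑ A ∈ 𝓓, α A) * R := by ring
          _ ≤ _ := by gcongr
      refine le_of_mul_le_mul_left (a := M * √M) ?_ (by positivity)
      have : 10 ^ 14 * s * (C ^ 2 / 400) ≤ M * √M * (C ^ 2 / 400) := by gcongr
      linarith
    have hC2 : C ^ 2 ≤ 0 := by linarith only [b3, hexc, hF, f1, f2]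
    have hCz : C = 0 := pow_eq_zero_iff two_ne_zero |>.mp (le_antisymm hC2 (sq_nonneg C))
    have hX0 : X = 0 := by
      have : 0 ≤ X := (sq_nonneg _).trans hcs
      rw [hCz] at f1 f2
      linarith only [this, hexc, hF, f1, f2]
    have hSz : S = 0 := by rw [hCz] at hsC; linarith
    have hΓz : M * Γ = 0 := by linarith
    have hΓz' : Γ = 0 := (mul_eq_zero.mp hΓz).resolve_left hM0.ne'
    have hWz : W = 0 := by linarith
    have hκz : κ = 0 := by linarith
    rw [hκz, hWz, hΓz'] at hsp
    exact h.rigid_of_sum_sq_eq_zero hL hsp (hκz ▸ hκ) (hS ▸ hSz) (hX ▸ hX0)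
  · intro B hB
    have hB' := hsp.big_subset hB
    have e := Finset.sum_sdiff (f := fun C => if ¬ Disjoint B C then α C else 0) hsp.big_subset
    unfold meetWeight
    simp_rw [Finset.sum_filter]
    rw [← e, add_comm]
    gcongr with A hA
    have hA' := (Finset.mem_sdiff.mp hA).1
    have hα := h.weight_pos A hA'
    by_cases hpB : p A ∈ B
    · rw [if_pos hpB, if_pos (Finset.not_disjoint_iff.mpr ⟨p A, hpB, hpA A hA'⟩)]
    · rw [if_neg hpB]; split_ifs <;> linarith
  · intro A hA
    have hA' := (Finset.mem_sdiff.mp hA).1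
    refine le_trans ?_ (h.sum_mem_le (p := (p A ∈ ·)) fun C _ hC =>
      Finset.not_disjoint_iff.mpr ⟨p A, hpA A hA', hC⟩)
    exact Finset.sum_le_sum_of_subset_of_nonneg (Finset.filter_subset_filter _ hsp.big_subset)
      fun C hC _ => (h.weight_pos C (Finset.mem_filter.mp hC).1).le
  · rw [add_comm, Finset.sum_sdiff hsp.big_subset, h.sum_eq]
  · rw [add_comm, Finset.sum_sdiff hsp.big_subset]
    exact h.sum_meetWeight_le

end NearOptimal

namespace NearOptimal
variable {ι : Type*} [Fintype ι] [DecidableEq ι] {Ω : Finset (Finset ι)} {α : Finset ι → ℝ}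
  {s m : ℕ}

theorem exists_partition (h : NearOptimal Ω α s m) (hL : LargeScale s m) :
    (∀ A ∈ Ω, ∀ B ∈ Ω, A ≠ B → Disjoint A B) ∧ Ω.biUnion id = Finset.univ ∧ Ω.card = s ∧
      (∀ A ∈ Ω, α A = 1 / (s : ℝ)) ∧ ∀ A ∈ Ω, A.card = m ∨ A.card = m + 1 := by
  obtain ⟨hA, hi⟩ := h.rigid hL
  have hs := hL.s_pos'
  have hmeet : ∀ A ∈ Ω, meetWeight Ω α A = 1 / s := fun A hA' => by
    rw [eq_div_iff hs.ne', mul_comm]; exact (hA A hA').1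
  have hdeg : ∀ i, ∑ B ∈ Ω with i ∈ B, α B = 1 / s := by
    intro i
    have h1 := hi i
    rw [shortage_eq, sub_eq_zero] at h1
    have h2 : ∑ B ∈ Ω with i ∈ B, α B / meetWeight Ω α B = s * ∑ B ∈ Ω with i ∈ B, α B := by
      rw [Finset.mul_sum]
      refine Finset.sum_congr rfl fun B hB => ?_
      rw [hmeet B (Finset.mem_filter.mp hB).1]
      field_simp
    rw [h2] at h1
    rw [eq_div_iff hs.ne', mul_comm, ← h1]
  have hsub : ∀ A ∈ Ω, ∀ B ∈ Ω, ¬ Disjoint A B → A ⊆ B := by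
    intro A hA' B hB hAB j hj
    by_contra hjB
    have h1 : ∑ C ∈ Ω with j ∈ C ∨ C = B, α C ≤ meetWeight Ω α A := h.sum_mem_le fun C _ hC => by
      rcases hC with hC | rfl
      · exact Finset.not_disjoint_iff.mpr ⟨j, hj, hC⟩
      · exact hAB
    have h2 : ∑ C ∈ Ω with j ∈ C ∨ C = B, α C = ∑ C ∈ Ω with j ∈ C, α C + α B := by
      rw [Finset.filter_or, Finset.sum_union, Finset.filter_eq', if_pos hB, Finset.sum_singleton]
      rw [Finset.disjoint_filter]
      rintro C - hC rfl
      exact hjB hC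
    have h3 := h.weight_pos B hB
    rw [h2, hdeg, hmeet A hA'] at h1
    linarith
  have hdisj : ∀ A ∈ Ω, ∀ B ∈ Ω, A ≠ B → Disjoint A B := by
    intro A hA' B hB hne
    by_contra hAB
    exact hne ((hsub A hA' B hB hAB).antisymm (hsub B hB A hA' fun h => hAB h.symm))
  have hw : ∀ A ∈ Ω, α A = 1 / (s : ℝ) := by
    intro A hA'
    rw [← hmeet A hA', meetWeight, Finset.sum_eq_single_of_mem A]
    · rw [Finset.mem_filter, disjoint_self]
      exact ⟨hA', (h.nonempty A hA').ne_empty⟩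
    · intro B hB hne
      rw [Finset.mem_filter] at hB
      exact absurd (hdisj A hA' B hB.1 hne.symm) hB.2
  refine ⟨hdisj, ?_, ?_, hw, fun A hA' => (hA A hA').2⟩
  · refine Finset.eq_univ_of_forall fun i => ?_
    have h1 : (Ω.filter (i ∈ ·)).Nonempty := by
      rw [Finset.nonempty_iff_ne_empty]
      intro h0
      have := hdeg i
      rw [h0, Finset.sum_empty] at this
      have : 0 < 1 / (s : ℝ) := by positivity
      linarith
    obtain ⟨A, hA'⟩ := h1
    rw [Finset.mem_filter] at hA'
    exact Finset.mem_biUnion.mpr ⟨A, hA'⟩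
  · have h1 := h.sum_eq
    rw [Finset.sum_congr rfl hw, Finset.sum_const, nsmul_eq_mul, mul_one_div, div_eq_one_iff_eq
      hs.ne'] at h1
    exact_mod_cast h1

end NearOptimal

section
variable {q : ℕ} {Ω : Finset (Finset (Fin q))} {α : Finset (Fin q) → ℝ}

theorem sum_NEsets_eq (hΩ : ∀ A ∈ Ω, A.Nonempty) {f : Finset (Fin q) → ℝ}
    (hf : ∀ A ∉ Ω, f A = 0) : ∑ A ∈ NEsets q, f A = ∑ A ∈ Ω, f A := by
  refine (Finset.sum_subset (fun A hA => ?_) fun A _ hA => hf A hA).symm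
  exact Finset.mem_filter.mpr ⟨Finset.mem_univ A, hΩ A hA⟩

theorem eQ_eq (hΩ : ∀ A ∈ Ω, A.Nonempty) (h0 : ∀ A ∉ Ω, α A = 0) (h1 : ∑ A ∈ Ω, α A = 1) :
    eQ q α = (1 - ∑ A ∈ Ω, α A * meetWeight Ω α A) / 2 := by
  have h2 : ∀ A ∈ Ω, ∑ B ∈ NEsets q, (if Disjoint A B then α A * α B else 0)
      = α A - α A * meetWeight Ω α A := by
    intro A _
    rw [sum_NEsets_eq hΩ fun B hB => by simp [h0 B hB], ← Finset.sum_filter, ← Finset.mul_sum]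
    have h3 := Finset.sum_filter_add_sum_filter_not Ω (fun B => Disjoint A B) α
    rw [h1] at h3
    rw [meetWeight]
    linear_combination α A * h3
  rw [eQ, sum_NEsets_eq hΩ fun A hA => by simp [h0 A hA], Finset.sum_congr rfl h2,
    Finset.sum_sub_distrib, h1]
  ring

theorem mem_supp {A : Finset (Fin q)} : A ∈ supp q α ↔ A.Nonempty ∧ 0 < α A := by
  simp [supp, NEsets]

theorem Feas.nearOptimal {s : ℕ} (hs : 0 < s) (h : Feas q s α)
    (hobj : Real.log (q / s : ℕ) + ((q : ℝ) / s - (q / s : ℕ)) / chordScale (q / s) ≤ objQ q α) :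
    NearOptimal (supp q α) α s (q / s) := by
  obtain ⟨h0, hnn, hv, he⟩ := h
  have hs' : (0 : ℝ) < s := by exact_mod_cast hs
  have hne : ∀ A ∈ supp q α, A.Nonempty := fun A hA => (mem_supp.mp hA).1
  have hz : ∀ A ∉ supp q α, α A = 0 := by
    intro A hA
    rcases A.eq_empty_or_nonempty with rfl | hA'
    · exact h0
    · rw [mem_supp] at hA
      exact le_antisymm (not_lt.mp fun hp => hA ⟨hA', hp⟩) (hnn A)
  have h1 : ∑ A ∈ supp q α, α A = 1 := by rw [← hv, vQ, sum_NEsets_eq hne hz]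
  refine ⟨hne, fun A hA => (mem_supp.mp hA).2, h1, ?_, ?_⟩
  · rw [eQ_eq hne hz h1, div_le_div_iff₀ (by positivity) two_pos] at he
    linarith
  · rw [Fintype.card_fin]
    rwa [objQ, sum_NEsets_eq hne fun A hA => by simp [hz A hA]] at hobj

end

namespace IsPartitionOf
variable {q : ℕ} {P : Finset (Finset (Fin q))}

theorem sum_card (h : IsPartitionOf q P) : ∑ A ∈ P, A.card = q := by
  have h1 := Finset.card_biUnion (s := P) (t := id) fun A hA B hB hAB => h.2.1 A hA B hB hAB
  rw [h.2.2, Finset.card_univ, Fintype.card_fin] at h1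
  exact h1.symm

theorem card_eq_or (h : IsPartitionOf q P)
    (hb : ∀ A ∈ P, ∀ B ∈ P, |(A.card : ℤ) - (B.card : ℤ)| ≤ 1) {A : Finset (Fin q)} (hA : A ∈ P) :
    A.card = q / P.card ∨ A.card = q / P.card + 1 := by
  have hP : 0 < P.card := Finset.card_pos.mpr ⟨A, hA⟩
  have h1 := Nat.div_mul_le_self q P.card
  have h2 := Nat.lt_div_mul_add (a := q) hP
  have hsum := h.sum_card
  set m := q / P.card
  have hb' : ∀ B ∈ P, B.card ≤ A.card + 1 ∧ A.card ≤ B.card + 1 := fun B hB => by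
    have := abs_le.mp (hb A hA B hB)
    omega
  rcases lt_trichotomy A.card m with h3 | h3 | h3
  · have h4 : ∑ B ∈ P, B.card < ∑ _B ∈ P, m :=
      Finset.sum_lt_sum (fun B hB => by have := hb' B hB; omega) ⟨A, hA, h3⟩
    rw [Finset.sum_const, smul_eq_mul, mul_comm] at h4
    omega
  · exact Or.inl h3
  · refine Or.inr (by_contra fun h5 => ?_)
    have h4 : ∑ _B ∈ P, (m + 1) < ∑ B ∈ P, B.card :=
      Finset.sum_lt_sum (fun B hB => by have := hb' B hB; omega) ⟨A, hA, by omega⟩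
    rw [Finset.sum_const, smul_eq_mul, mul_comm, add_mul, one_mul] at h4
    omega

end IsPartitionOf

namespace IsBalanced
variable {q s : ℕ} {α : Finset (Fin q) → ℝ}

theorem feas (hs : 0 < s) (h : IsBalanced q s α) : Feas q s α := by
  obtain ⟨P, hP, hcard, -, hw, hz⟩ := h
  have hs' : (0 : ℝ) < s := by exact_mod_cast hs
  have h1 : ∑ A ∈ P, α A = 1 := by
    rw [Finset.sum_congr rfl hw, Finset.sum_const, hcard, nsmul_eq_mul]
    field_simp
  have hmeet : ∀ A ∈ P, α A * meetWeight P α A = 1 / s * (1 / s) := by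
    intro A hA
    rw [hw A hA, meetWeight, Finset.sum_eq_single_of_mem A, hw A hA]
    · rw [Finset.mem_filter, disjoint_self]
      exact ⟨hA, (hP.1 A hA).ne_empty⟩
    · intro B hB hne
      rw [Finset.mem_filter] at hB
      exact absurd (hP.2.1 A hA B hB.1 hne.symm) hB.2
  refine ⟨hz _ fun h => Finset.not_nonempty_empty (hP.1 _ h), fun A => ?_, ?_, ?_⟩
  · by_cases hA : A ∈ P
    · rw [hw A hA]; positivity
    · rw [hz A hA]
  · rw [vQ, sum_NEsets_eq hP.1 hz, h1]
  · rw [eQ_eq hP.1 hz h1, Finset.sum_congr rfl hmeet, Finset.sum_const, hcard, nsmul_eq_mul]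
    refine le_of_eq ?_
    field_simp

theorem objQ_eq (hs : 0 < s) (hsq : s ≤ q) (h : IsBalanced q s α) :
    objQ q α = Real.log (q / s : ℕ) + ((q : ℝ) / s - (q / s : ℕ)) / chordScale (q / s) := by
  obtain ⟨P, hP, hcard, hb, hw, hz⟩ := h
  have hs' : (0 : ℝ) < s := by exact_mod_cast hs
  have hm : 0 < q / s := Nat.div_pos hsq hs
  have hlog : ∀ A ∈ P, α A * Real.log A.card = 1 / s * (Real.log (q / s : ℕ)
      + ((A.card : ℝ) - (q / s : ℕ)) / chordScale (q / s)) := by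
    intro A hA
    rw [hw A hA]
    have h1 := hP.card_eq_or hb hA
    rw [hcard] at h1
    generalize q / s = m at *
    have hm' : (0 : ℝ) < m := by exact_mod_cast hm
    rcases h1 with h1 | h1
    · simp [h1]
    · rw [h1, chordScale, Nat.cast_add, Nat.cast_one, add_sub_cancel_left, one_div_one_div,
        ← Real.log_mul (by positivity) (by positivity)]
      congr 2
      field_simp
  have hq : ∑ A ∈ P, (A.card : ℝ) = q := by exact_mod_cast hP.sum_card
  rw [objQ, sum_NEsets_eq hP.1 fun A hA => by simp [hz A hA], Finset.sum_congr rfl hlog,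
    ← Finset.mul_sum, Finset.sum_add_distrib, ← Finset.sum_div, Finset.sum_sub_distrib,
    Finset.sum_const, Finset.sum_const, hcard, hq, nsmul_eq_mul, nsmul_eq_mul]
  field_simp

theorem exists_of_le (hs : 0 < s) (hsq : s ≤ q) : ∃ α, IsBalanced q s α := by
  classical
  obtain ⟨P, hP, hcard⟩ := Finpartition.exists_equipartition_card_eq (Finset.univ : Finset (Fin q))
    hs.ne' (by rwa [Finset.card_univ, Fintype.card_fin])
  refine ⟨fun A => if A ∈ P.parts then 1 / s else 0, P.parts, ⟨fun A hA =>
    P.nonempty_of_mem_parts hA, fun A hA B hB hAB => P.disjoint hA hB hAB, P.biUnion_parts⟩, hcard,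
    fun A hA B hB => ?_, fun A hA => if_pos hA, fun A hA => if_neg hA⟩
  have h1 := hP.card_part_eq_average_iff hA
  have h2 := hP.card_part_eq_average_iff hB
  have h3 := hP.card_parts_eq_average hA
  have h4 := hP.card_parts_eq_average hB
  rw [abs_le]
  omega

theorem of_le_objQ (hs : 0 < s) (hL : LargeScale s (q / s)) (h : Feas q s α)
    (hobj : Real.log (q / s : ℕ) + ((q : ℝ) / s - (q / s : ℕ)) / chordScale (q / s) ≤ objQ q α) :
    IsBalanced q s α := by
  have hn := h.nearOptimal hs hobj
  obtain ⟨hdisj, hcov, hcard, hw, hsize⟩ := hn.exists_partition hL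
  refine ⟨supp q α, ⟨hn.nonempty, hdisj, hcov⟩, hcard, fun A hA B hB => ?_, hw, fun A hA => ?_⟩
  · have h1 := hsize A hA
    have h2 := hsize B hB
    rw [abs_le]
    omega
  · rcases A.eq_empty_or_nonempty with rfl | hA'
    · exact h.1
    · rw [mem_supp] at hA
      exact le_antisymm (not_lt.mp fun hp => hA ⟨hA', hp⟩) (h.2.1 A)

end IsBalanced

theorem exists_largeScale : ∃ s₀ : ℕ, ∀ s : ℕ, s₀ ≤ s → ∀ q : ℕ,
    100 * (s : ℝ) ^ 2 / Real.log s ≤ (q : ℝ) → 0 < s ∧ s ≤ q ∧ LargeScale s (q / s) := by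
  have hpow : Filter.Tendsto (fun s : ℕ => (s : ℝ) ^ (1 / 8 : ℝ)) Filter.atTop Filter.atTop :=
    (tendsto_rpow_atTop (by norm_num)).comp tendsto_natCast_atTop_atTop
  have hloglo := (isLittleO_log_rpow_atTop (r := 1 / 8) (by norm_num)).comp_tendsto
    (tendsto_natCast_atTop_atTop (R := ℝ))
  have hlog : Filter.Tendsto (fun s : ℕ => Real.log s) Filter.atTop Filter.atTop :=
    Real.tendsto_log_atTop.comp tendsto_natCast_atTop_atTop
  have hev : ∀ᶠ s : ℕ in Filter.atTop, 1 < s ∧ 10 ^ 14 ≤ (s : ℝ) ^ (1 / 8 : ℝ) ∧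
      100 ≤ Real.log s ∧ Real.log s ≤ (s : ℝ) ^ (1 / 8 : ℝ) := by
    filter_upwards [Filter.eventually_gt_atTop 1, hpow.eventually_ge_atTop (10 ^ 14),
      hlog.eventually_ge_atTop 100, hloglo.bound one_pos] with s h1 h2 h3 h4
    refine ⟨h1, h2, h3, ?_⟩
    have h5 := (le_abs_self _).trans h4
    simp only [Function.comp_apply, one_mul] at h5
    rwa [Real.norm_of_nonneg (by positivity)] at h5
  obtain ⟨s₀, hs₀⟩ := Filter.eventually_atTop.mp hev
  refine ⟨s₀, fun s hs q hq => ?_⟩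
  obtain ⟨hs1, hbig, hlog, hle⟩ := hs₀ s hs
  have hs0 : 0 < s := by omega
  have hsR : (0 : ℝ) < s := by exact_mod_cast hs0
  set t : ℝ := (s : ℝ) ^ (1 / 8 : ℝ) with ht
  have hst : (s : ℝ) = t ^ 8 := by
    rw [ht, ← Real.rpow_natCast, ← Real.rpow_mul hsR.le]; norm_num
  have ht1 : 1 ≤ t := by linarith
  set L := Real.log s with hLdef
  have hL0 : 0 < L := by linarith
  have hdiv : 100 * (s : ℝ) / L ≤ (q : ℝ) / s := by
    rw [le_div_iff₀ hsR]
    calc _ = 100 * (s : ℝ) ^ 2 / L := by ring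
      _ ≤ _ := hq
  have hm : (q : ℝ) / s < (q / s : ℕ) + 1 := by
    rw [div_lt_iff₀ hsR]
    have := Nat.lt_div_mul_add (a := q) hs0
    have : q < (q / s + 1) * s := by rw [add_mul, one_mul]; exact this
    exact_mod_cast this
  have hL1 : 1 ≤ s / L := by
    rw [one_le_div hL0, hst]
    exact hle.trans (by nlinarith [one_le_pow₀ ht1 (n := 7)])
  have hmge : 99 * (s / L) ≤ ((q / s : ℕ) : ℝ) := by
    have : 100 * (s : ℝ) / L = 100 * (s / L) := by ring
    linarith
  have hm0 : 0 < q / s := by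
    have : (0 : ℝ) < ((q / s : ℕ) : ℝ) := by linarith
    exact_mod_cast this
  have hM := le_chordScale hm0
  have hM0 : 0 ≤ chordScale (q / s) := (Nat.cast_nonneg _).trans hM
  have ht7 : t ^ 7 ≤ s / L := by
    rw [le_div_iff₀ hL0, hst]
    calc t ^ 7 * L ≤ t ^ 7 * t := by gcongr
      _ = t ^ 8 := by ring
  have hmt : t ^ 7 ≤ ((q / s : ℕ) : ℝ) := by linarith
  refine ⟨hs0, (Nat.div_pos_iff.mp hm0).2, hs0, ?_, ?_, ?_⟩
  · have h1 : (500000 : ℝ) ^ 2 ≤ ((q / s : ℕ) : ℝ) := by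
      refine le_trans ?_ hmt
      have : t ^ 1 ≤ t ^ 7 := pow_le_pow_right₀ ht1 (by norm_num)
      linarith
    exact_mod_cast h1
  · have h1 : t ^ 7 ≤ chordScale (q / s) := hmt.trans hM
    have h2 : t ^ 3 ≤ √(chordScale (q / s)) := by
      refine Real.le_sqrt_of_sq_le (le_trans ?_ h1)
      rw [← pow_mul]
      exact pow_le_pow_right₀ ht1 (by norm_num)
    calc 10 ^ 14 * (s : ℝ) ≤ t * t ^ 8 := by rw [hst]; gcongr
      _ ≤ t ^ 10 := by rw [← pow_succ']; exact pow_le_pow_right₀ ht1 (by norm_num)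
      _ = t ^ 7 * t ^ 3 := by ring
      _ ≤ _ := by gcongr
  · have h1 : t ^ 7 ≤ chordScale (q / s) := hmt.trans hM
    have h2 : 7 / 8 * L ≤ Real.log (chordScale (q / s)) := by
      have h3 := Real.log_le_log (by positivity) h1
      have h4 : Real.log (t ^ 7) = 7 / 8 * L := by
        rw [hLdef, hst, Real.log_pow, Real.log_pow]; push_cast; ring
      rwa [h4] at h3
    have h3 : L / 4 ≤ Real.log (chordScale (q / s)) / 2 - 3 := by linarith
    calc 20 * (s : ℝ) ≤ 99 * (s / L) * (L / 4) := by
          have : 99 * (s / L) * (L / 4) = 99 / 4 * s := by field_simp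
          linarith
      _ ≤ _ := mul_le_mul (hmge.trans hM) h3 (by positivity) hM0

/-- For large `s` and `q ≥ 100 s² / log s`, the solutions to `OPT_q(s)` are exactly the
`s`-balanced vectors for `q`. -/
theorem balanced_iff_solution :
    ∃ s₀ : ℕ, ∀ s : ℕ, s₀ ≤ s → ∀ q : ℕ,
      100 * (s : ℝ) ^ 2 / Real.log s ≤ (q : ℝ) →
      ∀ α : Finset (Fin q) → ℝ,
        (IsSolution q (s : ℝ) α ↔ IsBalanced q s α) := by
  obtain ⟨s₀, h⟩ := exists_largeScale
  refine ⟨s₀, fun s hs q hq α => ?_⟩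
  obtain ⟨hs0, hsq, hL⟩ := h s hs q hq
  constructor
  · rintro ⟨hf, hmax⟩
    obtain ⟨β, hβ⟩ := IsBalanced.exists_of_le hs0 hsq
    exact .of_le_objQ hs0 hL hf ((hβ.objQ_eq hs0 hsq).symm.le.trans (hmax β (hβ.feas hs0)))
  · intro hα
    refine ⟨hα.feas hs0, fun β hβ => ?_⟩
    by_contra! hlt
    have h1 := hα.objQ_eq hs0 hsq
    have hβ' := IsBalanced.of_le_objQ hs0 hL hβ (h1.symm.le.trans hlt.le)
    rw [h1, hβ'.objQ_eq hs0 hsq] at hlt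
    exact lt_irrefl _ hlt
end

section
/- For all integers q ≥ s ≥ 1, if α is an s-balanced vector for q, then OBJ_q(α) ≥ log q − log s − s²/(2·q²). -/
theorem sub_one_sub_two_mul_sq_le_log {t : ℝ} (ht : 1 / 2 ≤ t) :
    (t - 1) - 2 * (t - 1) ^ 2 ≤ Real.log t := by
  have ht0 : 0 < t := by linarith
  refine le_trans ?_ (Real.one_sub_inv_le_log_of_pos ht0)
  have h : 1 - t⁻¹ - ((t - 1) - 2 * (t - 1) ^ 2) = (t - 1) ^ 2 * (2 * t - 1) / t := by
    field_simp
    ring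
  have h' : 0 ≤ (t - 1) ^ 2 * (2 * t - 1) / t :=
    div_nonneg (mul_nonneg (sq_nonneg _) (by linarith)) ht0.le
  linarith

theorem log_add_sub_div_sub_le_log {a m : ℝ} (hm : 0 < m) (ha : m ≤ 2 * a) :
    Real.log m + (a - m) / m - 2 * (a - m) ^ 2 / m ^ 2 ≤ Real.log a := by
  have h := sub_one_sub_two_mul_sq_le_log (t := a / m) (by rw [le_div_iff₀ hm]; linarith)
  rw [Real.log_div (by linarith) hm.ne'] at h
  have e : (a / m - 1) - 2 * (a / m - 1) ^ 2 = (a - m) / m - 2 * (a - m) ^ 2 / m ^ 2 := by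
    field_simp
  linarith

theorem IsPartitionOf.sum_card_s19 {q : ℕ} {P : Finset (Finset (Fin q))}
    (hP : IsPartitionOf q P) : ∑ A ∈ P, A.card = q := by
  have h := Finset.card_biUnion (s := P) (t := id) hP.2.1
  rw [hP.2.2, Finset.card_univ, Fintype.card_fin] at h
  exact h.symm

theorem objQ_eq_sum_of_support_subset {q : ℕ} {α : Finset (Fin q) → ℝ}
    {P : Finset (Finset (Fin q))} (hP : ∀ A ∈ P, A.Nonempty) (hα : ∀ A, A ∉ P → α A = 0) :
    objQ q α = ∑ A ∈ P, α A * Real.log (A.card : ℝ) := by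
  refine (Finset.sum_subset (fun A hA => ?_) fun A _ hA => ?_).symm
  · simp [NEsets, hP A hA]
  · simp [hα A hA]

theorem card_mul_log_le_sum_log {ι : Type*} (P : Finset ι) (c : ι → ℝ) {k m : ℝ} (hk : 1 ≤ k)
    (hP : P.Nonempty) (hc : ∀ i ∈ P, c i = k ∨ c i = k + 1) (hsum : ∑ i ∈ P, c i = P.card * m) :
    P.card * (Real.log m - 1 / (2 * m ^ 2)) ≤ ∑ i ∈ P, Real.log (c i) := by
  have hs : (0 : ℝ) < P.card := by exact_mod_cast hP.card_pos
  have hlow : k ≤ m := by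
    refine le_of_mul_le_mul_left ?_ hs
    rw [← hsum, ← nsmul_eq_mul]
    exact Finset.card_nsmul_le_sum _ _ _ fun i hi => by rcases hc i hi with h | h <;> linarith
  have hupp : m ≤ k + 1 := by
    refine le_of_mul_le_mul_left ?_ hs
    rw [← hsum, ← nsmul_eq_mul]
    exact Finset.sum_le_card_nsmul _ _ _ fun i hi => by rcases hc i hi with h | h <;> linarith
  have hm : 0 < m := by linarith
  calc P.card * (Real.log m - 1 / (2 * m ^ 2))
      ≤ P.card * (Real.log m - 2 * ((m - k) * (k + 1 - m)) / m ^ 2) := by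
        refine mul_le_mul_of_nonneg_left (sub_le_sub_left ?_ _) hs.le
        rw [div_le_div_iff₀ (by positivity) (by positivity)]
        nlinarith [mul_nonneg (sq_nonneg m) (sq_nonneg (2 * (m - k) - 1))]
    _ = ∑ i ∈ P, (Real.log m + (c i - m) / m
          - 2 * ((2 * k + 1 - 2 * m) * c i + (m ^ 2 - k * (k + 1))) / m ^ 2) := by
        rw [Finset.sum_sub_distrib, Finset.sum_add_distrib, ← Finset.sum_div, ← Finset.sum_div,
          Finset.sum_sub_distrib, ← Finset.mul_sum, Finset.sum_add_distrib, ← Finset.mul_sum, hsum]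
        simp only [Finset.sum_const, nsmul_eq_mul]
        ring
    _ ≤ ∑ i ∈ P, Real.log (c i) := by
        refine Finset.sum_le_sum fun i hi => ?_
        have e : (2 * k + 1 - 2 * m) * c i + (m ^ 2 - k * (k + 1)) = (c i - m) ^ 2 := by
          rcases hc i hi with h | h <;> rw [h] <;> ring
        rw [e]
        exact log_add_sub_div_sub_le_log hm (by rcases hc i hi with h | h <;> linarith)

/-- For integers `q ≥ s ≥ 1`, the `s`-balanced vector `α` for `q` satisfies
`OBJ_q(α) ≥ log q − log s − s²/(2q²)`. -/
theorem balanced_objective_lower_bound (s q : ℕ) (hs : 1 ≤ s) (hsq : s ≤ q)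
    (α : Finset (Fin q) → ℝ) (hα : IsBalanced q s α) :
    Real.log q - Real.log s - (s : ℝ) ^ 2 / (2 * (q : ℝ) ^ 2) ≤ objQ q α := by
  obtain ⟨P, hP, hcard, hbal, hval, hzero⟩ := hα
  have hPne : P.Nonempty := Finset.card_pos.mp (by omega)
  obtain ⟨A₀, hA₀, hmin⟩ := Finset.exists_min_image P Finset.card hPne
  have hs0 : (0 : ℝ) < s := by exact_mod_cast hs
  have hq0 : (0 : ℝ) < q := by exact_mod_cast hs.trans hsq
  have hc : ∀ A ∈ P, (A.card : ℝ) = A₀.card ∨ (A.card : ℝ) = A₀.card + 1 := by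
    intro A hA
    have h₁ := hmin A hA
    have h₂ := (abs_le.mp (hbal A hA A₀ hA₀)).2
    norm_cast
    omega
  have hsum : ∑ A ∈ P, (A.card : ℝ) = P.card * ((q : ℝ) / s) := by
    rw [hcard, mul_div_cancel₀ _ hs0.ne']
    exact_mod_cast hP.sum_card_s19
  have key := card_mul_log_le_sum_log P (fun A => (A.card : ℝ))
    (by exact_mod_cast (hP.1 A₀ hA₀).card_pos) hPne hc hsum
  rw [objQ_eq_sum_of_support_subset hP.1 hzero,
    Finset.sum_congr rfl fun A hA => by rw [hval A hA], ← Finset.mul_sum, one_div_mul_eq_div,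
    le_div_iff₀' hs0, ← Real.log_div hq0.ne' hs0.ne']
  rw [hcard] at key
  have e : (s : ℝ) ^ 2 / (2 * (q : ℝ) ^ 2) = 1 / (2 * ((q : ℝ) / s) ^ 2) := by
    field_simp
  rw [e]
  exact key
end
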